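/- arXiv:math/0507501 — 3 statements merged into one kernel-verified Lean document; each statement's English description precedes it below -/
import Mathlib

section
/- Assume that the singular locus V_sing of the projective complete intersection V is finite, that V_sing ∩ H = ∅, and that d < d_j for every j = 1, …, k. Then the tangency set T(V,H) = {[x] ∈ ℙ^N(ℂ) : f_1(x) = ⋯ = f_k(x) = 0, h(x) = 0, the gradients d_x f_1, …, d_x f_k are linearly independent, d_x h ≠ 0, and d_x h lies in the ℂ-linear span of d_x f_1, …, d_x f_k} is a finite set. -/
open MvPolynomial

/-- The gradient (vector of partial derivatives) of a polynomial `f` evaluated at `x`. -/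
noncomputable def pgrad {N : ℕ} (f : MvPolynomial (Fin (N + 1)) ℂ) (x : Fin (N + 1) → ℂ) :
    Fin (N + 1) → ℂ :=
  fun i => eval x (pderiv i f)

/-- A full-row-rank family of vectors has a nonvanishing maximal minor. -/
theorem exists_det_submatrix_ne_zero {K m : Type*} [Field K] [Fintype m] {k : ℕ}
    {M : Matrix (Fin k) m K} (hM : LinearIndependent K M.row) :
    ∃ σ : Fin k → m, (M.submatrix id σ).det ≠ 0 := by
  have hr : Module.finrank K (Submodule.span K (Set.range M.col)) = k := by
    rw [← Matrix.rank_eq_finrank_span_cols, hM.rank_matrix, Fintype.card_fin]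
  obtain ⟨w, hw, -, hli⟩ := Submodule.exists_fun_fin_finrank_span_eq K (Set.range M.col)
  choose σ hσ using hw
  refine ⟨σ ∘ Fin.cast hr.symm, ?_⟩
  have hcol : LinearIndependent K (M.submatrix id (σ ∘ Fin.cast hr.symm)).col := by
    convert! hli.comp (Fin.cast hr.symm) (Fin.cast_injective _) using 1
    funext i
    exact hσ _
  rw [Matrix.linearIndependent_cols_iff_isUnit, Matrix.isUnit_iff_isUnit_det] at hcol
  exact hcol.ne_zero

/-- A homogeneous polynomial scales by the power of its degree. -/
theorem MvPolynomial.IsHomogeneous.eval_smul {K σ : Type*} [CommSemiring K]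
    {p : MvPolynomial σ K} {t : ℕ} (hp : p.IsHomogeneous t) (c : K) (x : σ → K) :
    eval (c • x) p = c ^ t * eval x p := by
  rw [eval_eq, eval_eq, Finset.mul_sum]
  refine Finset.sum_congr rfl fun s hs => ?_
  have hdeg := hp.degree_eq_sum_deg_support hs
  simp only [Pi.smul_apply, smul_eq_mul, mul_pow, Finset.prod_mul_distrib,
    Finset.prod_pow_eq_pow_sum]
  rw [show ∑ i ∈ s.support, s i = t from hdeg.symm]
  ring

/-- If multiplication by a nowhere vanishing function lowers the degree of homogeneous forms
of large degree on a set of pairwise non-proportional points, then this set is finite. -/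
theorem finite_of_mul_lowers_degree {K σ ι : Type*} [Field K] [Finite σ] (v : ι → σ → K)
    (hsep : ∀ i j, i ≠ j →
      ∃ l : MvPolynomial σ K, l.IsHomogeneous 1 ∧ eval (v i) l ≠ 0 ∧ eval (v j) l = 0)
    (a : ι → K) (ha : ∀ i, a i ≠ 0) {e r : ℕ} (he : 0 < e) (hr : 0 < r)
    (H : ∀ t, r ≤ t → ∀ g : MvPolynomial σ K, g.IsHomogeneous t →
      ∃ g' : MvPolynomial σ K, g'.IsHomogeneous (t - e) ∧
        ∀ i, a i * eval (v i) g = eval (v i) g') :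
    Finite ι := by
  classical
  let ev : MvPolynomial σ K →ₗ[K] (ι → K) := LinearMap.pi fun i => (aeval (v i)).toLinearMap
  have hev : ∀ g i, ev g i = eval (v i) g := fun g i => by
    simp [ev]
  let B : ℕ → Submodule K (ι → K) := fun t => (homogeneousSubmodule σ K t).map ev
  have hfg : ∀ t, Module.Finite K (B t) := fun t =>
    Module.Finite.iff_fg.mpr ((homogeneousSubmodule_fg σ K t).map ev)
  have hstep : ∀ t, r ≤ t → Module.finrank K (B t) ≤ Module.finrank K (B (t - e)) := by
    intro t ht
    let m : (ι → K) →ₗ[K] (ι → K) := LinearMap.mulLeft K a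
    have hinj : Function.Injective m := by
      intro x y hxy
      funext i
      exact mul_left_cancel₀ (ha i) (congrFun hxy i)
    rw [(Submodule.equivMapOfInjective m hinj (B t)).finrank_eq]
    refine Submodule.finrank_mono ?_
    rintro _ ⟨_, ⟨g, hg, rfl⟩, rfl⟩
    obtain ⟨g', hg', hgg⟩ := H t ht g hg
    refine ⟨g', hg', ?_⟩
    funext i
    simp [m, hev, hgg]
  obtain ⟨C, hC⟩ : ∃ C, ∀ t, Module.finrank K (B t) ≤ C := by
    refine ⟨∑ t ∈ Finset.range r, Module.finrank K (B t), fun t => ?_⟩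
    induction t using Nat.strong_induction_on with
    | _ t ih =>
      by_cases ht : t < r
      · exact Finset.single_le_sum (f := fun t => Module.finrank K (B t))
          (fun _ _ => Nat.zero_le _) (Finset.mem_range.mpr ht)
      · exact (hstep t (by omega)).trans (ih _ (by omega))
  by_contra hfin
  rw [not_finite_iff_infinite] at hfin
  obtain ⟨s, hs⟩ := Infinite.exists_subset_card_eq ι (C + 1)
  choose! l hl1 hl2 hl3 using hsep
  let g : s → MvPolynomial σ K := fun i => ∏ j ∈ s.erase i, l i j
  have hg : ∀ i, (g i).IsHomogeneous C := by
    intro i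
    have := IsHomogeneous.prod (s.erase i) (fun j => l i j) (fun _ => 1)
      (fun j hj => hl1 _ _ (Finset.ne_of_mem_erase hj).symm)
    simpa [Finset.card_erase_of_mem i.2, hs] using this
  have hself : ∀ i : s, ev (g i) i ≠ 0 := by
    intro i
    rw [hev, eval_prod]
    exact Finset.prod_ne_zero_iff.mpr fun j hj => hl2 _ _ (Finset.ne_of_mem_erase hj).symm
  have hother : ∀ i j : s, i ≠ j → ev (g i) j = 0 := by
    intro i j hij
    rw [hev, eval_prod]
    have hij' : (i : ι) ≠ j := fun h => hij (Subtype.ext h)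
    exact Finset.prod_eq_zero (Finset.mem_erase.mpr ⟨hij'.symm, j.2⟩) (hl3 _ _ hij')
  have hli : LinearIndependent K fun i => ev (g i) := by
    rw [Fintype.linearIndependent_iff]
    intro c hc i
    have := congrFun hc i
    rw [Finset.sum_apply, Finset.sum_eq_single i] at this
    · simpa [hself i] using this
    · intro j _ hji
      simp [hother j i hji]
    · simp
  have hcard := finrank_span_eq_card hli
  have hle : Module.finrank K (Submodule.span K (Set.range fun i => ev (g i)))
      ≤ Module.finrank K (B C) := by
    refine Submodule.finrank_mono (Submodule.span_le.mpr ?_)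
    rintro _ ⟨i, rfl⟩
    exact ⟨g i, hg i, rfl⟩
  have := hC C
  simp only [Fintype.card_coe, hs] at hcard
  omega

/-- Two vectors representing distinct projective points are separated by a linear form. -/
theorem exists_linear_form_separating {K σ : Type*} [Field K] {u w : σ → K} (hu : u ≠ 0)
    (hw : w ≠ 0) (huw : Projectivization.mk K u hu ≠ Projectivization.mk K w hw) :
    ∃ l : MvPolynomial σ K, l.IsHomogeneous 1 ∧ eval u l ≠ 0 ∧ eval w l = 0 := by
  obtain ⟨i, hi⟩ := Function.ne_iff.mp hw
  have hi' : w i ≠ 0 := hi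
  by_contra! hcon
  refine huw ((Projectivization.mk_eq_mk_iff' K u w hu hw).mpr ⟨u i / w i, ?_⟩)
  funext m
  have hm : eval u (C (w i) * X m - C (w m) * X i) = 0 := by
    by_contra hne
    refine hcon _ ((isHomogeneous_C_mul_X _ _).sub (isHomogeneous_C_mul_X _ _)) hne ?_
    simp [mul_comm]
  simp only [map_sub, map_mul, eval_C, eval_X] at hm
  simp only [Pi.smul_apply, smul_eq_mul]
  field_simp
  linear_combination -hm

/-- If the only common zero of an ideal is the origin, then the ideal contains all forms of large
degree. -/
theorem exists_homogeneous_mem_of_zeroLocus_subset {K σ : Type*} [Field K] [IsAlgClosed K]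
    [Finite σ] (I : Ideal (MvPolynomial σ K))
    (hI : ∀ x : σ → K, (∀ p ∈ I, eval x p = 0) → x = 0) :
    ∃ r, ∀ t, r ≤ t → ∀ g : MvPolynomial σ K, g.IsHomogeneous t → g ∈ I := by
  obtain ⟨r, hr⟩ := I.exists_radical_pow_le_of_fg I.radical.fg_of_isNoetherianRing
  refine ⟨r, fun t ht g hg => ?_⟩
  refine hr (Ideal.pow_le_pow_right ht ?_)
  have hX : ∀ i : σ, X i ∈ I.radical := by
    intro i
    rw [← vanishingIdeal_zeroLocus_eq_radical (K := K), mem_vanishingIdeal_iff]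
    intro x hx
    have : x = 0 := hI x fun p hp => by
      simpa [coe_aeval_eq_eval] using hx p hp
    simp [this]
  rw [g.as_sum]
  refine Ideal.sum_mem _ fun s hs => ?_
  have hdeg := hg.degree_eq_sum_deg_support hs
  rw [monomial_eq]
  refine Ideal.mul_mem_left _ _ ?_
  rw [hdeg, Finsupp.prod, ← Finset.prod_pow_eq_pow_sum]
  exact Ideal.prod_mem_prod fun i _ => Ideal.pow_mem_pow (hX i) _

/-- The ideal generated by the `f j`, by `h`, and by the maximal minors of the Jacobian matrix of
the `f j`. -/
noncomputable def jacobianIdeal {K σ : Type*} [Field K] {k : ℕ} (f : Fin k → MvPolynomial σ K)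
    (h : MvPolynomial σ K) : Ideal (MvPolynomial σ K) :=
  Ideal.span (Set.range f ∪ {h} ∪
    Set.range fun s : Fin k → σ => (Matrix.of fun i j => pderiv (s j) (f i)).det)

/-- The coefficients of the gradient of `h` with respect to the gradients of the `f j` become
polynomial functions after multiplication by an element of the Jacobian ideal. -/
theorem exists_eval_eq_coeff_mul_of_mem_jacobianIdeal {K σ : Type*} [Field K] {k : ℕ}
    {f : Fin k → MvPolynomial σ K} {h p : MvPolynomial σ K} (hp : p ∈ jacobianIdeal f h)
    (j : Fin k) :
    ∃ q : MvPolynomial σ K, ∀ (x : σ → K) (a : Fin k → K), (∀ i, eval x (f i) = 0) →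
      eval x h = 0 →
      (∀ m, eval x (pderiv m h) = ∑ i, a i * eval x (pderiv m (f i))) →
      a j * eval x p = eval x q := by
  induction hp using Submodule.span_induction with
  | mem p hp =>
    rcases hp with (⟨i, rfl⟩ | rfl) | ⟨s, rfl⟩
    · exact ⟨0, fun x a hf _ _ => by simp [hf]⟩
    · exact ⟨0, fun x a _ hh _ => by simp [hh]⟩
    · refine ⟨((Matrix.of fun i l => pderiv (s l) (f i)).updateRow j
        fun l => pderiv (s l) h).det, fun x a _ _ ha => ?_⟩
      rw [RingHom.map_det, RingHom.map_det, ← smul_eq_mul, ← Matrix.det_updateRow_sum]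
      congr 1
      ext i l
      by_cases hij : i = j
      · subst hij
        simp [ha]
      · simp [hij]
  | zero => exact ⟨0, fun x a _ _ _ => by simp⟩
  | add p₁ p₂ _ _ h₁ h₂ =>
    obtain ⟨q₁, h₁⟩ := h₁
    obtain ⟨q₂, h₂⟩ := h₂
    refine ⟨q₁ + q₂, fun x a hf hh ha => ?_⟩
    rw [map_add, map_add, mul_add, h₁ x a hf hh ha, h₂ x a hf hh ha]
  | smul c p _ h₁ =>
    obtain ⟨q, h₁⟩ := h₁
    refine ⟨c * q, fun x a hf hh ha => ?_⟩
    rw [smul_eq_mul, map_mul, map_mul, ← h₁ x a hf hh ha]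
    ring

/-- If `c ^ e * q (c • x) = b * c ^ t` for all nonzero scalars `c`, then `b` is the value at `x` of
the component of `q` of degree `t - e`. -/
theorem eq_eval_homogeneousComponent {K σ : Type*} [Field K] [Infinite K] {q : MvPolynomial σ K}
    {x : σ → K} {b : K} {e t : ℕ} (het : e ≤ t)
    (H : ∀ c : K, c ≠ 0 → c ^ e * eval (c • x) q = b * c ^ t) :
    b = eval x (homogeneousComponent (t - e) q) := by
  let Q : Polynomial K := ∑ i ∈ Finset.range (q.totalDegree + 1),
    Polynomial.C (eval x (homogeneousComponent i q)) * Polynomial.X ^ i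
  have hQ : ∀ c, Q.eval c = eval (c • x) q := by
    intro c
    conv_rhs => rw [← sum_homogeneousComponent q, map_sum]
    simp only [Q, Polynomial.eval_finsetSum]
    refine Finset.sum_congr rfl fun i _ => ?_
    rw [(homogeneousComponent_isHomogeneous i q).eval_smul]
    rw [Polynomial.eval_mul, Polynomial.eval_C, Polynomial.eval_pow, Polynomial.eval_X, mul_comm]
  have hQcoeff : Q.coeff (t - e) = eval x (homogeneousComponent (t - e) q) := by
    rw [Polynomial.finsetSum_coeff, Finset.sum_eq_single (t - e)]
    · rw [Polynomial.coeff_C_mul_X_pow, if_pos rfl]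
    · intro i _ hi
      rw [Polynomial.coeff_C_mul_X_pow, if_neg hi.symm]
    · intro hlt
      rw [Finset.mem_range, not_lt] at hlt
      rw [homogeneousComponent_eq_zero _ _ (Nat.lt_of_succ_le hlt)]
      simp
  have hpoly : Polynomial.X ^ e * Q = Polynomial.C b * Polynomial.X ^ t := by
    refine Polynomial.eq_of_infinite_eval_eq _ _ ?_
    refine (Set.finite_singleton (0 : K)).infinite_compl.mono fun c hc => ?_
    simpa [hQ] using H c hc
  have hcoeff := congrArg (fun p => Polynomial.coeff p t) hpoly
  simp only [Polynomial.coeff_X_pow_mul', het, if_true, Polynomial.coeff_C_mul,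
    Polynomial.coeff_X_pow, mul_one] at hcoeff
  rw [← hcoeff, hQcoeff]

/-- Homogeneous version of `exists_eval_eq_coeff_mul_of_mem_jacobianIdeal`: the coefficient of the
gradient of `f j` behaves like a form of degree `d - dd j`. -/
theorem exists_homogeneous_eval_eq_coeff_mul {K σ : Type*} [Field K] [Infinite K] {k : ℕ}
    {f : Fin k → MvPolynomial σ K} {h g : MvPolynomial σ K} {d t : ℕ} {dd : Fin k → ℕ}
    (hf : ∀ j, (f j).IsHomogeneous (dd j)) (hh : h.IsHomogeneous d) (hd : 1 ≤ d)
    (hdeg : ∀ j, d < dd j) (hg : g.IsHomogeneous t) (hgI : g ∈ jacobianIdeal f h)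
    (j : Fin k) (ht : dd j - d ≤ t) :
    ∃ q : MvPolynomial σ K, q.IsHomogeneous (t - (dd j - d)) ∧
      ∀ (x : σ → K) (a : Fin k → K), (∀ i, eval x (f i) = 0) → eval x h = 0 →
      (∀ m, eval x (pderiv m h) = ∑ i, a i * eval x (pderiv m (f i))) →
      a j * eval x g = eval x q := by
  obtain ⟨q, hq⟩ := exists_eval_eq_coeff_mul_of_mem_jacobianIdeal hgI j
  refine ⟨_, homogeneousComponent_isHomogeneous (t - (dd j - d)) q, fun x a hfx hhx ha => ?_⟩
  refine eq_eval_homogeneousComponent ht fun c hc => ?_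
  have key := hq (c • x) (fun i => a i * (c ^ (dd i - d))⁻¹)
    (fun i => by rw [(hf i).eval_smul, hfx, mul_zero])
    (by rw [hh.eval_smul, hhx, mul_zero]) (fun m => by
      rw [hh.pderiv.eval_smul, ha, Finset.mul_sum]
      refine Finset.sum_congr rfl fun i _ => ?_
      have hi := hdeg i
      rw [(hf i).pderiv.eval_smul, show dd i - 1 = (dd i - d) + (d - 1) by omega, pow_add]
      field_simp)
  rw [← key, hg.eval_smul]
  field_simp

/-- **Theorem 1 (i), first part.**  If the singular locus of the complete intersection
`V = {f_1 = ⋯ = f_k = 0}` is finite and disjoint from the hypersurface `H = {h = 0}`, and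
`d = deg h` is strictly smaller than every `d_j = deg f_j`, then the tangency set `T(V,H)`
is finite. -/
theorem tangency_set_finite
    (n k N : ℕ) (hn : 1 ≤ n) (hk : 1 ≤ k) (hN : N = n + k)
    (d : ℕ) (dd : Fin k → ℕ) (hd : 1 ≤ d)
    (f : Fin k → MvPolynomial (Fin (N + 1)) ℂ)
    (h : MvPolynomial (Fin (N + 1)) ℂ)
    (hf : ∀ j, (f j).IsHomogeneous (dd j))
    (hh : h.IsHomogeneous d)
    (Vsing Hset : Set (Projectivization ℂ (Fin (N + 1) → ℂ)))
    -- `Vsing` is the singular locus of `V`: points where the gradients of the `f_j` are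
    -- linearly dependent
    (hVsing : Vsing = {P | ∃ x, ∃ hx : x ≠ 0, P = Projectivization.mk ℂ x hx ∧
        (∀ j, eval x (f j) = 0) ∧
        ¬ LinearIndependent ℂ fun j => pgrad (f j) x})
    -- `Hset` is the hypersurface `H = {h = 0}`
    (hHset : Hset = {P | ∃ x, ∃ hx : x ≠ 0, P = Projectivization.mk ℂ x hx ∧ eval x h = 0})
    -- `V_sing` is finite
    (hVsingFin : Vsing.Finite)
    -- `V_sing ∩ H = ∅`
    (hVH : Vsing ∩ Hset = ∅)
    -- `d < d_j` for all `j`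
    (hdeg : ∀ j, d < dd j) :
    -- the tangency set `T(V,H)` is finite
    Set.Finite {P : Projectivization ℂ (Fin (N + 1) → ℂ) |
        ∃ x, ∃ hx : x ≠ 0, P = Projectivization.mk ℂ x hx ∧
        (∀ j, eval x (f j) = 0) ∧ eval x h = 0 ∧
        (LinearIndependent ℂ fun j => pgrad (f j) x) ∧
        pgrad h x ≠ 0 ∧
        pgrad h x ∈ Submodule.span ℂ (Set.range fun j => pgrad (f j) x)} := by
  have hli : ∀ x : Fin (N + 1) → ℂ, x ≠ 0 → (∀ j, eval x (f j) = 0) → eval x h = 0 →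
      LinearIndependent ℂ fun j => pgrad (f j) x := by
    intro x hx hfx hhx
    by_contra hdep
    have hmem : Projectivization.mk ℂ x hx ∈ Vsing ∩ Hset := by
      rw [hVsing, hHset]
      exact ⟨⟨x, hx, rfl, hfx, hdep⟩, ⟨x, hx, rfl, hhx⟩⟩
    rw [hVH] at hmem
    exact hmem
  obtain ⟨r, hr⟩ := exists_homogeneous_mem_of_zeroLocus_subset (jacobianIdeal f h) (by
    intro x hx
    by_contra hx0
    have hgen := fun p hp => hx p (Ideal.subset_span hp)
    obtain ⟨s, hs⟩ := exists_det_submatrix_ne_zero (M := Matrix.of fun j => pgrad (f j) x)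
      (hli x hx0 (fun j => hgen _ (.inl (.inl ⟨j, rfl⟩))) (hgen _ (.inl (.inr rfl))))
    refine hs ?_
    have := hgen _ (.inr ⟨s, rfl⟩)
    rw [RingHom.map_det] at this
    exact this)
  rw [← Set.finite_coe_iff]
  choose x hx hP hfx hhx _ hne hspan using fun P : {P : Projectivization ℂ (Fin (N + 1) → ℂ) |
        ∃ x, ∃ hx : x ≠ 0, P = Projectivization.mk ℂ x hx ∧
        (∀ j, eval x (f j) = 0) ∧ eval x h = 0 ∧
        (LinearIndependent ℂ fun j => pgrad (f j) x) ∧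
        pgrad h x ≠ 0 ∧
        pgrad h x ∈ Submodule.span ℂ (Set.range fun j => pgrad (f j) x)} => P.2
  choose a ha using fun P => (Submodule.mem_span_range_iff_exists_fun ℂ).mp (hspan P)
  rw [← Set.finite_univ_iff]
  refine (Set.finite_iUnion fun j => ?_ : (⋃ j, {P | a P j ≠ 0}).Finite).subset fun P _ => ?_
  · rw [← Set.finite_coe_iff]
    refine finite_of_mul_lowers_degree (fun P => x P.1) ?_ (fun P => a P.1 j) (fun P => P.2)
      (e := dd j - d) (r := max r (dd j)) (Nat.sub_pos_of_lt (hdeg j))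
      (lt_max_of_lt_right (Nat.zero_lt_of_lt (hdeg j))) fun t ht g hg => ?_
    · intro P Q hPQ
      refine exists_linear_form_separating (hx P.1) (hx Q.1) fun heq => hPQ ?_
      exact Subtype.ext (Subtype.ext ((hP P.1).trans (heq.trans (hP Q.1).symm)))
    · obtain ⟨q, hq, hqx⟩ := exists_homogeneous_eval_eq_coeff_mul hf hh hd hdeg hg
        (hr t (le_of_max_le_left ht) g hg) j
        ((Nat.sub_le _ _).trans (le_of_max_le_right ht))
      refine ⟨q, hq, fun P => hqx _ _ (hfx _) (hhx _) fun m => ?_⟩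
      have := congrFun (ha P.1) m
      simpa [pgrad, Finset.sum_apply] using this.symm
  · by_contra hcon
    simp only [Set.mem_iUnion, Set.mem_ofPred_eq, not_exists, not_not] at hcon
    refine hne P ?_
    rw [← ha P]
    simp [hcon]
end

section
/- Assume that the singular locus V_sing of the projective complete intersection V is finite, that V_sing ∩ H = ∅, that d < d_j for every j = 1, …, k, and moreover that H_sing ∩ V is a finite set. Then the complete intersection W = V ∩ H has at most isolated singularities; that is, the set {[x] ∈ ℙ^N(ℂ) : f_1(x) = ⋯ = f_k(x) = 0, h(x) = 0, and the gradients d_x f_1, …, d_x f_k, d_x h are linearly dependent over ℂ} is finite. -/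
open MvPolynomial

/-- A homogeneous polynomial of degree `n` scales by `c ^ n`. -/
lemma MvPolynomial.IsHomogeneous.eval_const_smul {ι R : Type*} [CommSemiring R] {n : ℕ}
    {p : MvPolynomial ι R} (hp : p.IsHomogeneous n) (c : R) (x : ι → R) :
    eval (c • x) p = c ^ n * eval x p := by
  rw [eval_eq, eval_eq, Finset.mul_sum]
  refine Finset.sum_congr rfl fun s hs => ?_
  have hdeg : n = ∑ i ∈ s.support, s i := hp.degree_eq_sum_deg_support hs
  simp only [Pi.smul_apply, smul_eq_mul, mul_pow, Finset.prod_mul_distrib,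
    Finset.prod_pow_eq_pow_sum, hdeg]
  ring

/-- If `p` scales by `c ^ m` along the line through `x`, then at `x` it agrees with its homogeneous
component of degree `m`. -/
lemma MvPolynomial.eval_homogeneousComponent_of_scaling {ι K : Type*} [Field K] [Infinite K]
    (p : MvPolynomial ι K) (x : ι → K) (m : ℕ) (μ : K)
    (hp : ∀ c : K, c ≠ 0 → eval (c • x) p = c ^ m * μ) :
    eval x (homogeneousComponent m p) = μ := by
  have hsum (c : K) : eval (c • x) p =
      ∑ i ∈ Finset.range (p.totalDegree + 1), c ^ i * eval x (homogeneousComponent i p) := by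
    conv_lhs => rw [← sum_homogeneousComponent p]
    rw [map_sum]
    exact Finset.sum_congr rfl fun i _ =>
      (homogeneousComponent_isHomogeneous i p).eval_const_smul c x
  have heq : Polynomial.monomial m μ =
      ∑ i ∈ Finset.range (p.totalDegree + 1),
        Polynomial.monomial i (eval x (homogeneousComponent i p)) := by
    refine Polynomial.eq_of_infinite_eval_eq _ _ ?_
    refine (Set.finite_singleton (0 : K)).infinite_compl.mono fun c hc => ?_
    have := hp c hc
    rw [hsum] at this
    simp only [Set.mem_ofPred_eq, Polynomial.eval_finsetSum, Polynomial.eval_monomial]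
    rw [mul_comm, ← this]
    exact Finset.sum_congr rfl fun i _ => mul_comm _ _
  have hcoeff := congrArg (fun q => Polynomial.coeff q m) heq
  simp only [Polynomial.finsetSum_coeff, Polynomial.coeff_monomial, if_true] at hcoeff
  rw [hcoeff, Finset.sum_ite_eq']
  split_ifs with hm
  · rfl
  · rw [homogeneousComponent_eq_zero _ _ (by simpa [Nat.lt_succ_iff] using hm), map_zero]

/-- A set of points of projective space is finite as soon as all ratios of coordinates take
only finitely many values on it. -/
lemma Projectivization.finite_of_finite_ratios {ι K : Type*} [Finite ι] [Field K]
    (S : Set (Projectivization K (ι → K)))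
    (hS : ∀ a b, ((fun P : Projectivization K (ι → K) => P.rep a / P.rep b) '' S).Finite) :
    S.Finite := by
  let ρ : Projectivization K (ι → K) → ι → ι → K := fun P a b => P.rep a / P.rep b
  refine Set.Finite.of_finite_image (f := ρ) ?_ ?_
  · refine (Set.Finite.pi' fun a => Set.Finite.pi' fun b => hS a b).subset ?_
    rintro _ ⟨P, hP, rfl⟩ a b
    exact ⟨P, hP, rfl⟩
  · intro P _ Q _ hPQ
    obtain ⟨b, hb⟩ := Function.ne_iff.mp P.rep_nonzero
    replace hb : P.rep b ≠ 0 := hb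
    have hratio (a : ι) : P.rep a / P.rep b = Q.rep a / Q.rep b := congrFun (congrFun hPQ a) b
    have hb' : Q.rep b ≠ 0 := fun h0 => by
      have := hratio b
      rw [h0, div_zero, div_self hb] at this
      exact one_ne_zero this
    rw [← P.mk_rep, ← Q.mk_rep, Projectivization.mk_eq_mk_iff']
    refine ⟨P.rep b / Q.rep b, funext fun a => ?_⟩
    have := hratio a
    field_simp at this
    simp only [Pi.smul_apply, smul_eq_mul]
    field_simp
    rw [← this, mul_comm]

/-- The polynomials `q` for which `l * q` is a polynomial function on `Z`. -/
def denominatorIdeal {ι K : Type*} [Field K] (Z : Set (ι → K)) (l : (ι → K) → K) :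
    Ideal (MvPolynomial ι K) where
  carrier := {q | ∃ p : MvPolynomial ι K, ∀ y ∈ Z, l y * eval y q = eval y p}
  add_mem' := by
    rintro q q' ⟨p, hp⟩ ⟨p', hp'⟩
    exact ⟨p + p', fun y hy => by rw [map_add, map_add, mul_add, hp y hy, hp' y hy]⟩
  zero_mem' := ⟨0, fun y _ => by simp⟩
  smul_mem' := by
    rintro c q ⟨p, hp⟩
    exact ⟨c * p, fun y hy => by
      rw [smul_eq_mul, map_mul, map_mul, ← hp y hy, mul_left_comm]⟩

lemma exists_pow_idealOfVars_le_denominatorIdeal {ι K : Type*} [Finite ι] [Field K]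
    [IsAlgClosed K] (Z : Set (ι → K)) (l : (ι → K) → K)
    (hreg : ∀ x : ι → K, x ≠ 0 → ∃ q ∈ denominatorIdeal Z l, eval x q ≠ 0) :
    ∃ r : ℕ, idealOfVars ι K ^ r ≤ denominatorIdeal Z l := by
  refine Ideal.exists_pow_le_of_le_radical_of_fg ?_ (idealOfVars_fg ι K)
  rw [idealOfVars, Ideal.span_le]
  rintro _ ⟨i, rfl⟩
  rw [← vanishingIdeal_zeroLocus_eq_radical (K := K), SetLike.mem_coe, mem_vanishingIdeal_iff]
  intro x hx
  have hx0 : x = 0 := by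
    by_contra hne
    obtain ⟨q, hq, hqx⟩ := hreg x hne
    exact hqx (by simpa [aeval_eq_eval] using hx q hq)
  simp [hx0]

/-- A function of negative degree on a projective set that is regular there (its denominators have
no common zero apart from the origin) is nonzero at only finitely many points. -/
theorem finite_ne_zero_of_regular_of_neg_degree {ι K : Type*} [Finite ι] [Field K]
    [IsAlgClosed K] (Z : Set (ι → K)) (l : (ι → K) → K) (e : ℕ) (he : 1 ≤ e)
    (hZ : ∀ x ∈ Z, ∀ c : K, c ≠ 0 → c • x ∈ Z)
    (hl : ∀ x ∈ Z, ∀ c : K, c ≠ 0 → c ^ e * l (c • x) = l x)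
    (hreg : ∀ x : ι → K, x ≠ 0 → ∃ q ∈ denominatorIdeal Z l, eval x q ≠ 0) :
    {P : Projectivization K (ι → K) | P.rep ∈ Z ∧ l P.rep ≠ 0}.Finite := by
  obtain ⟨r, hr⟩ := exists_pow_idealOfVars_le_denominatorIdeal Z l hreg
  have hstep (m : ℕ) (hm : r ≤ m + e) (q : MvPolynomial ι K) (hq : q.IsHomogeneous (m + e)) :
      ∃ p : MvPolynomial ι K, p.IsHomogeneous m ∧ ∀ y ∈ Z, l y * eval y q = eval y p := by
    have hqr : q ∈ idealOfVars ι K ^ r := by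
      rw [mem_pow_idealOfVars_iff]
      intro s hs
      have hdeg : m + e = s.degree := hq.degree_eq_sum_deg_support hs
      exact hm.trans hdeg.le
    obtain ⟨p, hp⟩ := hr hqr
    refine ⟨homogeneousComponent m p, homogeneousComponent_isHomogeneous m p, fun y hy => ?_⟩
    refine (eval_homogeneousComponent_of_scaling p y m _ fun c hc => ?_).symm
    rw [← hp _ (hZ y hy c hc), hq.eval_const_smul, ← hl y hy c hc]
    ring
  have hiter (A : ℕ) (q : MvPolynomial ι K) (hq : q.IsHomogeneous (r + A * e)) :
      ∃ p : MvPolynomial ι K, p.IsHomogeneous r ∧ ∀ y ∈ Z, l y ^ A * eval y q = eval y p := by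
    induction A generalizing q with
    | zero => exact ⟨q, by simpa using hq, by simp⟩
    | succ A ih =>
      obtain ⟨p, hp, hpq⟩ := hstep (r + A * e) (by omega) q
        (by convert hq using 1; ring)
      obtain ⟨p', hp', hpp'⟩ := ih p hp
      refine ⟨p', hp', fun y hy => ?_⟩
      rw [pow_succ, mul_assoc, hpq y hy, hpp' y hy]
  refine Projectivization.finite_of_finite_ratios _ fun a b => ?_
  have : Module.Finite K (homogeneousSubmodule ι K r) :=
    Module.Finite.iff_fg.mpr (homogeneousSubmodule_fg ι K r)
  set A := Module.finrank K (homogeneousSubmodule ι K r)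
  set M := r + A * e
  have hAM : A ≤ M := le_add_left (Nat.le_mul_of_pos_right A he)
  have hform (i : Fin (M + 1)) :
      (X a ^ (i : ℕ) * X b ^ (M - i) : MvPolynomial ι K).IsHomogeneous M := by
    convert (isHomogeneous_X_pow (R := K) a (i : ℕ)).mul (isHomogeneous_X_pow b (M - i)) using 1
    omega
  choose v hv hvl using fun i => hiter A _ (hform i)
  let w : Fin (M + 1) → homogeneousSubmodule ι K r := fun i => ⟨v i, hv i⟩
  have hdep : ¬ LinearIndependent K w := fun hw => by
    have := hw.fintype_card_le_finrank
    rw [Fintype.card_fin] at this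
    omega
  obtain ⟨g, hg, i₀, hi₀⟩ := Fintype.not_linearIndependent_iff.mp hdep
  have hgv : ∑ i, g i • v i = 0 := by
    simpa [w] using congrArg Subtype.val hg
  let F : Polynomial K := ∑ i : Fin (M + 1), Polynomial.monomial (i : ℕ) (g i)
  have hF : F ≠ 0 := fun h0 => hi₀ <| by
    have := congrArg (fun q => Polynomial.coeff q (i₀ : ℕ)) h0
    simpa [F, Polynomial.finsetSum_coeff, Polynomial.coeff_monomial, Fin.val_inj] using this
  refine ((F.rootSet_finite K).insert 0).subset ?_
  rintro _ ⟨P, ⟨hPZ, hPl⟩, rfl⟩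
  by_cases hb : P.rep b = 0
  · simp [hb]
  refine Set.mem_insert_of_mem _ ?_
  rw [Polynomial.mem_rootSet_of_ne hF, Polynomial.coe_aeval_eq_eval]
  have hzero : ∑ i, g i * (l P.rep ^ A * (P.rep a ^ (i : ℕ) * P.rep b ^ (M - i))) = 0 := by
    have := congrArg (eval P.rep) hgv
    rw [map_sum, map_zero] at this
    rw [← this]
    refine Finset.sum_congr rfl fun i _ => ?_
    rw [smul_eval, ← hvl i _ hPZ]
    simp
  have hfactor : (l P.rep ^ A * P.rep b ^ M) * F.eval (P.rep a / P.rep b) = 0 := by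
    rw [← hzero, Polynomial.eval_finsetSum, Finset.mul_sum]
    refine Finset.sum_congr rfl fun i _ => ?_
    have hsplit : P.rep b ^ M = P.rep b ^ (M - i) * P.rep b ^ (i : ℕ) := by
      rw [← pow_add]; congr 1; omega
    rw [Polynomial.eval_monomial, hsplit, div_pow]
    field_simp
  exact (mul_eq_zero.mp hfactor).resolve_left (mul_ne_zero (pow_ne_zero _ hPl) (pow_ne_zero _ hb))

lemma pgrad_smul {N m : ℕ} {p : MvPolynomial (Fin (N + 1)) ℂ} (hp : p.IsHomogeneous m)
    (c : ℂ) (x : Fin (N + 1) → ℂ) : pgrad p (c • x) = c ^ (m - 1) • pgrad p x :=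
  funext fun _ => hp.pderiv.eval_const_smul c x

/-- Cramer's rule: where the gradients of the `f j` are independent, the coefficients expressing
a gradient as a combination of them are regular. -/
lemma exists_mem_denominatorIdeal_of_linearIndependent_pgrad {N k : ℕ}
    (f : Fin k → MvPolynomial (Fin (N + 1)) ℂ) (h : MvPolynomial (Fin (N + 1)) ℂ)
    (Z : Set (Fin (N + 1) → ℂ)) (l : (Fin (N + 1) → ℂ) → Fin k → ℂ)
    (hl : ∀ y ∈ Z, ∑ j, l y j • pgrad (f j) y = pgrad h y)
    (x : Fin (N + 1) → ℂ) (hx : LinearIndependent ℂ fun j => pgrad (f j) x) (j : Fin k) :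
    ∃ q ∈ denominatorIdeal Z (fun y => l y j), eval x q ≠ 0 := by
  let D : Matrix (Fin k) (Fin (N + 1)) (MvPolynomial (Fin (N + 1)) ℂ) :=
    .of fun j i => pderiv i (f j)
  obtain ⟨B, hB⟩ : ∃ B : Matrix (Fin (N + 1)) (Fin k) ℂ, D.map (eval x) * B = 1 := by
    obtain ⟨g, hg⟩ := LinearMap.exists_leftInverse_of_injective _
      (LinearMap.ker_eq_bot.mpr hx.fintypeLinearCombination_injective)
    refine ⟨(LinearMap.toMatrix' g).transpose, ?_⟩
    ext i i'
    rw [Matrix.mul_apply_eq_vecMul, Matrix.vecMul_transpose, LinearMap.toMatrix'_mulVec]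
    have hgi := LinearMap.congr_fun hg (Pi.single i 1)
    rw [LinearMap.comp_apply, Fintype.linearCombination_apply_single, one_smul] at hgi
    rw [Matrix.one_eq_pi_single]
    exact congrFun hgi i'
  let B' : Matrix (Fin (N + 1)) (Fin k) (MvPolynomial (Fin (N + 1)) ℂ) := B.map C
  have hB' (y : Fin (N + 1) → ℂ) : B'.map (eval y) = B := by
    ext; simp [B']
  let G := D * B'
  have hG (y : Fin (N + 1) → ℂ) : G.map (eval y) = D.map (eval y) * B := by
    rw [Matrix.map_mul, hB']
  refine ⟨G.det, ⟨Matrix.vecMul (Matrix.vecMul (fun i => pderiv i h) B') G.adjugate j,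
    fun y hy => ?_⟩, ?_⟩
  · have hrow : Matrix.vecMul (l y) (G.map (eval y)) = Matrix.vecMul (pgrad h y) B := by
      rw [hG, ← Matrix.vecMul_vecMul]
      congr 1
      rw [← hl y hy, Matrix.vecMul_eq_sum]
      rfl
    have hadj := congrArg (fun u => Matrix.vecMul u (G.map (eval y)).adjugate j) hrow
    simp only [Matrix.vecMul_vecMul, Matrix.mul_adjugate, Matrix.vecMul_smul, Matrix.vecMul_one,
      Pi.smul_apply, smul_eq_mul] at hadj
    have hdet : eval y G.det = (G.map (eval y)).det := RingHom.map_det _ _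
    have hadjugate : G.adjugate.map (eval y) = (G.map (eval y)).adjugate :=
      RingHom.map_adjugate _ _
    have hvec : eval y ∘ Matrix.vecMul (fun i => pderiv i h) B' =
        Matrix.vecMul (pgrad h y) B := by
      ext i
      rw [Function.comp_apply, RingHom.map_vecMul, hB']
      rfl
    rw [RingHom.map_vecMul, hadjugate, hvec, Matrix.vecMul_vecMul, hdet, ← hadj, mul_comm]
  · rw [RingHom.map_det, RingHom.mapMatrix_apply, hG, hB, Matrix.det_one]
    exact one_ne_zero

/-- **Theorem 1 (i), second part.**  If moreover `H_sing ∩ V` is finite, then the complete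
intersection `W = V ∩ H` has at most isolated singularities, i.e. its singular locus
(points where the gradients of `f_1, …, f_k, h` are linearly dependent) is finite. -/
theorem complete_intersection_isolated_singularities
    (n k N : ℕ) (hn : 1 ≤ n) (hk : 1 ≤ k) (hN : N = n + k)
    (d : ℕ) (dd : Fin k → ℕ) (hd : 1 ≤ d)
    (f : Fin k → MvPolynomial (Fin (N + 1)) ℂ)
    (h : MvPolynomial (Fin (N + 1)) ℂ)
    (hf : ∀ j, (f j).IsHomogeneous (dd j))
    (hh : h.IsHomogeneous d)
    (Vset Vsing Hset Hsing : Set (Projectivization ℂ (Fin (N + 1) → ℂ)))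
    -- `Vset` is the complete intersection `V = {f_1 = ⋯ = f_k = 0}`
    (hVset : Vset = {P | ∃ x, ∃ hx : x ≠ 0, P = Projectivization.mk ℂ x hx ∧
        ∀ j, eval x (f j) = 0})
    -- `Vsing` is the singular locus of `V`
    (hVsing : Vsing = {P | ∃ x, ∃ hx : x ≠ 0, P = Projectivization.mk ℂ x hx ∧
        (∀ j, eval x (f j) = 0) ∧
        ¬ LinearIndependent ℂ fun j => pgrad (f j) x})
    -- `Hset` is the hypersurface `H = {h = 0}`, `Hsing` its singular locus
    (hHset : Hset = {P | ∃ x, ∃ hx : x ≠ 0, P = Projectivization.mk ℂ x hx ∧ eval x h = 0})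
    (hHsing : Hsing = {P | ∃ x, ∃ hx : x ≠ 0, P = Projectivization.mk ℂ x hx ∧
        eval x h = 0 ∧ pgrad h x = 0})
    -- `V_sing` is finite
    (hVsingFin : Vsing.Finite)
    -- `V_sing ∩ H = ∅`
    (hVH : Vsing ∩ Hset = ∅)
    -- `d < d_j` for all `j`
    (hdeg : ∀ j, d < dd j)
    -- `H_sing ∩ V` is finite
    (hHsingV : (Hsing ∩ Vset).Finite) :
    -- the singular locus of `W = V ∩ H` is finite
    Set.Finite {P : Projectivization ℂ (Fin (N + 1) → ℂ) |
        ∃ x, ∃ hx : x ≠ 0, P = Projectivization.mk ℂ x hx ∧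
        (∀ j, eval x (f j) = 0) ∧ eval x h = 0 ∧
        ¬ LinearIndependent ℂ (Fin.cons (pgrad h x) (fun j => pgrad (f j) x) :
            Fin (k + 1) → Fin (N + 1) → ℂ)} := by
  subst hVset hVsing hHset hHsing
  set Z : Set (Fin (N + 1) → ℂ) := {x | x ≠ 0 ∧ (∀ j, eval x (f j) = 0) ∧ eval x h = 0 ∧
    ¬ LinearIndependent ℂ (Fin.cons (pgrad h x) (fun j => pgrad (f j) x) :
      Fin (k + 1) → Fin (N + 1) → ℂ)}
  have hind (x : Fin (N + 1) → ℂ) (hx : x ≠ 0) (hfx : ∀ j, eval x (f j) = 0)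
      (hhx : eval x h = 0) : LinearIndependent ℂ fun j => pgrad (f j) x := by
    by_contra hdep
    exact Set.eq_empty_iff_forall_notMem.mp hVH (Projectivization.mk ℂ x hx)
      ⟨⟨x, hx, rfl, hfx, hdep⟩, ⟨x, hx, rfl, hhx⟩⟩
  have hspan (x : Fin (N + 1) → ℂ) :
      ∃ c : Fin k → ℂ, x ∈ Z → ∑ j, c j • pgrad (f j) x = pgrad h x := by
    by_cases hx : x ∈ Z
    · obtain ⟨hx0, hfx, hhx, hdep⟩ := hx
      rw [linearIndependent_finCons, not_and, not_not] at hdep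
      obtain ⟨c, hc⟩ := (Submodule.mem_span_range_iff_exists_fun ℂ).mp
        (hdep (hind x hx0 hfx hhx))
      exact ⟨c, fun _ => hc⟩
    · exact ⟨0, fun hx' => absurd hx' hx⟩
  choose l hl using hspan
  have hZ (x) (hx : x ∈ Z) (c : ℂ) (hc : c ≠ 0) : c • x ∈ Z := by
    have hgrad := hl x hx
    obtain ⟨hx0, hfx, hhx, -⟩ := hx
    have hfcx (j) : eval (c • x) (f j) = 0 := by rw [(hf j).eval_const_smul, hfx, mul_zero]
    have hhcx : eval (c • x) h = 0 := by rw [hh.eval_const_smul, hhx, mul_zero]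
    refine ⟨smul_ne_zero hc hx0, hfcx, hhcx, ?_⟩
    rw [linearIndependent_finCons, not_and, not_not]
    intro _
    refine (Submodule.mem_span_range_iff_exists_fun ℂ).mpr
      ⟨fun j => c ^ (d - 1) * l x j * (c ^ (dd j - 1))⁻¹, ?_⟩
    rw [pgrad_smul hh, ← hgrad, Finset.smul_sum]
    refine Finset.sum_congr rfl fun j _ => ?_
    rw [pgrad_smul (hf j), smul_smul, smul_smul, inv_mul_cancel_right₀ (pow_ne_zero _ hc)]
  have hscale (j) (x) (hx : x ∈ Z) (c : ℂ) (hc : c ≠ 0) :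
      c ^ (dd j - d) * l (c • x) j = l x j := by
    have heq : ∑ i, (l (c • x) i * c ^ (dd i - 1)) • pgrad (f i) x =
        ∑ i, (c ^ (d - 1) * l x i) • pgrad (f i) x := by
      have := hl _ (hZ x hx c hc)
      rw [pgrad_smul hh, ← hl x hx, Finset.smul_sum] at this
      simpa only [pgrad_smul (hf _), smul_smul] using this
    have hcoef := (hind x hx.1 hx.2.1 hx.2.2.1).fintypeLinearCombination_injective
      (a₁ := fun i => l (c • x) i * c ^ (dd i - 1))
      (a₂ := fun i => c ^ (d - 1) * l x i)
      (by simpa [Fintype.linearCombination_apply] using heq)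
    have hj : l (c • x) j * c ^ (dd j - 1) = c ^ (d - 1) * l x j := congrFun hcoef j
    have hpow : c ^ (dd j - 1) = c ^ (d - 1) * c ^ (dd j - d) := by
      rw [← pow_add]; congr 1; have := hdeg j; omega
    refine mul_left_cancel₀ (pow_ne_zero (d - 1) hc) ?_
    rw [← hj, hpow]
    ring
  have hfin (j : Fin k) : {P : Projectivization ℂ (Fin (N + 1) → ℂ) |
      P.rep ∈ Z ∧ l P.rep j ≠ 0}.Finite := by
    refine finite_ne_zero_of_regular_of_neg_degree Z (fun x => l x j) (dd j - d)
      (by have := hdeg j; omega) hZ (hscale j) fun x hx => ?_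
    by_cases hfx : ∀ i, eval x (f i) = 0
    · by_cases hhx : eval x h = 0
      · exact exists_mem_denominatorIdeal_of_linearIndependent_pgrad f h Z l hl x
          (hind x hx hfx hhx) j
      · exact ⟨h, ⟨0, fun y hy => by rw [hy.2.2.1, mul_zero, map_zero]⟩, hhx⟩
    · push Not at hfx
      obtain ⟨i, hi⟩ := hfx
      exact ⟨f i, ⟨0, fun y hy => by rw [hy.2.1 i, mul_zero, map_zero]⟩, hi⟩
  refine ((Set.finite_iUnion hfin).union hHsingV).subset ?_
  rintro P ⟨x, hx, rfl, hfx, hhx, hdep⟩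
  set P := Projectivization.mk ℂ x hx with hP
  have hPZ : P.rep ∈ Z := by
    obtain ⟨a, ha⟩ := Projectivization.exists_smul_eq_mk_rep ℂ x hx
    rw [hP, ← ha]
    exact hZ x ⟨hx, hfx, hhx, hdep⟩ a a.ne_zero
  by_cases hl0 : ∃ j, l P.rep j ≠ 0
  · obtain ⟨j, hj⟩ := hl0
    exact Or.inl (Set.mem_iUnion.mpr ⟨j, hPZ, hj⟩)
  · push Not at hl0
    have hgrad : pgrad h P.rep = 0 := by
      rw [← hl _ hPZ]
      exact Finset.sum_eq_zero fun j _ => by rw [hl0 j, zero_smul]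
    exact Or.inr ⟨⟨P.rep, P.rep_nonzero, P.mk_rep.symm, hPZ.2.2.1, hgrad⟩,
      ⟨P.rep, P.rep_nonzero, P.mk_rep.symm, hPZ.2.1⟩⟩
end

section
/- Assume that the singular locus V_sing of the projective complete intersection V is finite, that V_sing ∩ H = ∅, and that d < d_j for every j = 1, …, k. Let s be an integer with 0 ≤ s ≤ n − 1 and assume that the global Milnor fiber F_h = {x ∈ ℂ^{N+1} : h(x) = 1} is s-connected. Then the n-dimensional affine complete intersection F = {x ∈ ℂ^{N+1} : f_1(x) = ⋯ = f_k(x) = 0, h(x) = 1}, with the euclidean subspace topology, is also s-connected. -/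
open MvPolynomial

/-- A topological space `Y` is `s`-connected if it is nonempty, path-connected, and all its
homotopy groups `π_i(Y, y)` for `1 ≤ i ≤ s` are trivial (for every basepoint). -/
def SConnected (s : ℕ) (Y : Type*) [TopologicalSpace Y] : Prop :=
  Nonempty Y ∧ PathConnectedSpace Y ∧
    ∀ i : ℕ, 1 ≤ i → i ≤ s → ∀ y : Y, Subsingleton (HomotopyGroup (Fin i) Y y)

/-- Continuous maps from `K` to the normed space `V` can be perturbed off the origin. -/
def AvoidsZero (K V : Type*) [TopologicalSpace K] [NormedAddCommGroup V] : Prop :=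
  ∀ p : K → V, Continuous p → ∀ ε : ℝ, 0 < ε →
    ∃ q : K → V, Continuous q ∧ ∀ x, ‖q x - p x‖ ≤ ε ∧ q x ≠ 0

theorem avoidsZero_of_retract {K E V : Type*} [TopologicalSpace K]
    [NormedAddCommGroup E] [NormedSpace ℝ E] [FiniteDimensional ℝ E]
    [NormedAddCommGroup V] [NormedSpace ℝ V] [FiniteDimensional ℝ V]
    {j : K → E} (hj : Continuous j) {ρ : E → K} (hρ : Continuous ρ)
    (hρj : ∀ x, ρ (j x) = x) (hdim : Module.finrank ℝ E < Module.finrank ℝ V) :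
    AvoidsZero K V := by
  intro p hp ε hε
  obtain ⟨g, hg, happrox, -⟩ := (hp.comp hρ).exists_contDiff_approx (n := 1)
    (ε := fun _ => ε / 2) continuous_const (fun _ => half_pos hε)
  have hdense := hg.dense_compl_range_of_finrank_lt_finrank hdim
  obtain ⟨c, hc, hc0⟩ := Metric.dense_iff.1 hdense 0 (ε / 2) (half_pos hε)
  refine ⟨fun x => g (j x) - c, by have := hg.continuous; fun_prop, fun x => ⟨?_, ?_⟩⟩
  · have h1 : dist (g (j x)) (p x) < ε / 2 := by simpa [hρj] using happrox (j x)
    rw [dist_eq_norm] at h1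
    have h2 : ‖c‖ < ε / 2 := by simpa using hc
    calc ‖g (j x) - c - p x‖ = ‖(g (j x) - p x) - c‖ := by congr 1; abel
      _ ≤ ‖g (j x) - p x‖ + ‖c‖ := norm_sub_le _ _
      _ ≤ ε := by linarith
  · intro h0
    exact hc0 ⟨j x, sub_eq_zero.1 h0⟩

/-- Near `z`, families in `M` parametrised by `K` can be pushed by a small amount so that `χ`
decreases, fixing the points of `F` and moving `Q` by no more than `Λ` times the decrease of `χ`. -/
def Pushable (K : Type*) [TopologicalSpace K] {X Y : Type*} [PseudoMetricSpace X]
    [PseudoMetricSpace Y] (M F : Set X) (χ : X → ℝ) (Q : X → Y) (Λ : ℝ) (z : X) : Prop :=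
  ∃ ρ > 0, ∃ t₀ > 0, ∀ t : ℝ, 0 < t → t ≤ t₀ → ∃ κ > 0, ∀ τ : ℝ, 0 < τ →
    ∀ u : K → X, Continuous u → (∀ x, u x ∈ M) →
      ∃ v : K → X, Continuous v ∧ ∀ x, v x ∈ M ∧ (u x ∈ F → v x = u x) ∧
        dist (v x) (u x) ≤ t ∧ χ (v x) ≤ χ (u x) + τ ∧
        (dist (u x) z < ρ → χ (v x) ≤ χ (u x) - κ + τ) ∧
        dist (Q (v x)) (Q (u x)) ≤ Λ * (χ (u x) - χ (v x) + τ)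

section Lowering

variable {K X Y : Type*} [TopologicalSpace K] [PseudoMetricSpace X] [PseudoMetricSpace Y]
  {M F : Set X} {χ : X → ℝ} {Q : X → Y} {Λ : ℝ}

theorem exists_sweep (S : Finset X) (ρ : X → ℝ) (t κ : ℝ) (ht : 0 ≤ t)
    (hS : ∀ z ∈ S, ∀ τ : ℝ, 0 < τ → ∀ u : K → X, Continuous u → (∀ x, u x ∈ M) →
      ∃ v : K → X, Continuous v ∧ ∀ x, v x ∈ M ∧ (u x ∈ F → v x = u x) ∧
        dist (v x) (u x) ≤ t ∧ χ (v x) ≤ χ (u x) + τ ∧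
        (dist (u x) z < ρ z → χ (v x) ≤ χ (u x) - κ + τ) ∧
        dist (Q (v x)) (Q (u x)) ≤ Λ * (χ (u x) - χ (v x) + τ))
    (τ : ℝ) (hτ : 0 < τ) (u : K → X) (hu : Continuous u) (huM : ∀ x, u x ∈ M) :
    ∃ v : K → X, Continuous v ∧ ∀ x, v x ∈ M ∧ (u x ∈ F → v x = u x) ∧
      dist (v x) (u x) ≤ S.card * t ∧ χ (v x) ≤ χ (u x) + S.card * τ ∧
      (∀ z ∈ S, dist (u x) z + S.card * t < ρ z → χ (v x) ≤ χ (u x) - κ + S.card * τ) ∧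
      dist (Q (v x)) (Q (u x)) ≤ Λ * (χ (u x) - χ (v x) + S.card * τ) := by
  classical
  induction S using Finset.induction_on with
  | empty => exact ⟨u, hu, fun x => by simp [huM x]⟩
  | insert z S hz ih =>
    obtain ⟨v, hv, hvx⟩ := ih fun y hy => hS y (Finset.mem_insert_of_mem hy)
    obtain ⟨w, hw, hwx⟩ := hS z (Finset.mem_insert_self _ _) τ hτ v hv fun x => (hvx x).1
    refine ⟨w, hw, fun x => ?_⟩
    obtain ⟨-, a2, a3, a4, a5, a6⟩ := hvx x
    obtain ⟨b1, b2, b3, b4, b5, b6⟩ := hwx x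
    have hcard : ((insert z S).card : ℝ) = S.card + 1 := by
      rw [Finset.card_insert_of_notMem hz]; push_cast; ring
    rw [hcard]
    have hcS : (0 : ℝ) ≤ S.card * t := by positivity
    refine ⟨b1, fun h => ?_, ?_, by linarith, ?_, ?_⟩
    · have hv' := a2 h
      rw [b2 (hv' ▸ h), hv']
    · linarith [dist_triangle (w x) (v x) (u x)]
    · intro y hy hd
      rcases Finset.mem_insert.1 hy with rfl | hy
      · have := b5 (by linarith [dist_triangle (v x) (u x) y])
        linarith
      · have := a5 y hy (by linarith)
        linarith
    · calc dist (Q (w x)) (Q (u x)) ≤ dist (Q (w x)) (Q (v x)) + dist (Q (v x)) (Q (u x)) :=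
            dist_triangle _ _ _
        _ ≤ Λ * (χ (v x) - χ (w x) + τ) + Λ * (χ (u x) - χ (v x) + S.card * τ) := add_le_add b6 a6
        _ = _ := by ring

theorem exists_uniform_push {Z : Set X} (hZ : IsCompact Z) (hΛ : 0 ≤ Λ)
    (hpush : ∀ z ∈ Z, Pushable K M F χ Q Λ z) :
    ∃ κ > 0, ∀ τ : ℝ, 0 < τ → ∀ u : K → X, Continuous u → (∀ x, u x ∈ M) →
      ∃ v : K → X, Continuous v ∧ ∀ x, v x ∈ M ∧ (u x ∈ F → v x = u x) ∧
        χ (v x) ≤ χ (u x) + τ ∧ (u x ∈ Z → χ (v x) ≤ χ (u x) - κ + τ) ∧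
        dist (Q (v x)) (Q (u x)) ≤ Λ * (χ (u x) - χ (v x) + τ) := by
  classical
  choose! ρ hρ t₀ ht₀ hp using hpush
  obtain ⟨S, hSZ, hcover⟩ := hZ.elim_nhds_subcover (fun z => Metric.ball z (ρ z / 2))
    fun z hz => Metric.ball_mem_nhds z (half_pos (hρ z hz))
  rcases S.eq_empty_or_nonempty with rfl | hS
  · refine ⟨1, one_pos, fun τ hτ u hu huM => ⟨u, hu, fun x => ⟨huM x, fun _ => rfl, by linarith,
      fun h => ?_, ?_⟩⟩⟩
    · simpa using hcover h
    · simp only [dist_self, sub_self, zero_add]; positivity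
  have hcard : (0 : ℝ) < S.card := by exact_mod_cast hS.card_pos
  obtain ⟨t, ht, htS⟩ : ∃ t : ℝ, 0 < t ∧ ∀ z ∈ S, t ≤ t₀ z ∧ t ≤ ρ z / 2 / S.card := by
    obtain ⟨z, hz, hmin⟩ := S.exists_min_image (fun z => min (t₀ z) (ρ z / 2 / S.card)) hS
    refine ⟨_, ?_, fun y hy => le_min_iff.1 (hmin y hy)⟩
    exact lt_min (ht₀ z (hSZ z hz)) (div_pos (half_pos (hρ z (hSZ z hz))) hcard)
  have hp' : ∀ z, ∃ κ : ℝ, z ∈ S → 0 < κ ∧ ∀ τ : ℝ, 0 < τ →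
    ∀ u : K → X, Continuous u → (∀ x, u x ∈ M) →
      ∃ v : K → X, Continuous v ∧ ∀ x, v x ∈ M ∧ (u x ∈ F → v x = u x) ∧
        dist (v x) (u x) ≤ t ∧ χ (v x) ≤ χ (u x) + τ ∧
        (dist (u x) z < ρ z → χ (v x) ≤ χ (u x) - κ + τ) ∧
        dist (Q (v x)) (Q (u x)) ≤ Λ * (χ (u x) - χ (v x) + τ) := by
    intro z
    by_cases hz : z ∈ S
    · obtain ⟨κ, hκ, h⟩ := hp z (hSZ z hz) t ht (htS z hz).1
      exact ⟨κ, fun _ => ⟨hκ, h⟩⟩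
    · exact ⟨0, fun h => absurd h hz⟩
  choose κ hκ using hp'
  obtain ⟨y, hy, hmin⟩ := S.exists_min_image κ hS
  refine ⟨κ y, (hκ y hy).1, fun τ hτ u hu huM => ?_⟩
  obtain ⟨v, hv, hvx⟩ := exists_sweep (K := K) (M := M) (F := F) (χ := χ) (Q := Q) S ρ t (κ y) ht.le
    (fun z hz τ hτ u hu huM => by
      obtain ⟨v, hv, hvx⟩ := (hκ z hz).2 τ hτ u hu huM
      refine ⟨v, hv, fun x => ?_⟩
      obtain ⟨a1, a2, a3, a4, a5, a6⟩ := hvx x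
      exact ⟨a1, a2, a3, a4, fun h => (a5 h).trans (by linarith [hmin z hz]), a6⟩)
    (τ / S.card) (div_pos hτ hcard) u hu huM
  refine ⟨v, hv, fun x => ?_⟩
  obtain ⟨a1, a2, a3, a4, a5, a6⟩ := hvx x
  rw [mul_div_cancel₀ _ hcard.ne'] at a4 a5 a6
  refine ⟨a1, a2, a4, fun h => ?_, a6⟩
  obtain ⟨z, hz, hxz⟩ := Set.mem_iUnion₂.1 (hcover h)
  refine a5 z hz ?_
  have h1 : dist (u x) z < ρ z / 2 := hxz
  have h2 : S.card * t ≤ ρ z / 2 := by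
    have := (htS z hz).2
    rw [le_div_iff₀ hcard] at this
    linarith
  linarith

/-- A family with `χ ≤ b` can be lowered to `χ ≤ a` if `M` is pushable at all points of levels
between `a'` and `b` that the family can reach. -/
theorem exists_lowering {Z : Set X} (hZ : IsCompact Z) (hΛ : 0 ≤ Λ)
    (hpush : ∀ z ∈ Z, Pushable K M F χ Q Λ z) {lo a' a b : ℝ} (hlo : ∀ y, lo ≤ χ y)
    (ha : a' < a) (hab : a ≤ b) {u : K → X} (hu : Continuous u) (huM : ∀ x, u x ∈ M)
    (hub : ∀ x, χ (u x) ≤ b)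
    (hreach : ∀ y ∈ M, ∀ x, a' ≤ χ y → χ y ≤ b →
      dist (Q y) (Q (u x)) ≤ Λ * (b - lo + 1) → y ∈ Z) :
    ∃ v : K → X, Continuous v ∧ ∀ x, v x ∈ M ∧ (u x ∈ F → v x = u x) ∧ χ (v x) ≤ a ∧
      dist (Q (v x)) (Q (u x)) ≤ Λ * (b - lo + 1) := by
  obtain ⟨κ, hκ, hstep⟩ := exists_uniform_push hZ hΛ hpush
  obtain ⟨J, hJ⟩ : ∃ J : ℕ, (b - a') / (κ / 2) < J := exists_nat_gt _
  have hJ' : b - J * (κ / 2) ≤ a' := by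
    rw [div_lt_iff₀ (by positivity)] at hJ; linarith
  obtain ⟨τ, hτ, hτκ, hτa, hτ1⟩ : ∃ τ : ℝ, 0 < τ ∧ τ ≤ κ / 2 ∧ J * τ ≤ a - a' ∧ J * τ ≤ 1 := by
    refine ⟨min (κ / 2) (min ((a - a') / (J + 1)) (1 / (J + 1))), ?_, min_le_left _ _, ?_, ?_⟩
    · have : 0 < a - a' := sub_pos.2 ha
      positivity
    · have h1 : min (κ / 2) (min ((a - a') / (J + 1)) (1 / (J + 1))) ≤ (a - a') / (J + 1) :=
        (min_le_right _ _).trans (min_le_left _ _)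
      rw [le_div_iff₀ (by positivity)] at h1
      have : 0 < min (κ / 2) (min ((a - a') / (J + 1)) (1 / (J + 1))) := by
        have : 0 < a - a' := sub_pos.2 ha
        positivity
      linarith
    · have h1 : min (κ / 2) (min ((a - a') / (J + 1)) (1 / (J + 1))) ≤ 1 / (J + 1 : ℝ) :=
        (min_le_right _ _).trans (min_le_right _ _)
      rw [le_div_iff₀ (by positivity)] at h1
      have : 0 < min (κ / 2) (min ((a - a') / (J + 1)) (1 / (J + 1))) := by
        have : 0 < a - a' := sub_pos.2 ha
        positivity
      linarith
  have key : ∀ i : ℕ, i ≤ J → ∃ v : K → X, Continuous v ∧ ∀ x, v x ∈ M ∧ (u x ∈ F → v x = u x) ∧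
      χ (v x) ≤ max (b - i * (κ / 2)) (a' + i * τ) ∧
      dist (Q (v x)) (Q (u x)) ≤ Λ * (χ (u x) - χ (v x) + i * τ) := by
    intro i
    induction i with
    | zero => exact fun _ => ⟨u, hu, fun x => ⟨huM x, fun _ => rfl, by simp [hub x], by simp⟩⟩
    | succ i ih =>
      intro hi
      obtain ⟨v, hv, hvx⟩ := ih (by omega)
      obtain ⟨w, hw, hwx⟩ := hstep τ hτ v hv fun x => (hvx x).1
      refine ⟨w, hw, fun x => ?_⟩
      obtain ⟨a1, a2, a3, a4⟩ := hvx x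
      obtain ⟨b1, b2, b3, b4, b5⟩ := hwx x
      have hiJ : (i : ℝ) * τ ≤ J * τ := by
        gcongr; omega
      have hib : max (b - i * (κ / 2)) (a' + i * τ) ≤ b := by
        have : (0 : ℝ) ≤ i * (κ / 2) := by positivity
        exact max_le (by linarith) (by linarith)
      refine ⟨b1, fun h => ?_, ?_, ?_⟩
      · have hv' := a2 h
        rw [b2 (hv' ▸ h), hv']
      · push_cast
        by_cases hx : a' ≤ χ (v x)
        · have := b4 (hreach _ a1 x hx (a3.trans hib) (a4.trans (by
            gcongr
            · exact hub x
            · exact hlo _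
            · linarith)))
          rcases le_max_iff.1 a3 with h | h
          · exact le_max_of_le_left (by linarith)
          · exact le_max_of_le_right (by linarith)
        · exact le_max_of_le_right (by nlinarith)
      · push_cast
        calc dist (Q (w x)) (Q (u x)) ≤ dist (Q (w x)) (Q (v x)) + dist (Q (v x)) (Q (u x)) :=
              dist_triangle _ _ _
          _ ≤ Λ * (χ (v x) - χ (w x) + τ) + Λ * (χ (u x) - χ (v x) + i * τ) := add_le_add b5 a4
          _ = _ := by ring
  obtain ⟨v, hv, hvx⟩ := key J le_rfl
  refine ⟨v, hv, fun x => ?_⟩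
  obtain ⟨a1, a2, a3, a4⟩ := hvx x
  refine ⟨a1, a2, a3.trans (max_le (by linarith) (by linarith)), a4.trans ?_⟩
  gcongr
  · exact hub x
  · exact hlo _

end Lowering

/-- `r` is a continuous retraction of the open set `Ω` onto `M`. -/
structure IsNhdRetraction {X : Type*} [TopologicalSpace X] (M Ω : Set X) (r : X → X) : Prop where
  isOpen : IsOpen Ω
  subset : M ⊆ Ω
  continuousOn : ContinuousOn r Ω
  mapsTo : Set.MapsTo r Ω M
  eq_self : ∀ y ∈ M, r y = y

theorem HasStrictFDerivAt.exists_nhds_norm_sub_le {E G : Type*} [NormedAddCommGroup E]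
    [NormedSpace ℝ E] [NormedAddCommGroup G] [NormedSpace ℝ G] {f : E → G} {f' : E →L[ℝ] G} {z : E}
    (hf : HasStrictFDerivAt f f' z) {c : ℝ} (hc : 0 < c) :
    ∃ s ∈ nhds z, ∀ x ∈ s, ∀ y ∈ s, ‖f x - f y - f' (x - y)‖ ≤ c * ‖x - y‖ := by
  obtain ⟨s, hs, h⟩ := hf.approximates_deriv_on_nhds (c := c.toNNReal) (Or.inr (by simpa using hc))
  refine ⟨s, hs, fun x hx y hy => ?_⟩
  simpa [Real.coe_toNNReal _ hc.le] using h x hx y hy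

section Cutoff

variable {X : Type*} [PseudoMetricSpace X] {z : X}

/-- A continuous cutoff function, `1` on the ball of radius `ρ` and `0` off that of radius `2ρ`. -/
noncomputable def cutoff (z : X) (ρ : ℝ) (y : X) : ℝ := max 0 (min 1 (2 - dist y z / ρ))

theorem continuous_cutoff (z : X) (ρ : ℝ) : Continuous (cutoff z ρ) := by
  unfold cutoff; fun_prop

theorem cutoff_nonneg (z : X) (ρ : ℝ) (y : X) : 0 ≤ cutoff z ρ y := le_max_left _ _

theorem cutoff_le_one (z : X) (ρ : ℝ) (y : X) : cutoff z ρ y ≤ 1 :=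
  max_le zero_le_one (min_le_left _ _)

theorem cutoff_eq_one {ρ : ℝ} (hρ : 0 < ρ) {y : X} (hy : dist y z < ρ) : cutoff z ρ y = 1 := by
  have : dist y z / ρ ≤ 1 := (div_le_one hρ).2 hy.le
  unfold cutoff
  rw [min_eq_left (by linarith), max_eq_right zero_le_one]

theorem cutoff_eq_zero {ρ : ℝ} (hρ : 0 < ρ) {y : X} (hy : 2 * ρ ≤ dist y z) :
    cutoff z ρ y = 0 := by
  have : 2 ≤ dist y z / ρ := (le_div_iff₀ hρ).2 hy
  unfold cutoff
  exact max_eq_left ((min_le_right _ _).trans (by linarith))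

end Cutoff

section LocalPush

variable {K X Y : Type*} [TopologicalSpace K] [NormedAddCommGroup X] [NormedSpace ℝ X]
  [PseudoMetricSpace Y] {M Ω F : Set X} {r : X → X} {χ : X → ℝ} {Q : X → Y} {z : X}

theorem IsNhdRetraction.push (hr : IsNhdRetraction M Ω r) {ρ T : ℝ} (hρ : 0 < ρ)
    (hball : Metric.ball z (2 * ρ + T) ⊆ Ω) {u e : K → X} (hu : Continuous u)
    (huM : ∀ x, u x ∈ M) (he : Continuous e) (heT : ∀ x, ‖e x‖ ≤ T) :
    Continuous (fun x => r (u x + cutoff z ρ (u x) • e x)) ∧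
      ∀ x, r (u x + cutoff z ρ (u x) • e x) ∈ M ∧
        (2 * ρ ≤ dist (u x) z → r (u x + cutoff z ρ (u x) • e x) = u x) := by
  have hmem : ∀ x, u x + cutoff z ρ (u x) • e x ∈ Ω := by
    intro x
    by_cases hx : 2 * ρ ≤ dist (u x) z
    · rw [cutoff_eq_zero hρ hx, zero_smul, add_zero]
      exact hr.subset (huM x)
    · refine hball ?_
      rw [Metric.mem_ball]
      have h1 : ‖cutoff z ρ (u x) • e x‖ ≤ T := by
        rw [norm_smul, Real.norm_of_nonneg (cutoff_nonneg _ _ _)]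
        exact (mul_le_of_le_one_left (norm_nonneg _) (cutoff_le_one _ _ _)).trans (heT x)
      have h2 : dist (u x + cutoff z ρ (u x) • e x) (u x) ≤ T := by
        simpa [dist_eq_norm] using h1
      linarith [dist_triangle (u x + cutoff z ρ (u x) • e x) (u x) z]
  have hc := continuous_cutoff z ρ
  refine ⟨hr.continuousOn.comp_continuous (by fun_prop) hmem, fun x => ⟨hr.mapsTo (hmem x), ?_⟩⟩
  intro hx
  rw [cutoff_eq_zero hρ hx, zero_smul, add_zero, hr.eq_self _ (huM x)]

theorem pushable_of_fderiv_neg (hr : IsNhdRetraction M Ω r) (hF : IsClosed F) (hzM : z ∈ M)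
    (hzF : z ∉ F) {r' : X →L[ℝ] X} (hr' : HasStrictFDerivAt r r' z) {Θ' : X →L[ℝ] ℝ}
    (hΘ : HasStrictFDerivAt (χ ∘ r) Θ' z) {w : X} (hw : ‖w‖ ≤ 1) (hrw : r' w = w) {η L : ℝ}
    (hη : 0 < η) (hΘw : Θ' w ≤ -η) (hL : 0 ≤ L) (hQ : ∀ x y, dist (Q x) (Q y) ≤ L * dist x y) :
    Pushable K M F χ Q (4 * L / η) z := by
  obtain ⟨s₁, hs₁, ha₁⟩ := hr'.exists_nhds_norm_sub_le one_pos
  obtain ⟨s₂, hs₂, ha₂⟩ := hΘ.exists_nhds_norm_sub_le (half_pos hη)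
  obtain ⟨ρ₀, hρ₀, hball⟩ := Metric.mem_nhds_iff.1 (Filter.inter_mem (Filter.inter_mem hs₁ hs₂)
    (Filter.inter_mem (hr.isOpen.mem_nhds (hr.subset hzM)) (hF.isOpen_compl.mem_nhds hzF)))
  refine ⟨ρ₀ / 4, by positivity, ρ₀ / 4, by positivity, fun t ht ht₀ => ⟨η / 2 * (t / 2),
    by positivity, fun τ hτ u hu huM => ?_⟩⟩
  have hρ : 0 < ρ₀ / 4 := by positivity
  have hTe : ‖(t / 2) • w‖ ≤ t / 2 := by
    rw [norm_smul, Real.norm_of_nonneg (by positivity)]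
    exact mul_le_of_le_one_right (by positivity) hw
  obtain ⟨hv, hvx⟩ := hr.push (z := z) (T := t / 2) hρ
    (fun y hy => (hball (Metric.ball_subset_ball (by linarith) hy)).2.1) hu huM
    (continuous_const (y := (t / 2) • w)) fun _ => hTe
  refine ⟨_, hv, fun x => ?_⟩
  obtain ⟨hvM, hvu⟩ := hvx x
  by_cases hx : 2 * (ρ₀ / 4) ≤ dist (u x) z
  · rw [hvu hx]
    refine ⟨huM x, fun _ => rfl, by simp [ht.le], by linarith, fun h => by linarith, ?_⟩
    simp only [dist_self, sub_self, zero_add]; positivity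
  · set s := cutoff z (ρ₀ / 4) (u x) * (t / 2) with hs
    have hs0 : 0 ≤ s := mul_nonneg (cutoff_nonneg _ _ _) (by positivity)
    have hst : s ≤ t / 2 := mul_le_of_le_one_left (by positivity) (cutoff_le_one _ _ _)
    have hue : u x + cutoff z (ρ₀ / 4) (u x) • (t / 2) • w = u x + s • w := by
      rw [smul_smul]
    rw [hue] at hvM ⊢
    have hsw : ‖s • w‖ ≤ s := by
      rw [norm_smul, Real.norm_of_nonneg hs0]
      exact mul_le_of_le_one_right hs0 hw
    have hux : u x ∈ Metric.ball z ρ₀ := by rw [Metric.mem_ball]; linarith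
    have hux' : u x + s • w ∈ Metric.ball z ρ₀ := by
      rw [Metric.mem_ball]
      have : dist (u x + s • w) (u x) ≤ s := by simpa [dist_eq_norm] using hsw
      linarith [dist_triangle (u x + s • w) (u x) z]
    have e1 := ha₁ _ (hball hux').1.1 _ (hball hux).1.1
    have e2 := ha₂ _ (hball hux').1.2 _ (hball hux).1.2
    simp only [add_sub_cancel_left, map_smul, hrw, hr.eq_self _ (huM x), 
      one_mul, Function.comp_apply, smul_eq_mul] at e1 e2
    have hχ : χ (r (u x + s • w)) ≤ χ (u x) - η / 2 * s := by
      have h1 := (abs_le.1 (Real.norm_eq_abs _ ▸ e2)).2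
      have h2 : s * Θ' w ≤ s * (-η) := by gcongr
      have h3 : η / 2 * ‖s • w‖ ≤ η / 2 * s := by gcongr
      linarith
    have hd : dist (r (u x + s • w)) (u x) ≤ 2 * s := by
      rw [dist_eq_norm]
      have : r (u x + s • w) - u x = (r (u x + s • w) - u x - s • w) + s • w := by abel
      rw [this]
      exact (norm_add_le _ _).trans (by linarith)
    refine ⟨hvM, fun h => absurd h (hball hux).2.2, by linarith, ?_, fun h => ?_, ?_⟩
    · have : 0 ≤ η / 2 * s := by positivity
      linarith
    · have : s = t / 2 := by rw [hs, cutoff_eq_one hρ h, one_mul]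
      rw [this] at hχ ⊢
      linarith
    · calc dist (Q (r (u x + s • w))) (Q (u x)) ≤ L * dist (r (u x + s • w)) (u x) := hQ _ _
        _ ≤ L * (2 * s) := by gcongr
        _ = 4 * L / η * (η / 2 * s) := by field_simp; ring
        _ ≤ _ := by gcongr; linarith

theorem exists_concave_bound {V : Type*} [NormedAddCommGroup V] [NormedSpace ℝ V]
    [FiniteDimensional ℝ V] {Θ : X → ℝ} (hΘ : ContDiffAt ℝ 2 Θ z) (ι : V →L[ℝ] X)
    (hneg : ∀ a ≠ 0, fderiv ℝ (fderiv ℝ Θ) z (ι a) (ι a) < 0) :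
    ∃ c > 0, ∃ ρ > 0, ContinuousOn (fderiv ℝ Θ) (Metric.ball z ρ) ∧
      ∀ y, dist y z < ρ → ∀ a, ‖a‖ = 1 → ∀ s, 0 ≤ s → s ≤ ρ →
        Θ (y + s • ι a) ≤ Θ y + s * fderiv ℝ Θ y (ι a) - c * s ^ 2 := by
  set B := fderiv ℝ (fderiv ℝ Θ) z with hB
  obtain ⟨c, hc, hBc⟩ : ∃ c > 0, ∀ a, ‖a‖ = 1 → B (ι a) (ι a) ≤ -(3 * c) := by
    obtain ⟨b, hb, h⟩ := (isCompact_sphere (0 : V) 1).exists_forall_le' (a := 0)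
      (f := fun a => -B (ι a) (ι a)) (by fun_prop) (fun a ha => by
        have : a ≠ 0 := by rintro rfl; simp at ha
        linarith [hneg a this])
    exact ⟨b / 3, by positivity, fun a ha => by linarith [h a (by simpa using ha)]⟩
  have hstrict : HasStrictFDerivAt (fderiv ℝ Θ) B z :=
    (hΘ.fderiv_right (m := 1) (by norm_num)).hasStrictFDerivAt one_ne_zero
  set D : ℝ := (‖ι‖ + 1) with hD
  have hDpos : 0 < D := by positivity
  obtain ⟨s₁, hs₁, ha₁⟩ := hstrict.exists_nhds_norm_sub_le
    (c := c / D ^ 2) (by positivity)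
  have hdiff : ∀ᶠ y in nhds z, ContDiffAt ℝ 1 Θ y :=
    (hΘ.of_le (by norm_num)).eventually (by simp)
  obtain ⟨ρ₀, hρ₀, hball⟩ := Metric.mem_nhds_iff.1 (Filter.inter_mem hs₁ hdiff)
  refine ⟨c, hc, ρ₀ / (2 * D), by positivity, ?_, ?_⟩
  · intro y hy
    have hy' : y ∈ Metric.ball z ρ₀ := Metric.ball_subset_ball (by
      rw [div_le_iff₀ (by positivity)]
      nlinarith [norm_nonneg ι]) hy
    have hy2 : ContDiffAt ℝ 1 Θ y := (hball hy').2
    exact (hy2.continuousAt_fderiv one_ne_zero).continuousWithinAt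
  · intro y hy a ha s hs hsρ
    have hιa : ‖ι a‖ ≤ D := by
      have := ι.le_opNorm a
      rw [ha, mul_one] at this
      linarith
    have hρD : ρ₀ / (2 * D) * D = ρ₀ / 2 := by field_simp
    have hρ2 : ρ₀ / (2 * D) ≤ ρ₀ / 2 := by
      rw [← hρD]
      exact le_mul_of_one_le_right (by positivity) (by linarith [norm_nonneg ι])
    have hmem : ∀ σ ∈ Set.Icc 0 s, y + σ • ι a ∈ Metric.ball z ρ₀ := by
      intro σ hσ
      rw [Metric.mem_ball]
      have : dist (y + σ • ι a) y ≤ ρ₀ / 2 := by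
        rw [dist_eq_norm, add_sub_cancel_left, norm_smul, Real.norm_of_nonneg hσ.1, ← hρD]
        exact mul_le_mul (hσ.2.trans hsρ) hιa (norm_nonneg _) (by positivity)
      linarith [dist_triangle (y + σ • ι a) y z]
    set g : ℝ → ℝ := fun σ => Θ (y + σ • ι a) - (σ * fderiv ℝ Θ y (ι a) - c * σ ^ 2) with hg
    have hgd : ∀ σ ∈ Set.Icc 0 s, HasDerivAt g
        (fderiv ℝ Θ (y + σ • ι a) (ι a) - (fderiv ℝ Θ y (ι a) - c * (2 * σ))) σ := by
      intro σ hσ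
      have hy2 : ContDiffAt ℝ 1 Θ (y + σ • ι a) := (hball (hmem σ hσ)).2
      have h1 : HasFDerivAt Θ (fderiv ℝ Θ (y + σ • ι a)) (y + σ • ι a) :=
        (hy2.differentiableAt one_ne_zero).hasFDerivAt
      have h2 : HasDerivAt (fun σ : ℝ => y + σ • ι a) (ι a) σ := by
        simpa using ((hasDerivAt_id σ).smul_const (ι a)).const_add y
      have h3 := h1.comp_hasDerivAt σ h2
      have h4 : HasDerivAt (fun σ : ℝ => σ * fderiv ℝ Θ y (ι a) - c * σ ^ 2)
          (fderiv ℝ Θ y (ι a) - c * (2 * σ)) σ := by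
        have := ((hasDerivAt_id σ).mul_const (fderiv ℝ Θ y (ι a))).sub
          (((hasDerivAt_id σ).pow 2).const_mul c)
        refine this.congr_deriv ?_
        simp
      exact h3.sub h4
    have hanti : AntitoneOn g (Set.Icc 0 s) := by
      refine antitoneOn_of_deriv_nonpos (convex_Icc 0 s)
        (fun σ hσ => (hgd σ hσ).continuousAt.continuousWithinAt)
        (fun σ hσ => (hgd σ (interior_subset hσ)).differentiableAt.differentiableWithinAt)
        fun σ hσ => ?_
      have hσ' := interior_subset hσ
      rw [(hgd σ hσ').deriv]
      have e := ha₁ _ (hball (hmem σ hσ')).1 _ (hball (by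
        simpa using hmem 0 ⟨le_rfl, hs⟩ : y ∈ Metric.ball z ρ₀)).1
      rw [add_sub_cancel_left] at e
      have e2 := (ContinuousLinearMap.le_opNorm
        (fderiv ℝ Θ (y + σ • ι a) - fderiv ℝ Θ y - B (σ • ι a)) (ι a)).trans
        (mul_le_mul_of_nonneg_right e (norm_nonneg _))
      have e3 : c / D ^ 2 * ‖σ • ι a‖ * ‖ι a‖ ≤ c * σ := by
        rw [norm_smul, Real.norm_of_nonneg hσ'.1]
        calc c / D ^ 2 * (σ * ‖ι a‖) * ‖ι a‖ ≤ c / D ^ 2 * (σ * D) * D := by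
              have := hσ'.1
              gcongr
          _ = c * σ := by field_simp
      have e4 := (abs_le.1 (Real.norm_eq_abs _ ▸ e2.trans e3)).2
      simp only [sub_apply, map_smul, smul_apply,
        smul_eq_mul] at e4
      have e5 : σ * B (ι a) (ι a) ≤ σ * -(3 * c) :=
        mul_le_mul_of_nonneg_left (hBc a ha) hσ'.1
      linarith
    have := hanti ⟨le_rfl, hs⟩ ⟨hs, le_rfl⟩ hs
    simp only [hg, zero_smul, add_zero, zero_mul, zero_sub] at this
    norm_num at this
    linarith

theorem continuous_clip (z : X) {R : ℝ} (hR : 0 < R) :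
    Continuous fun y => z + (R / max R ‖y - z‖) • (y - z) := by
  have : ∀ y : X, max R ‖y - z‖ ≠ 0 := fun y => (lt_max_of_lt_left hR).ne'
  have h : Continuous fun y => R / max R ‖y - z‖ := continuous_const.div (by fun_prop) this
  fun_prop

theorem clip_mem {R : ℝ} (hR : 0 < R) (y : X) :
    dist (z + (R / max R ‖y - z‖) • (y - z)) z ≤ R := by
  have h : 0 < max R ‖y - z‖ := lt_max_of_lt_left hR
  rw [dist_eq_norm, add_sub_cancel_left, norm_smul, Real.norm_of_nonneg (by positivity),
    div_mul_eq_mul_div, div_le_iff₀ h]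
  gcongr
  exact le_max_right _ _

theorem clip_eq_self {R : ℝ} (hR : 0 < R) {y : X} (hy : dist y z ≤ R) :
    z + (R / max R ‖y - z‖) • (y - z) = y := by
  rw [dist_eq_norm] at hy
  rw [max_eq_left hy, div_self hR.ne', one_smul, add_sub_cancel]

theorem pushable_of_concave {V : Type*} [NormedAddCommGroup V] [InnerProductSpace ℝ V]
    [FiniteDimensional ℝ V] (hr : IsNhdRetraction M Ω r) (hF : IsClosed F) (hzM : z ∈ M)
    (hzF : z ∉ F) {r' : X →L[ℝ] X} (hr' : HasStrictFDerivAt r r' z)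
    (hΘ : ContDiffAt ℝ 2 (χ ∘ r) z) (ι : V →L[ℝ] X)
    (hneg : ∀ a ≠ 0, fderiv ℝ (fderiv ℝ (χ ∘ r)) z (ι a) (ι a) < 0) (hK : AvoidsZero K V)
    (hQ : ∀ᶠ y in nhds z, Q y = Q z) {Λ : ℝ} (hΛ : 0 ≤ Λ) : Pushable K M F χ Q Λ z := by
  obtain ⟨c, hc, ρ₁, hρ₁, hcont, hconc⟩ := exists_concave_bound hΘ ι hneg
  obtain ⟨s₁, hs₁, ha₁⟩ := hr'.exists_nhds_norm_sub_le one_pos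
  obtain ⟨ρ₀, hρ₀, hball⟩ := Metric.mem_nhds_iff.1 (Filter.inter_mem (Filter.inter_mem
    (Filter.inter_mem hs₁ hQ) (Metric.ball_mem_nhds z hρ₁))
    (Filter.inter_mem (hr.isOpen.mem_nhds (hr.subset hzM)) (hF.isOpen_compl.mem_nhds hzF)))
  have hQ' : ∀ y ∈ Metric.ball z ρ₀, Q y = Q z := fun y hy => (hball hy).1.1.2
  have hρ₀₁ : ∀ y ∈ Metric.ball z ρ₀, dist y z < ρ₁ := fun y hy => (hball hy).1.2
  set C : ℝ := 1 + ‖r'‖ with hC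
  set A : ℝ := ‖ι‖ + 1 with hA
  have hC1 : 1 ≤ C := by rw [hC]; linarith [norm_nonneg r']
  have hA1 : 1 ≤ A := by rw [hA]; linarith [norm_nonneg ι]
  have hA0 : 0 < A := by linarith
  have hC0 : 0 < C := by linarith
  refine ⟨ρ₀ / 4, by positivity, min (ρ₀ / 4) ρ₁, by positivity, fun t ht ht₁ =>
    ⟨c * (t / (C * A)) ^ 2, by positivity, fun τ hτ u hu huM => ?_⟩⟩
  have ht₀ : t ≤ ρ₀ / 4 := ht₁.trans (min_le_left _ _)
  set s := t / (C * A) with hs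
  have hs0 : 0 < s := by positivity
  have hsA : C * (s * A) = t := by rw [hs]; field_simp
  have hsA' : s * A ≤ t := by
    rw [← hsA]; exact le_mul_of_one_le_left (by positivity) hC1
  have hst : s ≤ t := le_trans (le_mul_of_one_le_right hs0.le hA1) hsA'
  have hR : 0 < ρ₀ / 2 := by positivity
  set clip : X → X := fun y => z + (ρ₀ / 2 / max (ρ₀ / 2) ‖y - z‖) • (y - z) with hclip
  have hclipc : Continuous clip := continuous_clip z hR
  have hp1 : Continuous fun x => fderiv ℝ (χ ∘ r) (clip (u x)) :=
    hcont.comp_continuous (hclipc.comp hu) fun x => hρ₀₁ _ (by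
      rw [Metric.mem_ball]
      exact (clip_mem hR (u x)).trans_lt (by linarith))
  have hp : Continuous fun x => -(InnerProductSpace.toDual ℝ V).symm
      ((fderiv ℝ (χ ∘ r) (clip (u x))).comp ι) :=
    ((InnerProductSpace.toDual ℝ V).symm.continuous.comp (hp1.clm_comp continuous_const)).neg
  obtain ⟨q, hq, hqx⟩ := hK _ hp (τ / s) (by positivity)
  set a : K → V := fun x => ‖q x‖⁻¹ • q x with ha
  have hqn : ∀ x, ‖q x‖ ≠ 0 := fun x => norm_ne_zero_iff.2 (hqx x).2
  have hac : Continuous a := (hq.norm.inv₀ hqn).smul hq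
  have han : ∀ x, ‖a x‖ = 1 := fun x => by
    simp only [ha, norm_smul, norm_inv, norm_norm]; exact inv_mul_cancel₀ (hqn x)
  have hda : ∀ x, dist (u x) z ≤ ρ₀ / 2 → fderiv ℝ (χ ∘ r) (u x) (ι (a x)) ≤ τ / s := by
    intro x hx
    have hcl : clip (u x) = u x := clip_eq_self hR hx
    have h1 := (hqx x).1
    set p := (InnerProductSpace.toDual ℝ V).symm ((fderiv ℝ (χ ∘ r) (clip (u x))).comp ι) with hp
    have h2 : fderiv ℝ (χ ∘ r) (u x) (ι (a x)) = inner ℝ p (a x) := by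
      rw [hp, InnerProductSpace.toDual_symm_apply, hcl]; rfl
    have h3 : inner ℝ (q x) (a x) = ‖q x‖ := by
      simp only [ha, real_inner_smul_right, real_inner_self_eq_norm_sq]
      have := hqn x
      field_simp
    have h4 : inner ℝ (q x - -p) (a x) ≤ τ / s := by
      refine (real_inner_le_norm _ _).trans ?_
      rwa [han, mul_one]
    rw [inner_sub_left, inner_neg_left, h3] at h4
    rw [h2]
    linarith [norm_nonneg (q x)]
  have hιa : ∀ x, ‖ι (a x)‖ ≤ A := fun x => by
    have := ι.le_opNorm (a x)
    rw [han, mul_one] at this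
    linarith
  have hTe : ∀ x, ‖s • ι (a x)‖ ≤ s * A := fun x => by
    rw [norm_smul, Real.norm_of_nonneg hs0.le]
    exact mul_le_mul_of_nonneg_left (hιa x) hs0.le
  have hρ : 0 < ρ₀ / 4 := by positivity
  obtain ⟨hv, hvx⟩ := hr.push (z := z) (T := s * A) hρ
    (fun y hy => (hball (Metric.ball_subset_ball (by linarith) hy)).2.1) hu huM
    (e := fun x => s • ι (a x)) (by fun_prop) hTe
  refine ⟨_, hv, fun x => ?_⟩
  obtain ⟨hvM, hvu⟩ := hvx x
  by_cases hx : 2 * (ρ₀ / 4) ≤ dist (u x) z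
  · rw [hvu hx]
    refine ⟨huM x, fun _ => rfl, by simp [ht.le], by linarith, fun h => by linarith, ?_⟩
    simp only [dist_self, sub_self, zero_add]; positivity
  · set σ := cutoff z (ρ₀ / 4) (u x) * s with hσ
    have hσ0 : 0 ≤ σ := mul_nonneg (cutoff_nonneg _ _ _) hs0.le
    have hσs : σ ≤ s := mul_le_of_le_one_left hs0.le (cutoff_le_one _ _ _)
    have hue : u x + cutoff z (ρ₀ / 4) (u x) • s • ι (a x) = u x + σ • ι (a x) := by
      rw [smul_smul]
    rw [hue] at hvM ⊢
    have hsw : ‖σ • ι (a x)‖ ≤ s * A := by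
      rw [norm_smul, Real.norm_of_nonneg hσ0]
      exact mul_le_mul hσs (hιa x) (norm_nonneg _) hs0.le
    have hux : u x ∈ Metric.ball z ρ₀ := by rw [Metric.mem_ball]; linarith
    have hux' : u x + σ • ι (a x) ∈ Metric.ball z ρ₀ := by
      rw [Metric.mem_ball]
      have : dist (u x + σ • ι (a x)) (u x) ≤ s * A := by simpa [dist_eq_norm] using hsw
      linarith [dist_triangle (u x + σ • ι (a x)) (u x) z]
    have e1 := ha₁ _ (hball hux').1.1.1 _ (hball hux).1.1.1
    rw [hr.eq_self _ (huM x), add_sub_cancel_left] at e1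
    have hd : dist (r (u x + σ • ι (a x))) (u x) ≤ t := by
      rw [dist_eq_norm, ← hsA]
      have e2 := r'.le_opNorm (σ • ι (a x))
      have : r (u x + σ • ι (a x)) - u x =
        (r (u x + σ • ι (a x)) - u x - r' (σ • ι (a x))) + r' (σ • ι (a x)) := by abel
      rw [this]
      calc _ ≤ _ := norm_add_le _ _
        _ ≤ C * ‖σ • ι (a x)‖ := by rw [hC]; linarith
        _ ≤ _ := by gcongr
    have hχ : χ (r (u x + σ • ι (a x))) ≤ χ (u x) + τ - c * σ ^ 2 := by
      have h1 := hconc (u x) (hρ₀₁ _ hux) (a x) (han x) σ hσ0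
        (hσs.trans (hst.trans (ht₁.trans (min_le_right _ _))))
      simp only [Function.comp_apply, hr.eq_self _ (huM x)] at h1
      have h2 : σ * fderiv ℝ (χ ∘ r) (u x) (ι (a x)) ≤ s * (τ / s) :=
        (mul_le_mul_of_nonneg_left (hda x (by linarith)) hσ0).trans
          (mul_le_mul_of_nonneg_right hσs (by positivity))
      rw [mul_div_cancel₀ _ hs0.ne'] at h2
      have h3 : (fun y => χ (r y)) = χ ∘ r := rfl
      linarith
    have hcσ : 0 ≤ c * σ ^ 2 := by positivity
    refine ⟨hvM, fun h => absurd h (hball hux).2.2, hd, by linarith, fun h => ?_, ?_⟩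
    · have : σ = s := by rw [hσ, cutoff_eq_one hρ h, one_mul]
      rw [this] at hχ ⊢
      linarith
    · have hvb : r (u x + σ • ι (a x)) ∈ Metric.ball z ρ₀ := by
        rw [Metric.mem_ball]
        linarith [dist_triangle (r (u x + σ • ι (a x))) (u x) z]
      rw [hQ' _ hux, hQ' _ hvb, dist_self]
      exact mul_nonneg hΛ (by linarith)

end LocalPush

section NegativeSubspace

theorem bilin_sum_self {E ι : Type*} [AddCommGroup E] [Module ℝ E] [Fintype ι]
    (B : LinearMap.BilinForm ℝ E) {w : ι → E} (hw : ∀ i j, i ≠ j → B (w i) (w j) = 0) (a : ι → ℝ) :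
    B (∑ i, a i • w i) (∑ i, a i • w i) = ∑ i, a i ^ 2 * B (w i) (w i) := by
  simp only [map_sum, LinearMap.sum_apply, map_smul, LinearMap.smul_apply, smul_eq_mul]
  refine Finset.sum_congr rfl fun i _ => ?_
  rw [Finset.sum_eq_single i (fun j _ hj => by rw [hw j i hj]; ring) (by simp)]
  ring

theorem exists_negative_family {E : Type*} [AddCommGroup E] [Module ℂ E] [FiniteDimensional ℂ E]
    (B : LinearMap.BilinForm ℝ E) (hs : ∀ x y, B x y = B y x)
    (hB : ∀ w ≠ 0, B w w + B (Complex.I • w) (Complex.I • w) < 0) {m : ℕ}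
    (hm : m ≤ Module.finrank ℂ E) :
    ∃ w : Fin m → E, (∀ i j, i ≠ j → B (w i) (w j) = 0) ∧ ∀ i, B (w i) (w i) < 0 := by
  classical
  have : FiniteDimensional ℝ E := FiniteDimensional.complexToReal E
  obtain ⟨d, hd, v, hv'⟩ : ∃ d, d = Module.finrank ℝ E ∧ ∃ v : Module.Basis (Fin d) ℝ E,
      ∀ i j, i ≠ j → B (v i) (v j) = 0 := by
    obtain ⟨v, hv⟩ := LinearMap.BilinForm.exists_orthogonal_basis (B := B) ⟨hs⟩
    exact ⟨_, rfl, v, fun i j hij => hv hij⟩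
  let P := {i : Fin d // 0 ≤ B (v i) (v i)}
  have hlin : LinearIndependent ℝ fun i : P => v i.1 :=
    v.linearIndependent.comp _ Subtype.val_injective
  let S : (P → ℝ) →ₗ[ℝ] E := Fintype.linearCombination ℝ fun i : P => v i.1
  have hS : ∀ a, S a = ∑ i, a i • v i.1 := fun a => Fintype.linearCombination_apply ℝ _ a
  have hSinj : ∀ a, S a = 0 → a = 0 := by
    intro a ha
    rw [hS] at ha
    exact funext (Fintype.linearIndependent_iff.1 hlin a ha)
  have hSnn : ∀ a, 0 ≤ B (S a) (S a) := by
    intro a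
    rw [hS, bilin_sum_self B (w := fun i : P => v i.1)
      (fun i j hij => hv' _ _ (fun h => hij (Subtype.ext h)))]
    exact Finset.sum_nonneg fun i _ => mul_nonneg (sq_nonneg _) i.2
  let J : E →ₗ[ℝ] E :=
    { toFun := fun x => Complex.I • x
      map_add' := fun x y => smul_add _ _ _
      map_smul' := fun c x => smul_comm _ _ _ }
  have hT : Function.Injective
      ((S ∘ₗ LinearMap.fst ℝ (P → ℝ) (P → ℝ)) + (J ∘ₗ S ∘ₗ LinearMap.snd ℝ (P → ℝ) (P → ℝ))) := by
    rw [injective_iff_map_eq_zero]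
    rintro ⟨a, b⟩ hab
    have hab' : S a + Complex.I • S b = 0 := hab
    have hSa : S a = -(Complex.I • S b) := eq_neg_of_add_eq_zero_left hab'
    have hb : S b = 0 := by
      by_contra hb
      have h1 := hB _ hb
      have h2 := hSnn a
      rw [hSa] at h2
      simp only [map_neg, LinearMap.neg_apply, neg_neg] at h2
      linarith [hSnn b]
    rw [hb, smul_zero, neg_zero] at hSa
    rw [hSinj a hSa, hSinj b hb]
    rfl
  have hcard := LinearMap.finrank_le_finrank_of_injective hT
  rw [Module.finrank_prod, Module.finrank_fintype_fun_eq_card, ← hd] at hcard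
  have h2 : d = 2 * Module.finrank ℂ E := hd ▸ finrank_real_of_complex E
  have hcompl : Fintype.card {i : Fin d // ¬ 0 ≤ B (v i) (v i)} = d - Fintype.card P := by
    rw [Fintype.card_subtype_compl, Fintype.card_fin]
  have : Fintype.card (Fin m) ≤ Fintype.card {i : Fin d // ¬ 0 ≤ B (v i) (v i)} := by
    rw [hcompl, Fintype.card_fin]; omega
  obtain ⟨g⟩ := Function.Embedding.nonempty_of_card_le this
  exact ⟨fun i => v (g i).1, fun i j hij => hv' _ _ fun h => hij (g.injective (Subtype.ext h)),
    fun i => not_le.1 (g i).2⟩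

theorem exists_negative_map {M m : ℕ} (L : Submodule ℂ (Fin M → ℂ))
    (hm : m ≤ Module.finrank ℂ L) (B : (Fin M → ℂ) →L[ℝ] (Fin M → ℂ) →L[ℝ] ℝ)
    (hs : ∀ v w, B v w = B w v)
    (hB : ∀ w ∈ L, w ≠ 0 → B w w + B (Complex.I • w) (Complex.I • w) < 0) :
    ∃ ι : EuclideanSpace ℝ (Fin m) →L[ℝ] (Fin M → ℂ), ∀ a ≠ 0, B (ι a) (ι a) < 0 := by
  let BL : LinearMap.BilinForm ℝ L := LinearMap.mk₂ ℝ (fun x y => B x.1 y.1)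
    (fun x y z => by simp) (fun c x y => by
      have : (c • x).1 = c • x.1 := rfl
      simp [this]) (fun x y z => by simp) (fun c x y => by
      have : (c • y).1 = c • y.1 := rfl
      simp [this])
  obtain ⟨w, hw, hneg⟩ := exists_negative_family BL (fun x y => hs _ _)
    (fun x hx => hB x.1 x.2 fun h => hx (Subtype.ext h)) hm
  refine ⟨LinearMap.toContinuousLinearMap
    ((Fintype.linearCombination ℝ fun i => (w i : Fin M → ℂ)) ∘ₗ
      (EuclideanSpace.equiv (Fin m) ℝ).toLinearMap), fun a ha => ?_⟩
  have h1 := bilin_sum_self (LinearMap.mk₂ ℝ (fun x y => B x y)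
    (fun x y z => by simp) (fun c x y => by simp) (fun x y z => by simp) (fun c x y => by simp))
    (w := fun i => (w i : Fin M → ℂ)) hw a
  simp only [LinearMap.mk₂_apply] at h1
  have h2 : B (∑ i, a i • (w i : Fin M → ℂ)) (∑ i, a i • (w i : Fin M → ℂ)) < 0 := by
    rw [h1]
    obtain ⟨i, hi⟩ : ∃ i, a i ≠ 0 := by
      by_contra! h
      exact ha (by ext i; simpa using h i)
    refine Finset.sum_neg' (fun j _ => ?_) ⟨i, Finset.mem_univ _, ?_⟩
    · exact mul_nonpos_of_nonneg_of_nonpos (sq_nonneg _) (hneg j).le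
    · exact mul_neg_of_pos_of_neg (by positivity) (hneg i)
  simpa [Fintype.linearCombination_apply] using h2

end NegativeSubspace

section Jets

variable {E : Type*} [NormedAddCommGroup E] [NormedSpace ℝ E]

/-- `u` has first derivative `a` and second derivative `b` at `0`. -/
def HasJetTwo (u : ℝ → E) (a b : E) : Prop :=
  ∃ u' : ℝ → E, (∀ᶠ σ in nhds 0, HasDerivAt u (u' σ) σ) ∧ u' 0 = a ∧ HasDerivAt u' b 0

theorem HasJetTwo.unique {u : ℝ → E} {a b a' b' : E} (h : HasJetTwo u a b)
    (h' : HasJetTwo u a' b') : a = a' ∧ b = b' := by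
  obtain ⟨v, hv, rfl, hb⟩ := h
  obtain ⟨w, hw, rfl, hb'⟩ := h'
  have hvw : v =ᶠ[nhds 0] w := by
    filter_upwards [hv, hw] with σ h₁ h₂ using h₁.unique h₂
  exact ⟨hvw.eq_of_nhds, hb.unique (hb'.congr_of_eventuallyEq hvw)⟩

theorem HasJetTwo.congr {u v : ℝ → E} {a b : E} (h : HasJetTwo u a b) (huv : v =ᶠ[nhds 0] u) :
    HasJetTwo v a b := by
  obtain ⟨u', hu, ha, hb⟩ := h
  refine ⟨u', ?_, ha, hb⟩
  filter_upwards [hu, huv.eventuallyEq_nhds] with σ h₁ h₂ using h₁.congr_of_eventuallyEq h₂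

theorem HasJetTwo.sum {ι : Type*} (s : Finset ι) {u : ι → ℝ → E} {a b : ι → E}
    (h : ∀ i ∈ s, HasJetTwo (u i) (a i) (b i)) :
    HasJetTwo (fun σ => ∑ i ∈ s, u i σ) (∑ i ∈ s, a i) (∑ i ∈ s, b i) := by
  choose! u' hu ha hb using h
  refine ⟨fun σ => ∑ i ∈ s, u' i σ, ?_, Finset.sum_congr rfl ha, HasDerivAt.fun_sum hb⟩
  filter_upwards [(Filter.eventually_all_finset s).2 hu] with σ hσ using HasDerivAt.fun_sum hσ

theorem HasJetTwo.sub {u v : ℝ → E} {a b a' b' : E} (h : HasJetTwo u a b)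
    (h' : HasJetTwo v a' b') : HasJetTwo (fun σ => u σ - v σ) (a - a') (b - b') := by
  obtain ⟨u', hu, rfl, hb⟩ := h
  obtain ⟨v', hv, rfl, hb'⟩ := h'
  refine ⟨fun σ => u' σ - v' σ, ?_, rfl, hb.sub hb'⟩
  filter_upwards [hu, hv] with σ h₁ h₂ using h₁.sub h₂

theorem HasJetTwo.const_mul {u : ℝ → ℝ} {a b : ℝ} (c : ℝ) (h : HasJetTwo u a b) :
    HasJetTwo (fun σ => c * u σ) (c * a) (c * b) := by
  obtain ⟨u', hu, rfl, hb⟩ := h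
  refine ⟨fun σ => c * u' σ, ?_, rfl, hb.const_mul c⟩
  filter_upwards [hu] with σ h₁ using h₁.const_mul c

theorem HasJetTwo.log {u : ℝ → ℝ} {a b : ℝ} (h : HasJetTwo u a b) (h0 : 0 < u 0) :
    HasJetTwo (fun σ => Real.log (u σ)) (a / u 0) (b / u 0 - (a / u 0) ^ 2) := by
  obtain ⟨u', hu, rfl, hb⟩ := h
  refine ⟨fun σ => u' σ / u σ, ?_, rfl, ?_⟩
  · have hpos : ∀ᶠ σ in nhds 0, 0 < u σ :=
      hu.self_of_nhds.continuousAt.eventually (lt_mem_nhds h0)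
    filter_upwards [hu, hpos] with σ h₁ h₂ using h₁.log h₂.ne'
  · refine (hb.fun_div hu.self_of_nhds h0.ne').congr_deriv ?_
    field_simp

theorem HasJetTwo.norm_sq {F : Type*} [NormedAddCommGroup F] [InnerProductSpace ℝ F]
    {u : ℝ → F} {a b : F} (h : HasJetTwo u a b) :
    HasJetTwo (fun σ => ‖u σ‖ ^ 2) (2 * inner ℝ (u 0) a) (2 * (‖a‖ ^ 2 + inner ℝ (u 0) b)) := by
  obtain ⟨u', hu, rfl, hb⟩ := h
  refine ⟨fun σ => 2 * inner ℝ (u σ) (u' σ), ?_, rfl, ?_⟩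
  · filter_upwards [hu] with σ h₁ using h₁.norm_sq
  · refine ((hu.self_of_nhds.inner ℝ hb).const_mul 2).congr_deriv ?_
    rw [real_inner_self_eq_norm_sq, add_comm]

theorem ContDiffAt.hasJetTwo_line {X : Type*} [NormedAddCommGroup X] [NormedSpace ℝ X]
    {Θ : X → E} {z : X} (hΘ : ContDiffAt ℝ 2 Θ z) (w : X) :
    HasJetTwo (fun σ => Θ (z + σ • w)) (fderiv ℝ Θ z w) (fderiv ℝ (fderiv ℝ Θ) z w w) := by
  have hline : ∀ σ : ℝ, HasDerivAt (fun σ : ℝ => z + σ • w) w σ := fun σ => by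
    simpa using ((hasDerivAt_id σ).smul_const w).const_add z
  have h0 : z + (0 : ℝ) • w = z := by simp
  refine ⟨fun σ => fderiv ℝ Θ (z + σ • w) w, ?_, by simp, ?_⟩
  · have h1 : ∀ᶠ y in nhds z, ContDiffAt ℝ 1 Θ y :=
      (hΘ.of_le (by norm_num)).eventually (by simp)
    have h2 : Filter.Tendsto (fun σ : ℝ => z + σ • w) (nhds 0) (nhds z) := by
      simpa using (hline 0).continuousAt.tendsto
    filter_upwards [h2.eventually h1] with σ hσ
    exact ((hσ.differentiableAt one_ne_zero).hasFDerivAt).comp_hasDerivAt σ (hline σ)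
  · have h1 : HasFDerivAt (fderiv ℝ Θ) (fderiv ℝ (fderiv ℝ Θ) z) (z + (0 : ℝ) • w) := by
      rw [h0]
      exact ((hΘ.fderiv_right (m := 1) (by norm_num)).differentiableAt one_ne_zero).hasFDerivAt
    have h2 := h1.comp_hasDerivAt (0 : ℝ) (hline 0)
    exact h2.clm_apply (hasDerivAt_const 0 w) |>.congr_deriv (by simp)

theorem ContDiffAt.hasJetTwo_complex {G : ℂ → ℂ} (hG : ContDiffAt ℂ 2 G 0) (c : ℂ) :
    HasJetTwo (fun σ : ℝ => G (c * σ)) (c * deriv G 0) (c ^ 2 * deriv (deriv G) 0) := by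
  have hline : ∀ σ : ℝ, HasDerivAt (fun σ : ℝ => c * (σ : ℂ)) c σ := fun σ => by
    simpa using (Complex.ofRealCLM.hasDerivAt (x := σ)).const_mul c
  have h2 : Filter.Tendsto (fun σ : ℝ => c * (σ : ℂ)) (nhds 0) (nhds 0) := by
    simpa using (hline 0).continuousAt.tendsto
  refine ⟨fun σ => c * deriv G (c * σ), ?_, by simp, ?_⟩
  · have h1 : ∀ᶠ y in nhds (0 : ℂ), ContDiffAt ℂ 1 G y :=
      (hG.of_le (by norm_num)).eventually (by simp)
    filter_upwards [h2.eventually h1] with σ hσ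
    exact (((hσ.differentiableAt one_ne_zero).hasDerivAt).comp σ (hline σ)).congr_deriv
      (mul_comm _ _)
  · have h3 : DifferentiableAt ℂ (deriv G) 0 := by
      have h4 : ContDiffAt ℂ 1 (fderiv ℂ G) 0 := hG.fderiv_right (m := 1) (by norm_num)
      have h5 : deriv G = fun y => fderiv ℂ G y 1 := by ext y; simp
      rw [h5]
      exact (h4.differentiableAt one_ne_zero).clm_apply (differentiableAt_const _)
    have h4 : HasDerivAt (deriv G) (deriv (deriv G) 0) (c * ((0 : ℝ) : ℂ)) := by
      simpa using h3.hasDerivAt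
    have h5 := (h4.comp (0 : ℝ) (hline 0)).const_mul c
    refine HasDerivAt.congr_deriv h5 ?_
    ring

end Jets

section MilnorRetraction

variable {M k d : ℕ} {h : (Fin M → ℂ) → ℂ} {f : Fin k → (Fin M → ℂ) → ℂ} {z : Fin M → ℂ}

/-- The retraction onto the level set `h = 1` of a function `h` homogeneous of degree `d`. -/
noncomputable def levelRetract (h : (Fin M → ℂ) → ℂ) (d : ℕ) (y : Fin M → ℂ) : Fin M → ℂ :=
  Complex.exp (-(Complex.log (h y) / d)) • y

theorem levelRetract_eq_self {y : Fin M → ℂ} (hy : h y = 1) : levelRetract h d y = y := by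
  simp [levelRetract, hy]

theorem contDiffAt_levelRetract (hh : ContDiff ℂ 2 h) (hz : 0 < (h z).re) :
    ContDiffAt ℂ 2 (levelRetract h d) z := by
  have h1 : ContDiffAt ℂ 2 (fun y => Complex.log (h y)) z :=
    (Complex.contDiffAt_log (Or.inl hz)).comp z hh.contDiffAt
  exact ((h1.div_const _).neg.cexp).smul contDiffAt_id

theorem isNhdRetraction_levelRetract (hd : d ≠ 0) (hh : ContDiff ℂ 2 h)
    (hhom : ∀ (c : ℂ) x, h (c • x) = c ^ d * h x) :
    IsNhdRetraction {x | h x = 1} {x | 0 < (h x).re} (levelRetract h d) where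
  isOpen := isOpen_lt continuous_const (Complex.continuous_re.comp hh.continuous)
  subset := fun x hx => by
    have : h x = 1 := hx
    simp [this]
  continuousOn := fun x hx => (contDiffAt_levelRetract hh hx).continuousAt.continuousWithinAt
  mapsTo := fun x hx => by
    have hx0 : h x ≠ 0 := fun h0 => by
      have : 0 < (h x).re := hx
      simp [h0] at this
    have hd' : (d : ℂ) ≠ 0 := by exact_mod_cast hd
    show h (levelRetract h d x) = 1
    rw [levelRetract, hhom, ← Complex.exp_nat_mul, mul_neg, mul_div_cancel₀ _ hd', Complex.exp_neg,
      Complex.exp_log hx0, inv_mul_cancel₀ hx0]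
  eq_self := fun y hy => levelRetract_eq_self hy

theorem hasDerivAt_levelRetract_line (hh : ContDiff ℂ 2 h) (hz : h z = 1) {w : Fin M → ℂ}
    (hw : fderiv ℂ h z w = 0) :
    HasDerivAt (fun ζ : ℂ => levelRetract h d (z + ζ • w)) w 0 := by
  have hline : HasDerivAt (fun ζ : ℂ => z + ζ • w) w 0 := by
    simpa using ((hasDerivAt_id (0 : ℂ)).smul_const w).const_add z
  have h0 : z + (0 : ℂ) • w = z := by simp
  have h1 : HasDerivAt (fun ζ : ℂ => h (z + ζ • w)) 0 0 := by
    have h2 : HasFDerivAt h (fderiv ℂ h z) (z + (0 : ℂ) • w) := by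
      rw [h0]; exact (hh.differentiable (by norm_num) z).hasFDerivAt
    exact hw ▸ h2.comp_hasDerivAt (0 : ℂ) hline
  have h2 : HasDerivAt (fun ζ : ℂ => Complex.log (h (z + ζ • w))) 0 0 := by
    have := h1.clog (by rw [h0, hz]; exact Complex.one_mem_slitPlane)
    simpa using this
  have h3 := ((h2.div_const (d : ℂ)).neg.cexp).smul hline
  refine h3.congr_deriv ?_
  simp [hz]

theorem fderiv_levelRetract (hh : ContDiff ℂ 2 h) (hz : h z = 1) {w : Fin M → ℂ}
    (hw : fderiv ℂ h z w = 0) : fderiv ℂ (levelRetract h d) z w = w := by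
  have hline : HasDerivAt (fun ζ : ℂ => z + ζ • w) w 0 := by
    simpa using ((hasDerivAt_id (0 : ℂ)).smul_const w).const_add z
  have h2 : HasFDerivAt (levelRetract h d) (fderiv ℂ (levelRetract h d) z) (z + (0 : ℂ) • w) := by
    rw [show z + (0 : ℂ) • w = z by simp]
    exact ((contDiffAt_levelRetract hh (by simp [hz])).differentiableAt (by norm_num)).hasFDerivAt
  have h3 := h2.comp_hasDerivAt (0 : ℂ) hline
  exact h3.unique (hasDerivAt_levelRetract_line (d := d) hh hz hw)

theorem hasStrictFDerivAt_levelRetract (hh : ContDiff ℂ 2 h) (hz : h z = 1) :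
    HasStrictFDerivAt (levelRetract h d) ((fderiv ℂ (levelRetract h d) z).restrictScalars ℝ) z :=
  ((contDiffAt_levelRetract hh (by simp [hz])).hasStrictFDerivAt (by norm_num)).restrictScalars ℝ

/-- The sum of the squared absolute values of the functions `f j`. -/
noncomputable def sqSum (f : Fin k → (Fin M → ℂ) → ℂ) (x : Fin M → ℂ) : ℝ := ∑ j, ‖f j x‖ ^ 2

/-- A truncated, strictly plurisuperharmonic perturbation of the logarithm of `sqSum f`. -/
noncomputable def logPotential (f : Fin k → (Fin M → ℂ) → ℂ) (ε lo : ℝ) (x : Fin M → ℂ) : ℝ :=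
  Real.log (max (sqSum f x * Real.exp (-(ε * ∑ i, ‖x i‖ ^ 2))) (Real.exp lo))

theorem sqSum_nonneg (f : Fin k → (Fin M → ℂ) → ℂ) (x : Fin M → ℂ) : 0 ≤ sqSum f x :=
  Finset.sum_nonneg fun _ _ => by positivity

theorem sqSum_eq_zero {x : Fin M → ℂ} : sqSum f x = 0 ↔ ∀ j, f j x = 0 := by
  simp [sqSum, Finset.sum_eq_zero_iff_of_nonneg]

theorem continuous_sqSum (hf : ∀ j, Continuous (f j)) : Continuous (sqSum f) := by
  unfold sqSum; fun_prop

theorem logPotential_eq {ε lo : ℝ} {x : Fin M → ℂ}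
    (hx : Real.exp lo < sqSum f x * Real.exp (-(ε * ∑ i, ‖x i‖ ^ 2))) :
    logPotential f ε lo x = Real.log (sqSum f x) - ε * ∑ i, ‖x i‖ ^ 2 := by
  have h0 : sqSum f x ≠ 0 := fun h => by
    rw [h, zero_mul] at hx
    exact (Real.exp_pos lo).not_gt hx
  rw [logPotential, max_eq_left hx.le, Real.log_mul h0 (Real.exp_ne_zero _), Real.log_exp]
  ring

theorem logPotential_levelRetract_eventuallyEq (hh : ContDiff ℂ 2 h) (hf : ∀ j, Continuous (f j))
    (hz : h z = 1) {ε lo : ℝ}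
    (hlo : Real.exp lo < sqSum f z * Real.exp (-(ε * ∑ i, ‖z i‖ ^ 2))) :
    (logPotential f ε lo ∘ levelRetract h d) =ᶠ[nhds z]
      fun y => Real.log (∑ j, ‖f j (levelRetract h d y)‖ ^ 2) -
        ε * ∑ i, ‖levelRetract h d y i‖ ^ 2 := by
  have hc : ContinuousAt (levelRetract h d) z :=
    (contDiffAt_levelRetract hh (by simp [hz])).continuousAt
  have hc2 : Continuous fun x => sqSum f x * Real.exp (-(ε * ∑ i, ‖x i‖ ^ 2)) := by
    have := continuous_sqSum hf
    fun_prop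
  have h1 := (hc2.continuousAt (x := levelRetract h d z)).comp hc
  rw [← levelRetract_eq_self (d := d) hz] at hlo
  filter_upwards [h1.eventually (lt_mem_nhds hlo)] with y hy
  exact logPotential_eq hy

theorem contDiffAt_logPotential (hh : ContDiff ℂ 2 h) (hf : ∀ j, ContDiff ℂ 2 (f j))
    (hz : h z = 1) {ε lo : ℝ}
    (hlo : Real.exp lo < sqSum f z * Real.exp (-(ε * ∑ i, ‖z i‖ ^ 2))) :
    ContDiffAt ℝ 2 (logPotential f ε lo ∘ levelRetract h d) z := by
  refine ContDiffAt.congr_of_eventuallyEq ?_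
    (logPotential_levelRetract_eventuallyEq hh (fun j => (hf j).continuous) hz hlo)
  have hr := (contDiffAt_levelRetract (d := d) hh (z := z) (by simp [hz])).restrict_scalars ℝ
  have h0 : ∑ j, ‖f j (levelRetract h d z)‖ ^ 2 ≠ 0 := fun h0 => by
    rw [levelRetract_eq_self hz] at h0
    rw [sqSum, h0, zero_mul] at hlo
    exact (Real.exp_pos lo).not_gt hlo
  have hfj : ∀ j, ContDiffAt ℝ 2 (fun y => f j (levelRetract h d y)) z := fun j =>
    (((hf j).restrict_scalars ℝ).contDiffAt).comp z hr
  have hri : ∀ i, ContDiffAt ℝ 2 (fun y => levelRetract h d y i) z := fun i =>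
    (contDiffAt_pi.1 hr) i
  refine (ContDiffAt.log (ContDiffAt.sum fun j _ => (hfj j).norm_sq ℝ) h0).sub
    (contDiffAt_const.mul (ContDiffAt.sum fun i _ => (hri i).norm_sq ℝ))

theorem hasJetTwo_logPotential (hh : ContDiff ℂ 2 h) (hf : ∀ j, ContDiff ℂ 2 (f j))
    (hz : h z = 1) {ε lo : ℝ}
    (hlo : Real.exp lo < sqSum f z * Real.exp (-(ε * ∑ i, ‖z i‖ ^ 2)))
    {w : Fin M → ℂ} (hw : fderiv ℂ h z w = 0) :
    ∃ (e : Fin k → ℂ) (e' : Fin M → ℂ), ∀ c : ℂ,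
      HasJetTwo (fun σ : ℝ => (logPotential f ε lo ∘ levelRetract h d) (z + σ • c • w))
        ((∑ j, 2 * inner ℝ (f j z) (c * fderiv ℂ (f j) z w)) / sqSum f z -
          ε * ∑ i, 2 * inner ℝ (z i) (c * w i))
        ((∑ j, 2 * (‖c * fderiv ℂ (f j) z w‖ ^ 2 + inner ℝ (f j z) (c ^ 2 * e j))) / sqSum f z -
          ((∑ j, 2 * inner ℝ (f j z) (c * fderiv ℂ (f j) z w)) / sqSum f z) ^ 2 -
          ε * ∑ i, 2 * (‖c * w i‖ ^ 2 + inner ℝ (z i) (c ^ 2 * e' i))) := by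
  set R : ℂ → Fin M → ℂ := fun ζ => levelRetract h d (z + ζ • w) with hR
  have hR0 : R 0 = z := by simp [hR, levelRetract_eq_self hz]
  have hRd : HasDerivAt R w 0 := hasDerivAt_levelRetract_line hh hz hw
  have hRc : ContDiffAt ℂ 2 R 0 := by
    have h1 : ContDiffAt ℂ 2 (levelRetract h d) (z + (0 : ℂ) • w) := by
      rw [show z + (0 : ℂ) • w = z by simp]
      exact contDiffAt_levelRetract hh (by simp [hz])
    have h2 : ContDiffAt ℂ 2 (fun ζ : ℂ => z + ζ • w) 0 := by fun_prop
    exact h1.comp (0 : ℂ) h2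
  have hGc : ∀ j, ContDiffAt ℂ 2 (fun ζ => f j (R ζ)) 0 := fun j =>
    ((hf j).contDiffAt (x := R 0)).comp (0 : ℂ) hRc
  have hGd : ∀ j, deriv (fun ζ => f j (R ζ)) 0 = fderiv ℂ (f j) z w := fun j => by
    have h1 : HasFDerivAt (f j) (fderiv ℂ (f j) z) (R 0) := by
      rw [hR0]; exact ((hf j).differentiable (by norm_num) z).hasFDerivAt
    exact (h1.comp_hasDerivAt (0 : ℂ) hRd).deriv
  have hRic : ∀ i, ContDiffAt ℂ 2 (fun ζ => R ζ i) 0 := fun i => contDiffAt_pi.1 hRc i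
  have hRid : ∀ i, deriv (fun ζ => R ζ i) 0 = w i := fun i => (hasDerivAt_pi.1 hRd i).deriv
  refine ⟨fun j => deriv (deriv (fun ζ => f j (R ζ))) 0,
    fun i => deriv (deriv (fun ζ => R ζ i)) 0, fun c => ?_⟩
  have hN := HasJetTwo.sum Finset.univ fun j _ => ((hGc j).hasJetTwo_complex c).norm_sq
  have hI := HasJetTwo.sum Finset.univ fun i _ => ((hRic i).hasJetTwo_complex c).norm_sq
  have hφ : 0 < sqSum f z := by
    by_contra h0
    have : sqSum f z = 0 := le_antisymm (not_lt.1 h0) (sqSum_nonneg f z)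
    rw [this, zero_mul] at hlo
    exact (Real.exp_pos lo).not_gt hlo
  have h0 : ∑ j, ‖f j (R (c * ((0 : ℝ) : ℂ)))‖ ^ 2 = sqSum f z := by simp [hR0, sqSum]
  have hJ := (hN.log (by rw [h0]; exact hφ)).sub (hI.const_mul ε)
  simp only [h0] at hJ
  simp only [hGd, hRid, Complex.ofReal_zero, mul_zero, hR0] at hJ
  refine hJ.congr ?_
  have htend : Filter.Tendsto (fun σ : ℝ => z + σ • c • w) (nhds 0) (nhds z) := by
    have : Continuous fun σ : ℝ => z + σ • c • w := by fun_prop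
    simpa using this.tendsto 0
  filter_upwards [htend.eventually (logPotential_levelRetract_eventuallyEq (d := d) hh
    (fun j => (hf j).continuous) hz hlo)] with σ hσ
  rw [hσ]
  have : z + σ • c • w = z + (c * (σ : ℂ)) • w := by
    rw [mul_comm, mul_smul, Complex.coe_smul]
  simp only [hR, this]

end MilnorRetraction

section ConcretePush

variable {K Y : Type*} [TopologicalSpace K] [PseudoMetricSpace Y] {M k d : ℕ}
  {h : (Fin M → ℂ) → ℂ} {f : Fin k → (Fin M → ℂ) → ℂ} {z : Fin M → ℂ} {Q : (Fin M → ℂ) → Y}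

theorem sqSum_pos_of_lt {ε lo : ℝ}
    (hlo : Real.exp lo < sqSum f z * Real.exp (-(ε * ∑ i, ‖z i‖ ^ 2))) : 0 < sqSum f z := by
  by_contra h0
  have : sqSum f z = 0 := le_antisymm (not_lt.1 h0) (sqSum_nonneg f z)
  rw [this, zero_mul] at hlo
  exact (Real.exp_pos lo).not_gt hlo

theorem isClosed_commonZeros (hf : ∀ j, Continuous (f j)) : IsClosed {x | ∀ j, f j x = 0} := by
  simp only [Set.ofPred_forall]
  exact isClosed_iInter fun j => isClosed_eq (hf j) continuous_const

theorem exists_submodule_tangent (ℓ : (Fin M → ℂ) →ₗ[ℂ] ℂ) (g : Fin k → (Fin M → ℂ) →ₗ[ℂ] ℂ)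
    {v : Fin k → ℂ} (hv : v ≠ 0) {m : ℕ} (hm : m + k ≤ M) :
    ∃ L : Submodule ℂ (Fin M → ℂ), m ≤ Module.finrank ℂ L ∧
      ∀ w ∈ L, ℓ w = 0 ∧ ∃ μ : ℂ, ∀ j, g j w = μ * v j := by
  let T := ℓ.prod ((Submodule.mkQ (Submodule.span ℂ {v})) ∘ₗ LinearMap.pi g)
  refine ⟨LinearMap.ker T, ?_, fun w hw => ?_⟩
  · have h1 := T.finrank_range_add_finrank_ker
    have h2 := Submodule.finrank_le (LinearMap.range T)
    have h3 := Submodule.finrank_quotient_add_finrank (Submodule.span ℂ {v})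
    rw [finrank_span_singleton hv, Module.finrank_fintype_fun_eq_card, Fintype.card_fin] at h3
    rw [Module.finrank_prod, Module.finrank_self] at h2
    rw [Module.finrank_fintype_fun_eq_card, Fintype.card_fin] at h1
    omega
  · have hw' : (ℓ w, Submodule.Quotient.mk (p := Submodule.span ℂ {v}) (LinearMap.pi g w)) = 0 := hw
    rw [Prod.mk_eq_zero, Submodule.Quotient.mk_eq_zero, Submodule.mem_span_singleton] at hw'
    obtain ⟨h1, μ, hμ⟩ := hw'
    exact ⟨h1, μ, fun j => by simpa using (congrFun hμ j).symm⟩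

theorem pushable_of_eventually_eq (hd : d ≠ 0) (hh : ContDiff ℂ 2 h)
    (hhom : ∀ (c : ℂ) x, h (c • x) = c ^ d * h x) (hf : ∀ j, ContDiff ℂ 2 (f j)) (hz : h z = 1)
    {ε lo : ℝ} (hε : 0 < ε)
    (hlo : Real.exp lo < sqSum f z * Real.exp (-(ε * ∑ i, ‖z i‖ ^ 2)))
    {m : ℕ} (hm : m + k ≤ M) (hK : AvoidsZero K (EuclideanSpace ℝ (Fin m)))
    (hQ : ∀ᶠ y in nhds z, Q y = Q z) {Λ : ℝ} (hΛ : 0 ≤ Λ) :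
    Pushable K {x | h x = 1} {x | ∀ j, f j x = 0} (logPotential f ε lo) Q Λ z := by
  have hS := sqSum_pos_of_lt hlo
  have hΘ := contDiffAt_logPotential (d := d) hh hf hz hlo
  have hv : (fun j => f j z) ≠ 0 := fun h0 =>
    hS.ne' (sqSum_eq_zero.2 fun j => congrFun h0 j)
  obtain ⟨L, hL, hLw⟩ := exists_submodule_tangent (fderiv ℂ h z).toLinearMap
    (fun j => (fderiv ℂ (f j) z).toLinearMap) hv hm
  have hsymm : IsSymmSndFDerivAt ℝ (logPotential f ε lo ∘ levelRetract h d) z :=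
    hΘ.isSymmSndFDerivAt (by simp)
  obtain ⟨ι, hι⟩ := exists_negative_map L hL
    (fderiv ℝ (fderiv ℝ (logPotential f ε lo ∘ levelRetract h d)) z) (fun v w => hsymm v w) (by
      intro w hw hw0
      obtain ⟨h1, μ, hμ⟩ := hLw w hw
      obtain ⟨e, e', hJ⟩ := hasJetTwo_logPotential (d := d) hh hf hz hlo (w := w) h1
      have j1 := ((hΘ.hasJetTwo_line ((1 : ℂ) • w)).unique (hJ 1)).2
      have j2 := ((hΘ.hasJetTwo_line (Complex.I • w)).unique (hJ Complex.I)).2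
      have hμ' : ∀ j, fderiv ℂ (f j) z w = μ * f j z := hμ
      rw [one_smul] at j1
      rw [j1, j2]
      simp only [hμ', one_mul, one_pow, Complex.I_sq, neg_mul, inner_neg_right, norm_mul,
        Complex.norm_I]
      have hin : ∀ c : ℂ, ∑ j, 2 * inner ℝ (f j z) (c * f j z) = 2 * c.re * sqSum f z := by
        intro c
        rw [sqSum, Finset.mul_sum]
        refine Finset.sum_congr rfl fun j _ => ?_
        rw [Complex.inner, ← Complex.normSq_eq_norm_sq, Complex.normSq_apply]
        simp only [Complex.mul_re, Complex.conj_re, Complex.conj_im, Complex.mul_im]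
        ring
      have hin1 := hin μ
      have hin2 := hin (Complex.I * μ)
      simp only [mul_assoc] at hin1 hin2 ⊢
      rw [hin1, hin2]
      have hsum : (∑ j, 2 * ((‖μ‖ * ‖f j z‖) ^ 2 + inner ℝ (f j z) (e j))) / sqSum f z +
          (∑ j, 2 * ((‖μ‖ * ‖f j z‖) ^ 2 + -inner ℝ (f j z) (e j))) / sqSum f z = 4 * ‖μ‖ ^ 2 := by
        rw [← add_div, ← Finset.sum_add_distrib, div_eq_iff hS.ne', sqSum, Finset.mul_sum]
        exact Finset.sum_congr rfl fun j _ => by ring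
      have hsum2 : ∑ i, 2 * (‖w i‖ ^ 2 + inner ℝ (z i) (e' i)) +
          ∑ i, 2 * (‖w i‖ ^ 2 + -inner ℝ (z i) (e' i)) = 4 * ∑ i, ‖w i‖ ^ 2 := by
        rw [← Finset.sum_add_distrib, Finset.mul_sum]
        exact Finset.sum_congr rfl fun j _ => by ring
      have hwpos : 0 < ∑ i, ‖w i‖ ^ 2 := by
        obtain ⟨i, hi⟩ := Function.ne_iff.1 hw0
        exact Finset.sum_pos' (fun i _ => by positivity)
          ⟨i, Finset.mem_univ _, by have := norm_pos_iff.2 hi; positivity⟩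
      have hre : (2 * (μ.re * sqSum f z) / sqSum f z) ^ 2 +
          (2 * ((Complex.I * μ).re * sqSum f z) / sqSum f z) ^ 2 = 4 * ‖μ‖ ^ 2 := by
        rw [← Complex.normSq_eq_norm_sq, Complex.normSq_apply]
        have : (Complex.I * μ).re = -μ.im := by simp
        rw [this]
        field_simp
        ring
      have := mul_pos hε hwpos
      simp only [mul_assoc, one_mul] at *
      nlinarith)
  exact pushable_of_concave (isNhdRetraction_levelRetract hd hh hhom)
    (isClosed_commonZeros fun j => (hf j).continuous) hz
    (fun h0 => hS.ne' (sqSum_eq_zero.2 h0)) (hasStrictFDerivAt_levelRetract hh hz) hΘ ι hι hK hQ hΛ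

theorem pushable_of_descent (hd : d ≠ 0) (hh : ContDiff ℂ 2 h)
    (hhom : ∀ (c : ℂ) x, h (c • x) = c ^ d * h x) (hf : ∀ j, ContDiff ℂ 2 (f j)) (hz : h z = 1)
    {ε lo : ℝ} (hε : 0 < ε)
    (hlo : Real.exp lo < sqSum f z * Real.exp (-(ε * ∑ i, ‖z i‖ ^ 2)))
    {w : Fin M → ℂ} (hw : ‖w‖ ≤ 1) (hhw : fderiv ℂ h z w = 0) {η R L : ℝ} (hη : 0 < η)
    (hfw : ∑ j, 2 * inner ℝ (f j z) (fderiv ℂ (f j) z w) ≤ -η * sqSum f z) (hzR : ‖z‖ ≤ R)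
    (hεR : ε * (2 * M * R) ≤ η / 2) (hL : 0 ≤ L)
    (hQ : ∀ x y, dist (Q x) (Q y) ≤ L * dist x y) :
    Pushable K {x | h x = 1} {x | ∀ j, f j x = 0} (logPotential f ε lo) Q (8 * L / η) z := by
  have hS := sqSum_pos_of_lt hlo
  have hΘ := contDiffAt_logPotential (d := d) hh hf hz hlo
  obtain ⟨e, e', hJ⟩ := hasJetTwo_logPotential (d := d) hh hf hz hlo (w := w) hhw
  have j1 := ((hΘ.hasJetTwo_line ((1 : ℂ) • w)).unique (hJ 1)).1
  simp only [one_smul, one_mul] at j1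
  have hdiv : (∑ j, 2 * inner ℝ (f j z) (fderiv ℂ (f j) z w)) / sqSum f z ≤ -η :=
    (div_le_iff₀ hS).2 hfw
  have hin : -(2 * M * R) ≤ ∑ i, 2 * inner ℝ (z i) (w i) := by
    have : ∀ i ∈ Finset.univ, -(2 * R) ≤ 2 * inner ℝ (z i) (w i) := fun i _ => by
      have h1 := abs_le.1 (abs_real_inner_le_norm (z i) (w i))
      have h2 : ‖z i‖ * ‖w i‖ ≤ R * 1 :=
        mul_le_mul ((norm_le_pi_norm z i).trans hzR) ((norm_le_pi_norm w i).trans hw)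
          (norm_nonneg _) ((norm_nonneg z).trans hzR)
      linarith [h1.1]
    have h2 := Finset.sum_le_sum this
    simp only [Finset.sum_const, Finset.card_univ, Fintype.card_fin, nsmul_eq_mul] at h2
    linarith
  have hΘw : fderiv ℝ (logPotential f ε lo ∘ levelRetract h d) z w ≤ -(η / 2) := by
    rw [j1]
    have := mul_le_mul_of_nonneg_left hin hε.le
    linarith
  have h8 : 8 * L / η = 4 * L / (η / 2) := by field_simp; ring
  rw [h8]
  exact pushable_of_fderiv_neg (isNhdRetraction_levelRetract hd hh hhom)
    (isClosed_commonZeros fun j => (hf j).continuous) hz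
    (fun h0 => hS.ne' (sqSum_eq_zero.2 h0)) (hasStrictFDerivAt_levelRetract hh hz)
    (hΘ.hasStrictFDerivAt (by norm_num)) hw (fderiv_levelRetract hh hz hhw) (half_pos hη) hΘw hL hQ

end ConcretePush

section Collapse

/-- The clipping of a real number to the interval `[-r, r]`. -/
def clipReal (r t : ℝ) : ℝ := max (-r) (min r t)

theorem abs_clipReal_le {r : ℝ} (hr : 0 ≤ r) (t : ℝ) : |clipReal r t| ≤ r :=
  abs_le.2 ⟨le_max_left _ _, max_le (by linarith) (min_le_left _ _)⟩

theorem abs_clipReal_sub_le (r s t : ℝ) : |clipReal r s - clipReal r t| ≤ |s - t| := by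
  unfold clipReal
  have h1 := abs_max_sub_max_le_abs (min r s) (min r t) (-r)
  rw [max_comm (-r), max_comm (-r)]
  refine h1.trans ?_
  have h2 := abs_min_sub_min_le_max r s r t
  simpa using h2

/-- The map of the real line collapsing the intervals of radius `r` about the points of `S`. -/
def collapseReal (S : Finset ℝ) (r x : ℝ) : ℝ := x - ∑ p ∈ S, clipReal r (x - p)

theorem abs_collapseReal_sub_le (S : Finset ℝ) (r x y : ℝ) :
    |collapseReal S r x - collapseReal S r y| ≤ (1 + S.card) * |x - y| := by
  have h1 : collapseReal S r x - collapseReal S r y =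
      (x - y) - ∑ p ∈ S, (clipReal r (x - p) - clipReal r (y - p)) := by
    rw [Finset.sum_sub_distrib]; unfold collapseReal; ring
  have h2 : |∑ p ∈ S, (clipReal r (x - p) - clipReal r (y - p))| ≤ S.card * |x - y| := by
    refine (Finset.abs_sum_le_sum_abs _ _).trans ?_
    rw [← nsmul_eq_mul]
    refine Finset.sum_le_card_nsmul _ _ _ fun p _ => ?_
    simpa using abs_clipReal_sub_le r (x - p) (y - p)
  rw [h1]
  exact (abs_sub _ _).trans (by linarith)

theorem abs_collapseReal_sub_self_le (S : Finset ℝ) {r : ℝ} (hr : 0 ≤ r) (x : ℝ) :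
    |collapseReal S r x - x| ≤ S.card * r := by
  have h1 : collapseReal S r x - x = -∑ p ∈ S, clipReal r (x - p) := by unfold collapseReal; ring
  rw [h1, abs_neg]
  refine (Finset.abs_sum_le_sum_abs _ _).trans ?_
  rw [← nsmul_eq_mul]
  exact Finset.sum_le_card_nsmul _ _ _ fun p _ => abs_clipReal_le hr _

theorem collapseReal_eq {S : Finset ℝ} {r : ℝ}
    (hS : ∀ p ∈ S, ∀ q ∈ S, p ≠ q → 2 * r ≤ |p - q|) {s : ℝ} (hs : s ∈ S) {x y : ℝ}
    (hx : |x - s| < r) (hy : |y - s| < r) : collapseReal S r x = collapseReal S r y := by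
  unfold collapseReal
  rw [← Finset.add_sum_erase S _ hs, ← Finset.add_sum_erase S _ hs]
  have h1 : ∀ t, |t - s| < r → clipReal r (t - s) = t - s := fun t ht => by
    have := abs_lt.1 ht
    rw [clipReal, min_eq_right this.2.le, max_eq_right this.1.le]
  have h2 : ∀ p ∈ S.erase s, clipReal r (x - p) = clipReal r (y - p) := by
    intro p hp
    rw [Finset.mem_erase] at hp
    have hd := hS p hp.2 s hs hp.1
    have h3 := abs_lt.1 hx
    have h4 := abs_lt.1 hy
    unfold clipReal
    rcases le_abs.1 hd with hd | hd
    · rw [min_eq_right (by linarith), min_eq_right (by linarith), max_eq_left (by linarith),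
        max_eq_left (by linarith)]
    · rw [min_eq_left (by linarith), min_eq_left (by linarith)]
  rw [Finset.sum_congr rfl h2, h1 x hx, h1 y hy]
  ring

/-- The map applying `collapseReal` to all real and imaginary parts. -/
def collapse {M : ℕ} (S : Finset ℝ) (r : ℝ) (x : Fin M → ℂ) : Fin M → ℝ × ℝ :=
  fun i => (collapseReal S r (x i).re, collapseReal S r (x i).im)

variable {M : ℕ}

theorem dist_collapse_le (S : Finset ℝ) (r : ℝ) (x y : Fin M → ℂ) :
    dist (collapse S r x) (collapse S r y) ≤ (1 + S.card) * dist x y := by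
  have hc : (0 : ℝ) ≤ 1 + S.card := by positivity
  refine (dist_pi_le_iff (by positivity)).2 fun i => ?_
  have h1 : ‖x i - y i‖ ≤ dist x y := by rw [← dist_eq_norm]; exact dist_le_pi_dist x y i
  refine max_le ?_ ?_
  · rw [Real.dist_eq]
    refine (abs_collapseReal_sub_le S r _ _).trans (mul_le_mul_of_nonneg_left ?_ hc)
    exact (Complex.abs_re_le_norm (x i - y i)).trans h1
  · rw [Real.dist_eq]
    refine (abs_collapseReal_sub_le S r _ _).trans (mul_le_mul_of_nonneg_left ?_ hc)
    exact (Complex.abs_im_le_norm (x i - y i)).trans h1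

theorem dist_le_collapse (S : Finset ℝ) {r : ℝ} (hr : 0 ≤ r) (x y : Fin M → ℂ) :
    dist x y ≤ 2 * dist (collapse S r x) (collapse S r y) + 4 * S.card * r := by
  refine (dist_pi_le_iff (by positivity)).2 fun i => ?_
  have key : ∀ a b : ℝ, |a - b| ≤ |collapseReal S r a - collapseReal S r b| + 2 * S.card * r := by
    intro a b
    have h1 := abs_le.1 (abs_collapseReal_sub_self_le S hr a)
    have h2 := abs_le.1 (abs_collapseReal_sub_self_le S hr b)
    have h3 := abs_le.1 (le_refl |collapseReal S r a - collapseReal S r b|)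
    exact abs_le.2 ⟨by linarith [h1.1, h1.2, h2.1, h2.2, h3.1],
      by linarith [h1.1, h1.2, h2.1, h2.2, h3.2]⟩
  have h0 := dist_le_pi_dist (collapse S r x) (collapse S r y) i
  have h1 : |collapseReal S r (x i).re - collapseReal S r (y i).re| ≤ _ :=
    (le_max_left _ _).trans h0
  have h2 : |collapseReal S r (x i).im - collapseReal S r (y i).im| ≤ _ :=
    (le_max_right _ _).trans h0
  have h3 := Complex.norm_le_abs_re_add_abs_im (x i - y i)
  rw [Complex.sub_re, Complex.sub_im] at h3
  rw [dist_eq_norm]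
  linarith [key (x i).re (y i).re, key (x i).im (y i).im]

theorem eventually_collapse_eq {S : Finset ℝ} {r : ℝ}
    (hS : ∀ p ∈ S, ∀ q ∈ S, p ≠ q → 2 * r ≤ |p - q|) {x : Fin M → ℂ}
    (hx : ∀ i, (∃ s ∈ S, |(x i).re - s| < r) ∧ ∃ s ∈ S, |(x i).im - s| < r) :
    ∀ᶠ y in nhds x, collapse S r y = collapse S r x := by
  choose hre him using hx
  choose a haS ha using hre
  choose b hbS hb using him
  have h1 : ∀ i, ∀ᶠ y : Fin M → ℂ in nhds x, |(y i).re - a i| < r := fun i => by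
    have : Continuous fun y : Fin M → ℂ => |(y i).re - a i| := by fun_prop
    exact this.continuousAt.eventually (gt_mem_nhds (ha i))
  have h2 : ∀ i, ∀ᶠ y : Fin M → ℂ in nhds x, |(y i).im - b i| < r := fun i => by
    have : Continuous fun y : Fin M → ℂ => |(y i).im - b i| := by fun_prop
    exact this.continuousAt.eventually (gt_mem_nhds (hb i))
  filter_upwards [Filter.eventually_all.2 h1, Filter.eventually_all.2 h2] with y hy1 hy2
  funext i
  exact Prod.ext (collapseReal_eq hS (haS i) (hy1 i) (ha i))
    (collapseReal_eq hS (hbS i) (hy2 i) (hb i))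

end Collapse

section ConcreteLowering

variable {K Y : Type*} [TopologicalSpace K] [CompactSpace K] [PseudoMetricSpace Y] {M k d : ℕ}
  {h : (Fin M → ℂ) → ℂ} {f : Fin k → (Fin M → ℂ) → ℂ} {Q : (Fin M → ℂ) → Y}

theorem continuous_logPotential (hf : ∀ j, Continuous (f j)) (ε lo : ℝ) :
    Continuous (logPotential f ε lo) := by
  have h1 := continuous_sqSum hf
  refine Continuous.log (by fun_prop) fun x => ?_
  exact (lt_max_of_lt_right (Real.exp_pos lo)).ne'

theorem exists_lowering_sqSum (hd : d ≠ 0) (hh : ContDiff ℂ 2 h)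
    (hhom : ∀ (c : ℂ) x, h (c • x) = c ^ d * h x) (hf : ∀ j, ContDiff ℂ 2 (f j))
    {m : ℕ} (hm : m + k ≤ M) (hK : AvoidsZero K (EuclideanSpace ℝ (Fin m)))
    {L q η α β : ℝ} (hL : 0 ≤ L) (hQ : ∀ x y, dist (Q x) (Q y) ≤ L * dist x y)
    (hq : ∀ x y, dist x y ≤ 2 * dist (Q x) (Q y) + q) (hα : 0 < α) (hαβ : α ≤ β) (hη : 0 < η)
    (hdesc : ∀ x, h x = 1 → α / 4 ≤ sqSum f x → sqSum f x ≤ 2 * β →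
      (∀ᶠ y in nhds x, Q y = Q x) ∨ ∃ w, ‖w‖ ≤ 1 ∧ fderiv ℂ h x w = 0 ∧
        ∑ j, 2 * inner ℝ (f j x) (fderiv ℂ (f j) x w) ≤ -η * sqSum f x)
    {u : K → Fin M → ℂ} (hu : Continuous u) (huh : ∀ x, h (u x) = 1)
    (huβ : ∀ x, sqSum f (u x) ≤ β) :
    ∃ v : K → Fin M → ℂ, Continuous v ∧ ∀ x, h (v x) = 1 ∧
      ((∀ j, f j (u x) = 0) → v x = u x) ∧ sqSum f (v x) ≤ α ∧
      dist (v x) (u x) ≤ 2 * (8 * L / η * (Real.log (8 * β / α) + 1)) + q := by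
  have hβ : 0 < β := hα.trans_le hαβ
  obtain ⟨R₀, hR₀⟩ : ∃ R₀ : ℝ, ∀ x, ‖u x‖ ≤ R₀ := by
    obtain ⟨R₀, h⟩ := (isCompact_range hu).isBounded.exists_norm_le
    exact ⟨R₀, fun x => h _ ⟨x, rfl⟩⟩
  set D := 2 * (8 * L / η * (Real.log (8 * β / α) + 1)) + q with hD
  set R := max 0 (R₀ + D) with hR
  have hR0 : 0 ≤ R := le_max_left _ _
  obtain ⟨ε, hε, hε1, hε2⟩ : ∃ ε : ℝ, 0 < ε ∧ ε * (M * R ^ 2) ≤ Real.log 2 ∧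
      ε * (2 * M * R) ≤ η / 2 := by
    have hl := Real.log_pos one_lt_two
    refine ⟨min (Real.log 2 / (M * R ^ 2 + 1)) (η / 2 / (2 * M * R + 1)), by positivity, ?_, ?_⟩
    · calc _ ≤ Real.log 2 / (M * R ^ 2 + 1) * (M * R ^ 2 + 1) := by
            gcongr
            · exact min_le_left _ _
            · linarith
        _ = _ := by field_simp
    · calc _ ≤ η / 2 / (2 * M * R + 1) * (2 * M * R + 1) := by
            gcongr
            · exact min_le_right _ _
            · linarith
        _ = _ := by field_simp
  set E : (Fin M → ℂ) → ℝ := fun x => Real.exp (-(ε * ∑ i, ‖x i‖ ^ 2)) with hE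
  have hE0 : ∀ x, 0 < E x := fun x => Real.exp_pos _
  have hE1 : ∀ x, E x ≤ 1 := fun x => Real.exp_le_one_iff.2 (by
    have : 0 ≤ ε * ∑ i, ‖x i‖ ^ 2 := by positivity
    linarith)
  have hE2 : ∀ x, ‖x‖ ≤ R → 1 / 2 ≤ E x := by
    intro x hx
    have h1 : ∑ i, ‖x i‖ ^ 2 ≤ M * R ^ 2 := by
      have := Finset.sum_le_card_nsmul Finset.univ (fun i => ‖x i‖ ^ 2) (R ^ 2) fun i _ => by
        have := (norm_le_pi_norm x i).trans hx
        gcongr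
      simpa using this
    have h2 : ε * ∑ i, ‖x i‖ ^ 2 ≤ Real.log 2 :=
      (mul_le_mul_of_nonneg_left h1 hε.le).trans hε1
    calc (1 : ℝ) / 2 = Real.exp (-Real.log 2) := by
          rw [Real.exp_neg, Real.exp_log two_pos]; norm_num
      _ ≤ E x := Real.exp_le_exp.2 (by linarith)
  set χ := logPotential f ε (Real.log (α / 8)) with hχ
  have hχx : ∀ x, χ x = Real.log (max (sqSum f x * E x) (α / 8)) := fun x => by
    simp only [hχ, logPotential, hE]
    rw [Real.exp_log (by positivity)]
  have hmaxpos : ∀ x, 0 < max (sqSum f x * E x) (α / 8) := fun x =>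
    lt_max_of_lt_right (by positivity)
  have hcont : Continuous χ := continuous_logPotential (fun j => (hf j).continuous) _ _
  set Z : Set (Fin M → ℂ) := {x | h x = 1} ∩ Metric.closedBall 0 R ∩
    {x | Real.log (α / 4) ≤ χ x} ∩ {x | χ x ≤ Real.log β} with hZ
  have hZc : IsCompact Z := by
    refine Metric.isCompact_of_isClosed_isBounded ?_ ?_
    · exact (((isClosed_eq hh.continuous continuous_const).inter Metric.isClosed_closedBall).inter
        (isClosed_le continuous_const hcont)).inter (isClosed_le hcont continuous_const)
    · exact Metric.isBounded_closedBall.subset fun x hx => hx.1.1.2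
  have hΛ : 0 ≤ 8 * L / η := by positivity
  have hpush : ∀ z ∈ Z, Pushable K {x | h x = 1} {x | ∀ j, f j x = 0} χ Q (8 * L / η) z := by
    rintro z ⟨⟨⟨hz1, hzR⟩, hzα⟩, hzβ⟩
    have hzR' : ‖z‖ ≤ R := by simpa using hzR
    have h1 : α / 4 ≤ max (sqSum f z * E z) (α / 8) := by
      have : Real.log (α / 4) ≤ χ z := hzα
      rw [hχx] at this
      exact (Real.log_le_log_iff (by positivity) (hmaxpos z)).1 this
    have h2 : α / 4 ≤ sqSum f z * E z := by
      rcases le_max_iff.1 h1 with h | h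
      · exact h
      · linarith
    have h3 : sqSum f z * E z ≤ β := by
      have : χ z ≤ Real.log β := hzβ
      rw [hχx] at this
      exact (le_max_left _ _).trans ((Real.log_le_log_iff (hmaxpos z) hβ).1 this)
    have hlo : Real.exp (Real.log (α / 8)) < sqSum f z * Real.exp (-(ε * ∑ i, ‖z i‖ ^ 2)) := by
      rw [Real.exp_log (by positivity)]
      change _ < sqSum f z * E z
      linarith
    have h4 : α / 4 ≤ sqSum f z :=
      h2.trans (mul_le_of_le_one_right (sqSum_nonneg f z) (hE1 z))
    have h5 : sqSum f z ≤ 2 * β := by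
      have := mul_le_mul_of_nonneg_left (hE2 z hzR') (sqSum_nonneg f z)
      linarith
    rcases hdesc z hz1 h4 h5 with hloc | ⟨w, hw, hhw, hfw⟩
    · exact pushable_of_eventually_eq hd hh hhom hf hz1 hε hlo hm hK hloc hΛ
    · exact pushable_of_descent hd hh hhom hf hz1 hε hlo hw hhw hη hfw hzR' hε2 hL hQ
  have hba : Real.log β - Real.log (α / 8) = Real.log (8 * β / α) := by
    rw [← Real.log_div hβ.ne' (by positivity)]
    congr 1
    field_simp
  have hnear : ∀ y x, dist (Q y) (Q (u x)) ≤
      8 * L / η * (Real.log β - Real.log (α / 8) + 1) → dist y (u x) ≤ D := by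
    intro y x hy
    rw [hba] at hy
    exact (hq y (u x)).trans (by rw [hD]; linarith)
  have hnearR : ∀ y x, dist y (u x) ≤ D → ‖y‖ ≤ R := by
    intro y x hy
    rw [dist_eq_norm] at hy
    have : ‖y‖ ≤ ‖y - u x‖ + ‖u x‖ := by simpa using norm_add_le (y - u x) (u x)
    exact le_max_of_le_right (by linarith [hR₀ x])
  obtain ⟨v, hv, hvx⟩ := exists_lowering (K := K) (u := u) hZc hΛ hpush (lo := Real.log (α / 8))
    (a' := Real.log (α / 4)) (a := Real.log (α / 2)) (b := Real.log β)
    (fun y => by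
      rw [hχx]
      exact Real.log_le_log (by positivity) (le_max_right _ _))
    (Real.log_lt_log (by positivity) (by linarith))
    (Real.log_le_log (by positivity) (by linarith)) hu huh
    (fun x => by
      rw [hχx]
      refine Real.log_le_log (hmaxpos _) (max_le ?_ (by linarith))
      exact (mul_le_of_le_one_right (sqSum_nonneg f _) (hE1 _)).trans (huβ x))
    (fun y hy x h1 h2 h3 =>
      ⟨⟨⟨hy, by simpa using hnearR y x (hnear y x h3)⟩, h1⟩, h2⟩)
  refine ⟨v, hv, fun x => ?_⟩
  obtain ⟨a1, a2, a3, a4⟩ := hvx x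
  refine ⟨a1, a2, ?_, hnear _ _ a4⟩
  have h1 := hE2 _ (hnearR _ _ (hnear _ _ a4))
  rw [hχx] at a3
  have h2 := (le_max_left _ _).trans ((Real.log_le_log_iff (hmaxpos _) (by positivity)).1 a3)
  have := mul_le_mul_of_nonneg_left h1 (sqSum_nonneg f (v x))
  linarith

end ConcreteLowering

section PolynomialCalculus

theorem MvPolynomial.hasFDerivAt_eval {σ : Type*} [Fintype σ] (p : MvPolynomial σ ℂ) (x : σ → ℂ) :
    HasFDerivAt (fun y : σ → ℂ => eval y p)
      (∑ i, eval x (pderiv i p) • ContinuousLinearMap.proj (R := ℂ) (φ := fun _ : σ => ℂ) i) x := by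
  classical
  induction p using MvPolynomial.induction_on with
  | C a =>
    refine ((hasFDerivAt_const (𝕜 := ℂ) (E := σ → ℂ) a x).congr_fderiv ?_).congr_of_eventuallyEq
      (.of_forall fun y => eval_C a)
    ext v
    simp
  | add p q hp hq =>
    refine ((hp.add hq).congr_fderiv ?_).congr_of_eventuallyEq (.of_forall fun y => by simp)
    ext v
    simp [add_mul, Finset.sum_add_distrib]
  | mul_X p j hp =>
    have hX : HasFDerivAt (fun y : σ → ℂ => y j)
        (ContinuousLinearMap.proj (R := ℂ) (φ := fun _ : σ => ℂ) j) x :=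
      (ContinuousLinearMap.proj (R := ℂ) (φ := fun _ : σ => ℂ) j).hasFDerivAt
    have := hp.mul hX
    simp only [map_mul, eval_X]
    refine this.congr_fderiv ?_
    ext v
    simp [pderiv_X, Pi.single_apply, Finset.sum_add_distrib, add_mul, Finset.mul_sum, apply_ite]
    exact Finset.sum_congr rfl fun i _ => by ring

theorem MvPolynomial.fderiv_eval_apply {σ : Type*} [Fintype σ] (p : MvPolynomial σ ℂ)
    (x w : σ → ℂ) :
    fderiv ℂ (fun y : σ → ℂ => eval y p) x w = ∑ i, eval x (pderiv i p) * w i := by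
  simp [(p.hasFDerivAt_eval x).fderiv]

theorem MvPolynomial.contDiff_eval {σ : Type*} [Fintype σ] (p : MvPolynomial σ ℂ)
    {m : WithTop ℕ∞} : ContDiff ℂ m (fun y : σ → ℂ => eval y p) :=
  (AnalyticOnNhd.eval_mvPolynomial (𝕜 := ℂ) p).contDiff

theorem MvPolynomial.IsHomogeneous.eval_smul_eq {σ : Type*} {p : MvPolynomial σ ℂ} {n : ℕ}
    (hp : p.IsHomogeneous n) (c : ℂ) (x : σ → ℂ) : eval (c • x) p = c ^ n * eval x p := by
  rw [eval_eq, eval_eq, Finset.mul_sum]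
  refine Finset.sum_congr rfl fun m hm => ?_
  have h1 : ∑ i ∈ m.support, m i = n := by
    have := hp (mem_support_iff.1 hm)
    rwa [Finsupp.weight_apply, Finsupp.sum, Finset.sum_congr rfl fun i _ => by
      rw [Pi.one_apply, smul_eq_mul, mul_one]] at this
  simp only [Pi.smul_apply, smul_eq_mul, mul_pow, Finset.prod_mul_distrib,
    Finset.prod_pow_eq_pow_sum, h1]
  ring

theorem MvPolynomial.IsHomogeneous.sum_mul_eval_pderiv {σ : Type*} [Fintype σ]
    {p : MvPolynomial σ ℂ} {n : ℕ} (hp : p.IsHomogeneous n) (x : σ → ℂ) :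
    ∑ i, eval x (pderiv i p) * x i = n * eval x p := by
  have := congrArg (eval x) hp.sum_X_mul_pderiv
  simp only [map_sum, map_mul, eval_X, nsmul_eq_mul, map_natCast] at this
  rw [← this]
  exact Finset.sum_congr rfl fun i _ => mul_comm _ _

end PolynomialCalculus

section Minors

/-- The maximal minor of the Jacobian matrix of `f` with columns `I`. -/
noncomputable def jacobianMinor {k M : ℕ} (f : Fin k → MvPolynomial (Fin M) ℂ)
    (I : Fin k → Fin M) : MvPolynomial (Fin M) ℂ :=
  Matrix.det (Matrix.of fun j a => pderiv (I a) (f j))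

theorem eval_jacobianMinor {k M : ℕ} (f : Fin k → MvPolynomial (Fin M) ℂ)
    (I : Fin k → Fin M) (x : Fin M → ℂ) :
    eval x (jacobianMinor f I) = Matrix.det (Matrix.of fun j a => eval x (pderiv (I a) (f j))) := by
  rw [jacobianMinor, RingHom.map_det]
  rfl

theorem exists_det_ne_zero_of_linearIndependent {k M : ℕ} {A : Fin k → Fin M → ℂ}
    (hA : LinearIndependent ℂ A) :
    ∃ I : Fin k → Fin M, Matrix.det (Matrix.of fun j a => A j (I a)) ≠ 0 := by
  have hrank : (Matrix.of A).rank = k := by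
    have := LinearIndependent.rank_matrix (M := Matrix.of A) hA
    simpa using this
  have hspan : Submodule.span ℂ (Set.range (Matrix.of A).col) = ⊤ := by
    apply Submodule.eq_top_of_finrank_eq
    rw [← Matrix.rank_eq_finrank_span_cols, hrank]
    simp
  obtain ⟨I, hI⟩ : ∃ I : Fin k → Fin M,
      LinearIndependent ℂ fun a => (Matrix.of A).col (I a) := by
    obtain ⟨κ, a, ha, hs, hli⟩ := exists_linearIndependent' ℂ (Matrix.of A).col
    rw [hspan] at hs
    let b := Module.Basis.mk hli hs.ge
    have : Finite κ := Finite.of_injective a ha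
    have := Fintype.ofFinite κ
    have hc : Fintype.card κ = k := by
      rw [← Module.finrank_eq_card_basis b]
      simp
    let e : Fin k ≃ κ := (Fintype.equivFinOfCardEq hc).symm
    exact ⟨a ∘ e, hli.comp e e.injective⟩
  refine ⟨I, ?_⟩
  have : IsUnit (Matrix.of fun j a => A j (I a)) := by
    rw [← Matrix.linearIndependent_cols_iff_isUnit]
    exact hI
  exact ((Matrix.isUnit_iff_isUnit_det _).1 this).ne_zero

/-- Cramer's rule as a quantitative injectivity estimate. -/
theorem norm_det_mul_norm_le {k : ℕ} (A : Matrix (Fin k) (Fin k) ℂ) (c : Fin k → ℂ) {C t : ℝ}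
    (hC : ∀ i j, ‖A.adjugate i j‖ ≤ C) (ht : 0 ≤ t) (hC0 : 0 ≤ C)
    (hc : ∀ a, ‖∑ j, c j * A j a‖ ≤ t) : ‖A.det‖ * ‖c‖ ≤ k * C * t := by
  have h1 : Matrix.vecMul (Matrix.vecMul c A) A.adjugate = A.det • c := by
    rw [Matrix.vecMul_vecMul, Matrix.mul_adjugate, Matrix.vecMul_smul, Matrix.vecMul_one]
  rw [← norm_smul, ← h1]
  refine (pi_norm_le_iff_of_nonneg (by positivity)).2 fun j => ?_
  have h2 : ∀ a, ‖Matrix.vecMul c A a‖ ≤ t := hc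
  calc ‖Matrix.vecMul (Matrix.vecMul c A) A.adjugate j‖
      = ‖∑ a, Matrix.vecMul c A a * A.adjugate a j‖ := rfl
    _ ≤ ∑ a, ‖Matrix.vecMul c A a * A.adjugate a j‖ := norm_sum_le _ _
    _ ≤ ∑ _a : Fin k, t * C := Finset.sum_le_sum fun a _ => by
        rw [norm_mul]
        exact mul_le_mul (h2 a) (hC a j) (norm_nonneg _) ht
    _ = k * C * t := by simp; ring

theorem exists_minor_estimate {k M : ℕ} (f : Fin k → MvPolynomial (Fin M) ℂ) {Z : Set (Fin M → ℂ)}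
    (hZ : IsCompact Z) :
    ∃ C > 0, ∀ x ∈ Z, ∀ (I : Fin k → Fin M) (c : Fin k → ℂ) (t : ℝ), 0 ≤ t →
      (∀ i, ‖∑ j, c j * eval x (pderiv i (f j))‖ ≤ t) →
      ‖eval x (jacobianMinor f I)‖ * ‖c‖ ≤ C * t := by
  have hcont : ∀ (I : Fin k → Fin M) (a b : Fin k), Continuous fun x : Fin M → ℂ =>
      (Matrix.of fun j a => eval x (pderiv (I a) (f j))).adjugate a b := by
    intro I a b
    refine Continuous.matrix_elem (Continuous.matrix_adjugate ?_) a b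
    exact continuous_matrix fun i j => (pderiv (I j) (f i)).continuous_eval
  have hb : ∀ (q : (Fin k → Fin M) × Fin k × Fin k), ∃ C, ∀ x ∈ Z,
      ‖(Matrix.of fun j a => eval x (pderiv (q.1 a) (f j))).adjugate q.2.1 q.2.2‖ ≤ C :=
    fun q => hZ.exists_bound_of_continuousOn (hcont q.1 q.2.1 q.2.2).continuousOn
  choose C hC using hb
  set D : ℝ := ∑ q, |C q| with hD
  have hD0 : 0 ≤ D := Finset.sum_nonneg fun _ _ => abs_nonneg _
  refine ⟨k * D + 1, by positivity, fun x hx I c t ht hc => ?_⟩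
  rw [eval_jacobianMinor]
  refine (norm_det_mul_norm_le _ c (C := D) (fun a b => ?_) ht hD0 fun a => hc (I a)).trans ?_
  · exact (hC (I, a, b) x hx).trans ((le_abs_self _).trans
      (Finset.single_le_sum (f := fun q => |C q|) (fun _ _ => abs_nonneg _) (Finset.mem_univ _)))
  · nlinarith

end Minors

section Descent

/-- A tangent vector along which the conjugate-weighted differential is large can be rotated and
rescaled to a unit direction of fast decrease. -/
theorem exists_unit_descent {V : Type*} [NormedAddCommGroup V] [NormedSpace ℂ V] {k : ℕ}
    (a : Fin k → ℂ) (G : Fin k → V →L[ℂ] ℂ) (ℓ : V →L[ℂ] ℂ) {w : V} {b B : ℝ} (hw : ℓ w = 0)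
    (hB : 0 < B) (hwB : ‖w‖ ≤ B)
    (hb : b * B ≤ ‖∑ j, (starRingEnd ℂ) (a j) * G j w‖) :
    ∃ w', ‖w'‖ ≤ 1 ∧ ℓ w' = 0 ∧ ∑ j, 2 * inner ℝ (a j) (G j w') ≤ -(2 * b) := by
  set S := ∑ j, (starRingEnd ℂ) (a j) * G j w with hS
  by_cases hS0 : S = 0
  · refine ⟨0, by simp, by simp, ?_⟩
    rw [hS0, norm_zero] at hb
    have : b ≤ 0 := by
      by_contra hb0
      push Not at hb0
      nlinarith [mul_pos hb0 hB]
    simp only [map_zero, inner_zero_right, mul_zero, Finset.sum_const_zero]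
    linarith
  · have hSn : 0 < ‖S‖ := norm_pos_iff.2 hS0
    set c : ℂ := -((starRingEnd ℂ) S / (‖S‖ * B : ℝ)) with hc
    have hcn : ‖c‖ = 1 / B := by
      rw [hc, norm_neg, norm_div, RCLike.norm_conj, Complex.norm_real, Real.norm_eq_abs,
        abs_of_pos (by positivity)]
      field_simp
    have hcS : c * S = ((-(‖S‖ / B) : ℝ) : ℂ) := by
      have : (starRingEnd ℂ) S * S = ((‖S‖ ^ 2 : ℝ) : ℂ) := by
        rw [mul_comm, Complex.mul_conj, Complex.normSq_eq_norm_sq]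
      rw [hc, neg_mul, div_mul_eq_mul_div, this, ← Complex.ofReal_div, ← Complex.ofReal_neg]
      congr 2
      field_simp
    refine ⟨c • w, ?_, by rw [map_smul, hw, smul_zero], ?_⟩
    · rw [norm_smul, hcn]
      calc 1 / B * ‖w‖ ≤ 1 / B * B := by gcongr
        _ = 1 := by field_simp
    · have h1 : ∑ j, 2 * inner ℝ (a j) (G j (c • w)) = 2 * (c * S).re := by
        rw [hS, Finset.mul_sum, Complex.re_sum, Finset.mul_sum]
        refine Finset.sum_congr rfl fun j _ => ?_
        rw [Complex.inner, map_smul, smul_eq_mul]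
        ring_nf
      rw [h1, hcS, Complex.ofReal_re]
      have : b ≤ ‖S‖ / B := by rwa [le_div_iff₀ hB]
      linarith

variable {k M d : ℕ} {dd : Fin k → ℕ} {f : Fin k → MvPolynomial (Fin M) ℂ}
  {h : MvPolynomial (Fin M) ℂ}

/-- The functions associated with a family of polynomials. -/
noncomputable def evalFamily (f : Fin k → MvPolynomial (Fin M) ℂ) (j : Fin k)
    (x : Fin M → ℂ) : ℂ := eval x (f j)

theorem exists_tangent_descent (hd : 1 ≤ d) (hh : h.IsHomogeneous d)
    (hf : ∀ j, (f j).IsHomogeneous (dd j)) {D : ℝ} (hD : ∀ j, (dd j : ℝ) ≤ D)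
    {x : Fin M → ℂ} (hx : eval x h = 1) (i : Fin M) {b B : ℝ} (hB : 0 < B)
    (hxB : 1 + ‖eval x (pderiv i h)‖ * ‖x‖ ≤ B)
    (hb : b * B + ‖eval x (pderiv i h)‖ * (D * sqSum (evalFamily f) x) ≤
      ‖∑ j, (starRingEnd ℂ) (eval x (f j)) * eval x (pderiv i (f j))‖) :
    ∃ w, ‖w‖ ≤ 1 ∧ fderiv ℂ (fun y : Fin M → ℂ => eval y h) x w = 0 ∧
      ∑ j, 2 * inner ℝ (evalFamily f j x) (fderiv ℂ (evalFamily f j) x w) ≤ -(2 * b) := by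
  have hd' : (1 : ℝ) ≤ d := by exact_mod_cast hd
  have hd0 : (d : ℂ) ≠ 0 := by exact_mod_cast (by omega : d ≠ 0)
  set q : ℂ := eval x (pderiv i h) / d with hq
  have hqn : ‖q‖ ≤ ‖eval x (pderiv i h)‖ := by
    rw [hq, norm_div, Complex.norm_natCast]
    exact div_le_self (norm_nonneg _) hd'
  set w : Fin M → ℂ := Pi.single i 1 - q • x with hw
  have happ : ∀ (p : MvPolynomial (Fin M) ℂ) (e : ℕ), p.IsHomogeneous e →
      fderiv ℂ (fun y : Fin M → ℂ => eval y p) x w =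
        eval x (pderiv i p) - q * (e * eval x p) := by
    intro p e hp
    rw [map_sub, map_smul, fderiv_eval_apply, fderiv_eval_apply, hp.sum_mul_eval_pderiv,
      smul_eq_mul]
    simp [Pi.single_apply]
  refine exists_unit_descent (fun j => evalFamily f j x) (fun j => fderiv ℂ (evalFamily f j) x)
    (fderiv ℂ (fun y : Fin M → ℂ => eval y h) x) (w := w) ?_ hB ?_ ?_
  · rw [happ h d hh, hx, hq]
    field_simp
    simp
  · refine le_trans (norm_sub_le _ _) (le_trans ?_ hxB)
    rw [norm_smul]
    refine add_le_add ?_ (by gcongr)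
    refine (pi_norm_le_iff_of_nonneg zero_le_one).2 fun l => ?_
    by_cases hl : l = i
    · subst hl; simp
    · simp [hl]
  · have h1 : ∑ j, (starRingEnd ℂ) (evalFamily f j x) * fderiv ℂ (evalFamily f j) x w =
        ∑ j, (starRingEnd ℂ) (eval x (f j)) * eval x (pderiv i (f j)) -
          q * ∑ j, (dd j : ℂ) * ((‖eval x (f j)‖ ^ 2 : ℝ) : ℂ) := by
      rw [Finset.mul_sum, ← Finset.sum_sub_distrib]
      refine Finset.sum_congr rfl fun j _ => ?_
      have h2 : (starRingEnd ℂ) (eval x (f j)) * eval x (f j) = ((‖eval x (f j)‖ ^ 2 : ℝ) : ℂ) := by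
        rw [mul_comm, Complex.mul_conj, Complex.normSq_eq_norm_sq]
      have h3 := happ (f j) (dd j) (hf j)
      change (starRingEnd ℂ) (eval x (f j)) * fderiv ℂ (fun y : Fin M → ℂ => eval y (f j)) x w = _
      rw [h3, ← h2]
      ring
    have h4 : ‖q * ∑ j, (dd j : ℂ) * ((‖eval x (f j)‖ ^ 2 : ℝ) : ℂ)‖ ≤
        ‖eval x (pderiv i h)‖ * (D * sqSum (evalFamily f) x) := by
      rw [norm_mul]
      refine mul_le_mul hqn ?_ (norm_nonneg _) (norm_nonneg _)
      refine (norm_sum_le _ _).trans ?_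
      rw [sqSum, Finset.mul_sum]
      refine Finset.sum_le_sum fun j _ => ?_
      rw [norm_mul, Complex.norm_natCast, Complex.norm_real, Real.norm_eq_abs,
        abs_of_nonneg (by positivity)]
      exact mul_le_mul_of_nonneg_right (hD j) (by positivity)
    change _ ≤ ‖∑ j, (starRingEnd ℂ) (evalFamily f j x) * fderiv ℂ (evalFamily f j) x w‖
    rw [h1]
    have := norm_sub_norm_le
      (∑ j, (starRingEnd ℂ) (eval x (f j)) * eval x (pderiv i (f j)))
      (q * ∑ j, (dd j : ℂ) * ((‖eval x (f j)‖ ^ 2 : ℝ) : ℂ))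
    linarith

theorem norm_eval_le_sqrt (f : Fin k → MvPolynomial (Fin M) ℂ) (x : Fin M → ℂ) (j : Fin k) :
    ‖eval x (f j)‖ ≤ √(sqSum (evalFamily f) x) := by
  refine Real.le_sqrt_of_sq_le ?_
  exact Finset.single_le_sum (f := fun j => ‖evalFamily f j x‖ ^ 2) (fun _ _ => by positivity)
    (Finset.mem_univ j)

theorem sqrt_sqSum_le (f : Fin k → MvPolynomial (Fin M) ℂ) (x : Fin M → ℂ) {t : ℝ} (ht : 0 ≤ t)
    (hx : ∀ j, ‖eval x (f j)‖ ≤ t) : √(sqSum (evalFamily f) x) ≤ (k + 1) * t := by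
  refine Real.sqrt_le_iff.2 ⟨by positivity, ?_⟩
  calc sqSum (evalFamily f) x ≤ ∑ _j : Fin k, t ^ 2 :=
        Finset.sum_le_sum fun j _ => pow_le_pow_left₀ (norm_nonneg _) (hx j) 2
    _ = k * t ^ 2 := by simp
    _ ≤ ((k + 1) * t) ^ 2 := by
        have : (0 : ℝ) ≤ k := by positivity
        rw [mul_pow]
        gcongr
        nlinarith

end Descent

section DescentEstimates

variable {k M d : ℕ} {dd : Fin k → ℕ} {f : Fin k → MvPolynomial (Fin M) ℂ}
  {h : MvPolynomial (Fin M) ℂ}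

theorem exists_index_minor_estimate (f : Fin k → MvPolynomial (Fin M) ℂ) {Z : Set (Fin M → ℂ)}
    (hZ : IsCompact Z) :
    ∃ C > 0, ∀ x ∈ Z, ∀ (I : Fin k → Fin M) (c : Fin k → ℂ),
      0 < ‖eval x (jacobianMinor f I)‖ * ‖c‖ →
      ∃ i, ‖eval x (jacobianMinor f I)‖ * ‖c‖ ≤ C * ‖∑ j, c j * eval x (pderiv i (f j))‖ := by
  obtain ⟨C, hC, H⟩ := exists_minor_estimate f hZ
  refine ⟨2 * C, by positivity, fun x hx I c hpos => ?_⟩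
  by_contra! hcon
  have := H x hx I c (‖eval x (jacobianMinor f I)‖ * ‖c‖ / (2 * C)) (by positivity) fun i => by
    rw [le_div_iff₀ (by positivity), mul_comm]
    exact (hcon i).le
  have h2 : C * (‖eval x (jacobianMinor f I)‖ * ‖c‖ / (2 * C)) =
      ‖eval x (jacobianMinor f I)‖ * ‖c‖ / 2 := by
    field_simp
  linarith

theorem exists_pderiv_bound (h : MvPolynomial (Fin M) ℂ) {Z : Set (Fin M → ℂ)}
    (hZ : IsCompact Z) : ∃ H, 0 ≤ H ∧ ∀ x ∈ Z, ∀ i, ‖eval x (pderiv i h)‖ ≤ H := by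
  choose C hC using fun i => hZ.exists_bound_of_continuousOn
    (pderiv i h).continuous_eval.continuousOn
  refine ⟨∑ i, |C i|, Finset.sum_nonneg fun _ _ => abs_nonneg _, fun x hx i => ?_⟩
  exact (hC i x hx).trans ((le_abs_self _).trans
    (Finset.single_le_sum (f := fun i => |C i|) (fun _ _ => abs_nonneg _) (Finset.mem_univ i)))

theorem exists_descent_of_eq_zero {x : Fin M → ℂ} {t : ℝ} (ht : t = 0) :
    ∃ w, ‖w‖ ≤ 1 ∧ fderiv ℂ (fun y : Fin M → ℂ => eval y h) x w = 0 ∧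
      ∑ j, 2 * inner ℝ (evalFamily f j x) (fderiv ℂ (evalFamily f j) x w) ≤ -t := by
  refine ⟨0, by simp, by simp, ?_⟩
  simp [ht]

theorem exists_degree_bound (dd : Fin k → ℕ) : ∃ D : ℝ, 0 ≤ D ∧ ∀ j, (dd j : ℝ) ≤ D :=
  ⟨∑ j, (dd j : ℝ), by positivity, fun j =>
    Finset.single_le_sum (f := fun j => (dd j : ℝ)) (fun _ _ => by positivity) (Finset.mem_univ j)⟩

/-- At points of a compact part of `h = 1` where a Jacobian minor is not too small, the
defect `sqSum` can be decreased at a definite rate. -/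
theorem exists_descent_of_minor (hd : 1 ≤ d) (hh : h.IsHomogeneous d)
    (hf : ∀ j, (f j).IsHomogeneous (dd j)) {Z : Set (Fin M → ℂ)} (hZ : IsCompact Z)
    (hZh : ∀ x ∈ Z, eval x h = 1) :
    ∃ c > 0, ∃ c' > 0, ∀ x ∈ Z, ∀ (a : ℝ) (I : Fin k → Fin M), 0 < a →
      a ≤ ‖eval x (jacobianMinor f I)‖ → √(sqSum (evalFamily f) x) ≤ c' * a →
      ∃ w, ‖w‖ ≤ 1 ∧ fderiv ℂ (fun y : Fin M → ℂ => eval y h) x w = 0 ∧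
        ∑ j, 2 * inner ℝ (evalFamily f j x) (fderiv ℂ (evalFamily f j) x w) ≤
          -(c * a * √(sqSum (evalFamily f) x)) := by
  obtain ⟨C, hC, HC⟩ := exists_index_minor_estimate f hZ
  obtain ⟨H, hH, HH⟩ := exists_pderiv_bound h hZ
  obtain ⟨D, hD0, hD⟩ := exists_degree_bound dd
  obtain ⟨R, hR⟩ := hZ.exists_bound_of_continuousOn (f := fun x : Fin M → ℂ => x)
    continuous_id.continuousOn
  set κ : ℝ := 1 / (2 * C * (k + 1)) with hκ
  have hκ0 : 0 < κ := by positivity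
  set B : ℝ := 1 + H * |R| with hB
  have hB0 : 0 < B := by positivity
  refine ⟨2 * κ / B, by positivity, κ / (H * D + 1), by positivity, fun x hx a I ha haI hsq => ?_⟩
  set φ := sqSum (evalFamily f) x with hφ
  by_cases hφ0 : φ = 0
  · exact exists_descent_of_eq_zero (by simp [hφ0])
  have hφp : 0 < φ := lt_of_le_of_ne (sqSum_nonneg _ _) (Ne.symm hφ0)
  have hsp : 0 < √φ := Real.sqrt_pos.2 hφp
  set c : Fin k → ℂ := fun j => (starRingEnd ℂ) (eval x (f j)) with hc
  have hcn : √φ ≤ (k + 1) * ‖c‖ := sqrt_sqSum_le f x (norm_nonneg c) fun j => by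
    have := norm_le_pi_norm c j
    rwa [hc, RCLike.norm_conj] at this
  have hcp : 0 < ‖c‖ := by
    by_contra hcon
    have : ‖c‖ = 0 := le_antisymm (not_lt.1 hcon) (norm_nonneg _)
    rw [this, mul_zero] at hcn
    linarith
  obtain ⟨i, hi⟩ := HC x hx I c (mul_pos (ha.trans_le haI) hcp)
  have h1 : 2 * κ * a * √φ ≤ ‖∑ j, c j * eval x (pderiv i (f j))‖ := by
    have h2 : a * ‖c‖ ≤ C * ‖∑ j, c j * eval x (pderiv i (f j))‖ :=
      (mul_le_mul_of_nonneg_right haI hcp.le).trans hi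
    have h3 : 2 * κ * a * √φ = a * √φ / (C * (k + 1)) := by
      rw [hκ]; field_simp
    rw [h3, div_le_iff₀ (by positivity)]
    calc a * √φ ≤ a * ((k + 1) * ‖c‖) := by gcongr
      _ = (k + 1) * (a * ‖c‖) := by ring
      _ ≤ (k + 1) * (C * ‖∑ j, c j * eval x (pderiv i (f j))‖) := by gcongr
      _ = _ := by ring
  have hsq' : (H * D + 1) * √φ ≤ κ * a := by
    have h3 : κ / (H * D + 1) * a = κ * a / (H * D + 1) := by ring
    rwa [h3, le_div_iff₀ (by positivity), mul_comm] at hsq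
  have hHi := HH x hx i
  obtain ⟨w, hw1, hw2, hw3⟩ := exists_tangent_descent hd hh hf hD (hZh x hx) i
    (b := κ * a * √φ / B) (B := B) hB0
    (by
      rw [hB]
      gcongr
      exact (hR x hx).trans (le_abs_self R))
    (by
      refine le_trans ?_ h1
      have h4 : κ * a * √φ / B * B = κ * a * √φ := by field_simp
      have h5 : ‖eval x (pderiv i h)‖ * (D * φ) ≤ κ * a * √φ := by
        calc ‖eval x (pderiv i h)‖ * (D * φ) ≤ H * (D * φ) := by gcongr
          _ = (H * D * √φ) * √φ := by
              nth_rewrite 1 [← Real.mul_self_sqrt hφp.le]; ring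
          _ ≤ κ * a * √φ := by
              refine mul_le_mul_of_nonneg_right ?_ hsp.le
              linarith
      rw [h4]
      linarith)
  refine ⟨w, hw1, hw2, hw3.trans (le_of_eq ?_)⟩
  ring

/-- Far from the origin, the defect `sqSum` can be decreased at a definite rate. -/
theorem exists_descent_at_infinity (hd : 1 ≤ d) (hh : h.IsHomogeneous d)
    (hf : ∀ j, (f j).IsHomogeneous (dd j)) (hdeg : ∀ j, d < dd j)
    (hreg : ∀ u : Fin M → ℂ, u ≠ 0 → (∀ j, eval u (f j) = 0) → eval u h = 0 →
      ∃ I, eval u (jacobianMinor f I) ≠ 0) (Φ : ℝ) :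
    ∃ R > 0, ∃ c > 0, ∀ x : Fin M → ℂ, eval x h = 1 → R ≤ ‖x‖ → sqSum (evalFamily f) x ≤ Φ →
      ∃ w, ‖w‖ ≤ 1 ∧ fderiv ℂ (fun y : Fin M → ℂ => eval y h) x w = 0 ∧
        ∑ j, 2 * inner ℝ (evalFamily f j x) (fderiv ℂ (evalFamily f j) x w) ≤
          -(c * √(sqSum (evalFamily f) x)) := by
  have hZ : IsCompact (Metric.sphere (0 : Fin M → ℂ) 1) := isCompact_sphere _ _
  obtain ⟨C, hC, HC⟩ := exists_index_minor_estimate f hZ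
  obtain ⟨H, hH, HH⟩ := exists_pderiv_bound h hZ
  obtain ⟨D, hD0, hD⟩ := exists_degree_bound dd
  obtain ⟨c₀, hc₀, Hc₀⟩ : ∃ c₀ > 0, ∀ u ∈ Metric.sphere (0 : Fin M → ℂ) 1,
      c₀ ≤ ∑ j, ‖eval u (f j)‖ + ‖eval u h‖ + ∑ I, ‖eval u (jacobianMinor f I)‖ := by
    refine hZ.exists_forall_le' (f := fun u : Fin M → ℂ => ∑ j, ‖eval u (f j)‖ + ‖eval u h‖ +
      ∑ I, ‖eval u (jacobianMinor f I)‖) ?_ fun u hu => ?_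
    · refine Continuous.continuousOn ?_
      refine ((continuous_finsetSum _ fun j _ => (f j).continuous_eval.norm).add
        h.continuous_eval.norm).add
        (continuous_finsetSum _ fun I _ => (jacobianMinor f I).continuous_eval.norm)
    · have hs1 : 0 ≤ ∑ j, ‖eval u (f j)‖ := Finset.sum_nonneg fun _ _ => norm_nonneg _
      have hs2 : 0 ≤ ∑ I, ‖eval u (jacobianMinor f I)‖ :=
        Finset.sum_nonneg fun _ _ => norm_nonneg _
      by_contra hcon
      have hz1 : ∑ j, ‖eval u (f j)‖ = 0 := by linarith [norm_nonneg (eval u h)]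
      have hz2 : ‖eval u h‖ = 0 := by linarith [norm_nonneg (eval u h)]
      have hz3 : ∑ I, ‖eval u (jacobianMinor f I)‖ = 0 := by linarith [norm_nonneg (eval u h)]
      rw [Finset.sum_eq_zero_iff_of_nonneg fun _ _ => norm_nonneg _] at hz1 hz3
      have hu0 : u ≠ 0 := by
        rintro rfl
        simp at hu
      obtain ⟨I, hI⟩ := hreg u hu0 (fun j => norm_eq_zero.1 (hz1 j (Finset.mem_univ j)))
        (norm_eq_zero.1 hz2)
      exact hI (norm_eq_zero.1 (hz3 I (Finset.mem_univ I)))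
  set nI : ℝ := (Fintype.card (Fin k → Fin M) : ℝ) with hnI
  have hnI0 : 0 ≤ nI := by positivity
  set a : ℝ := c₀ / (2 * (nI + 1)) with ha
  have ha0 : 0 < a := by positivity
  set κ : ℝ := a / (2 * C * (k + 1)) with hκ
  have hκ0 : 0 < κ := by positivity
  set s : ℝ := √Φ with hs
  have hs0 : 0 ≤ s := Real.sqrt_nonneg _
  set R : ℝ := 1 + 4 * (k + 1) * s / c₀ + 4 / c₀ + H * D * s / κ with hRdef
  refine ⟨R, by positivity, 2 * κ / (1 + H), by positivity, fun x hx hRx hxΦ => ?_⟩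
  set φ := sqSum (evalFamily f) x with hφ
  by_cases hφ0 : φ = 0
  · exact exists_descent_of_eq_zero (by simp [hφ0])
  have hφp : 0 < φ := lt_of_le_of_ne (sqSum_nonneg _ _) (Ne.symm hφ0)
  have hsp : 0 < √φ := Real.sqrt_pos.2 hφp
  have hsφ : √φ ≤ s := Real.sqrt_le_sqrt hxΦ
  set ρ : ℝ := ‖x‖ with hρ
  have e1 : 0 ≤ 4 * (k + 1) * s / c₀ := by positivity
  have e2 : 0 ≤ 4 / c₀ := by positivity
  have e3 : 0 ≤ H * D * s / κ := by positivity
  have hρ1 : 1 ≤ ρ := by linarith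
  have hρa : 4 * (k + 1) * s ≤ c₀ * ρ := by
    rw [mul_comm c₀, ← div_le_iff₀ hc₀]; linarith
  have hρb : 4 ≤ c₀ * ρ := by
    rw [mul_comm c₀, ← div_le_iff₀ hc₀]; linarith
  have hρc : H * D * s ≤ κ * ρ := by
    rw [mul_comm κ, ← div_le_iff₀ hκ0]; linarith
  have hρ0 : 0 < ρ := by linarith
  have hρC : (ρ : ℂ) ≠ 0 := by exact_mod_cast hρ0.ne'
  set u : Fin M → ℂ := (ρ : ℂ)⁻¹ • x with hu
  have hxu : x = (ρ : ℂ) • u := by rw [hu, smul_smul, mul_inv_cancel₀ hρC, one_smul]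
  have huS : u ∈ Metric.sphere (0 : Fin M → ℂ) 1 := by
    rw [mem_sphere_zero_iff_norm, hu, norm_smul, norm_inv, Complex.norm_real, Real.norm_eq_abs,
      abs_of_pos hρ0, ← hρ, inv_mul_cancel₀ hρ0.ne']
  have hev : ∀ (p : MvPolynomial (Fin M) ℂ) (e : ℕ), p.IsHomogeneous e →
      eval x p = (ρ : ℂ) ^ e * eval u p := fun p e hp => by
    conv_lhs => rw [hxu]
    exact hp.eval_smul_eq _ _
  have hevn : ∀ (p : MvPolynomial (Fin M) ℂ) (e : ℕ), p.IsHomogeneous e →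
      ‖eval x p‖ = ρ ^ e * ‖eval u p‖ := fun p e hp => by
    rw [hev p e hp, norm_mul, norm_pow, Complex.norm_real, Real.norm_eq_abs, abs_of_pos hρ0]
  have hsmall : ∀ (p : MvPolynomial (Fin M) ℂ) (e : ℕ), p.IsHomogeneous e → 1 ≤ e →
      ρ * ‖eval u p‖ ≤ ‖eval x p‖ := fun p e hp he => by
    rw [hevn p e hp]
    gcongr
    exact le_self_pow₀ hρ1 (by omega)
  obtain ⟨I, hI⟩ : ∃ I, a ≤ ‖eval u (jacobianMinor f I)‖ := by
    by_contra! hcon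
    have h2 : ∑ j, ‖eval u (f j)‖ ≤ k * (s / ρ) := by
      calc ∑ j, ‖eval u (f j)‖ ≤ ∑ _j : Fin k, s / ρ := Finset.sum_le_sum fun j _ => by
            rw [le_div_iff₀ hρ0, mul_comm]
            exact (hsmall (f j) (dd j) (hf j) (by have := hdeg j; omega)).trans
              ((norm_eval_le_sqrt f x j).trans hsφ)
        _ = k * (s / ρ) := by simp
    have h3 : ‖eval u h‖ ≤ 1 / ρ := by
      rw [le_div_iff₀ hρ0, mul_comm]
      simpa [hx] using hsmall h d hh hd
    have h4 : k * (s / ρ) ≤ c₀ / 4 := by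
      rw [← mul_div_assoc, div_le_iff₀ hρ0]; nlinarith
    have h5 : 1 / ρ ≤ c₀ / 4 := by
      rw [div_le_iff₀ hρ0]; linarith
    have h6 := Hc₀ u huS
    have h8 : ∑ I, ‖eval u (jacobianMinor f I)‖ < c₀ / 2 := by
      calc ∑ I, ‖eval u (jacobianMinor f I)‖ ≤ nI * a := by
            calc ∑ I, ‖eval u (jacobianMinor f I)‖ ≤ ∑ _I : Fin k → Fin M, a :=
                  Finset.sum_le_sum fun I _ => (hcon I).le
              _ = nI * a := by simp [hnI]
        _ < (nI + 1) * a := by nlinarith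
        _ = c₀ / 2 := by rw [ha]; field_simp
    linarith
  set c : Fin k → ℂ := fun j => (starRingEnd ℂ) (eval x (f j)) * (ρ : ℂ) ^ (dd j - 1) with hc
  have hcj : ∀ j, ρ ^ d * ‖eval x (f j)‖ ≤ ‖c‖ := fun j => by
    refine le_trans ?_ (norm_le_pi_norm c j)
    rw [hc, norm_mul, RCLike.norm_conj, norm_pow, Complex.norm_real, Real.norm_eq_abs,
      abs_of_pos hρ0, mul_comm]
    refine mul_le_mul_of_nonneg_left (pow_le_pow_right₀ hρ1 ?_) (norm_nonneg _)
    have := hdeg j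
    omega
  have hcn : ρ ^ d * √φ ≤ (k + 1) * ‖c‖ := by
    have := sqrt_sqSum_le f x (t := ‖c‖ / ρ ^ d) (by positivity) fun j => by
      rw [le_div_iff₀ (by positivity), mul_comm]; exact hcj j
    rw [← mul_div_assoc, le_div_iff₀ (by positivity)] at this
    linarith
  have hcp : 0 < ‖c‖ := by
    by_contra hcon
    have : ‖c‖ = 0 := le_antisymm (not_lt.1 hcon) (norm_nonneg _)
    rw [this, mul_zero] at hcn
    have : 0 < ρ ^ d * √φ := by positivity
    linarith
  obtain ⟨i, hi⟩ := HC u huS I c (mul_pos (ha0.trans_le hI) hcp)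
  have hθ : ∑ j, c j * eval u (pderiv i (f j)) =
      ∑ j, (starRingEnd ℂ) (eval x (f j)) * eval x (pderiv i (f j)) :=
    Finset.sum_congr rfl fun j _ => by
      rw [hev (pderiv i (f j)) (dd j - 1) (hf j).pderiv, hc]
      ring
  rw [hθ] at hi
  have h1 : 2 * κ * ρ ^ d * √φ ≤
      ‖∑ j, (starRingEnd ℂ) (eval x (f j)) * eval x (pderiv i (f j))‖ := by
    have h3 : 2 * κ * ρ ^ d * √φ = a * (ρ ^ d * √φ) / (C * (k + 1)) := by
      rw [hκ]; field_simp
    rw [h3, div_le_iff₀ (by positivity)]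
    calc a * (ρ ^ d * √φ) ≤ a * ((k + 1) * ‖c‖) := by gcongr
      _ = (k + 1) * (a * ‖c‖) := by ring
      _ ≤ (k + 1) * (C * ‖∑ j, (starRingEnd ℂ) (eval x (f j)) * eval x (pderiv i (f j))‖) := by
          exact mul_le_mul_of_nonneg_left ((mul_le_mul_of_nonneg_right hI hcp.le).trans hi)
            (by positivity)
      _ = _ := by ring
  have hpow : ρ ^ (d - 1) * ρ = ρ ^ d := by
    rw [← pow_succ, Nat.sub_add_cancel hd]
  have hρd : 1 ≤ ρ ^ d := one_le_pow₀ hρ1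
  have hdh : ‖eval x (pderiv i h)‖ ≤ H * ρ ^ (d - 1) := by
    rw [hevn (pderiv i h) (d - 1) hh.pderiv, mul_comm]
    gcongr
    exact HH u huS i
  obtain ⟨w, hw1, hw2, hw3⟩ := exists_tangent_descent hd hh hf hD hx i
    (b := κ * √φ / (1 + H)) (B := (1 + H) * ρ ^ d) (by positivity)
    (by
      calc 1 + ‖eval x (pderiv i h)‖ * ρ ≤ ρ ^ d + H * ρ ^ (d - 1) * ρ := by gcongr
        _ = (1 + H) * ρ ^ d := by rw [mul_assoc, hpow]; ring)
    (by
      refine le_trans ?_ h1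
      have h4 : κ * √φ / (1 + H) * ((1 + H) * ρ ^ d) = κ * ρ ^ d * √φ := by field_simp
      have h5 : ‖eval x (pderiv i h)‖ * (D * φ) ≤ κ * ρ ^ d * √φ := by
        calc ‖eval x (pderiv i h)‖ * (D * φ) ≤ H * ρ ^ (d - 1) * (D * φ) := by gcongr
          _ = (ρ ^ (d - 1) * (H * D * √φ)) * √φ := by
              nth_rewrite 1 [← Real.mul_self_sqrt hφp.le]; ring
          _ ≤ (ρ ^ (d - 1) * (H * D * s)) * √φ := by gcongr
          _ ≤ (ρ ^ (d - 1) * (κ * ρ)) * √φ := by gcongr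
          _ = κ * ρ ^ d * √φ := by rw [← hpow]; ring
      rw [h4]
      linarith)
  refine ⟨w, hw1, hw2, hw3.trans (le_of_eq ?_)⟩
  ring

end DescentEstimates

section Lojasiewicz

variable {k M d : ℕ} {dd : Fin k → ℕ} {f : Fin k → MvPolynomial (Fin M) ℂ}
  {h : MvPolynomial (Fin M) ℂ}

/-- All coordinates of `x` have real and imaginary parts `r`-close to `S`. -/
def NearGrid (S : Finset ℝ) (r : ℝ) (x : Fin M → ℂ) : Prop :=
  ∀ i, (∃ s ∈ S, |(x i).re - s| < r) ∧ ∃ s ∈ S, |(x i).im - s| < r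

/-- On a compact set, an element of an ideal is dominated by the generators. -/
theorem exists_norm_eval_le_of_mem_span {ι : Type*} [Fintype ι]
    (g : ι → MvPolynomial (Fin M) ℂ) {Z : Set (Fin M → ℂ)} (hZ : IsCompact Z)
    {p : MvPolynomial (Fin M) ℂ} (hp : p ∈ Ideal.span (Set.range g)) :
    ∃ C, 0 ≤ C ∧ ∀ x ∈ Z, ‖eval x p‖ ≤ C * ∑ l, ‖eval x (g l)‖ := by
  obtain ⟨a, rfl⟩ := (Ideal.mem_span_range_iff_exists_fun).1 hp
  choose C hC using fun l => hZ.exists_bound_of_continuousOn (a l).continuous_eval.continuousOn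
  refine ⟨∑ l, |C l|, Finset.sum_nonneg fun _ _ => abs_nonneg _, fun x hx => ?_⟩
  rw [map_sum, Finset.mul_sum]
  refine (norm_sum_le _ _).trans (Finset.sum_le_sum fun l _ => ?_)
  rw [map_mul, norm_mul]
  refine mul_le_mul_of_nonneg_right ?_ (norm_nonneg _)
  exact (hC l x hx).trans ((le_abs_self _).trans
    (Finset.single_le_sum (f := fun l => |C l|) (fun _ _ => abs_nonneg _) (Finset.mem_univ l)))

/-- A Łojasiewicz inequality: away from the grid spanned by the finitely many common zeros of `g`,
the functions `g` are not simultaneously small. -/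
theorem exists_lojasiewicz {ι : Type*} [Fintype ι] (g : ι → MvPolynomial (Fin M) ℂ)
    (hfin : {x : Fin M → ℂ | ∀ l, eval x (g l) = 0}.Finite) {Z : Set (Fin M → ℂ)}
    (hZ : IsCompact Z) :
    ∃ (S : Finset ℝ) (m : ℕ) (C : ℝ), 0 < C ∧ ∀ x ∈ Z, ∀ r : ℝ, 0 < r → r ≤ 1 →
      ¬ NearGrid S r x → r ^ m ≤ C * ∑ l, ‖eval x (g l)‖ := by
  classical
  set T : Finset (Fin M → ℂ) := hfin.toFinset with hT
  set S : Finset ℝ := T.biUnion fun σ =>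
    (Finset.univ.image fun i => (σ i).re) ∪ Finset.univ.image fun i => (σ i).im with hS
  have hre : ∀ σ ∈ T, ∀ i, (σ i).re ∈ S := fun σ hσ i => by
    refine Finset.mem_biUnion.2 ⟨σ, hσ, ?_⟩
    exact Finset.mem_union_left _ (Finset.mem_image_of_mem _ (Finset.mem_univ i))
  have him : ∀ σ ∈ T, ∀ i, (σ i).im ∈ S := fun σ hσ i => by
    refine Finset.mem_biUnion.2 ⟨σ, hσ, ?_⟩
    exact Finset.mem_union_right _ (Finset.mem_image_of_mem _ (Finset.mem_univ i))
  set P : Fin M → MvPolynomial (Fin M) ℂ := fun i => ∏ σ ∈ T, (X i - C (σ i)) with hP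
  have hPJ : ∀ i, ∃ e : ℕ, P i ^ e ∈ Ideal.span (Set.range g) := fun i => by
    have : P i ∈ (Ideal.span (Set.range g)).radical := by
      rw [← vanishingIdeal_zeroLocus_eq_radical (K := ℂ), mem_vanishingIdeal_iff]
      intro x hx
      rw [zeroLocus_span] at hx
      have hxT : x ∈ T := by
        rw [hT, Set.Finite.mem_toFinset]
        intro l
        have := hx (g l) ⟨l, rfl⟩
        rwa [aeval_eq_eval] at this
      rw [aeval_eq_eval]
      change eval x (P i) = 0
      rw [hP, map_prod]
      exact Finset.prod_eq_zero hxT (by simp)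
    exact this
  choose e he using hPJ
  choose C hC0 hC using fun i => exists_norm_eval_le_of_mem_span g hZ (he i)
  refine ⟨S, T.card * ∑ i, e i, 1 + ∑ i, C i, ?_,
    fun x hx r hr hr1 hxS => ?_⟩
  · have := Finset.sum_nonneg fun i (_ : i ∈ Finset.univ) => hC0 i
    linarith
  have hE : 0 ≤ ∑ l, ‖eval x (g l)‖ := Finset.sum_nonneg fun _ _ => norm_nonneg _
  obtain ⟨i, hi⟩ : ∃ i, ∀ σ ∈ T, r ≤ ‖x i - σ i‖ := by
    rw [NearGrid, not_forall] at hxS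
    obtain ⟨i, hi⟩ := hxS
    refine ⟨i, fun σ hσ => ?_⟩
    by_contra! hcon
    refine hi ⟨⟨_, hre σ hσ i, ?_⟩, ⟨_, him σ hσ i, ?_⟩⟩
    · rw [← Complex.sub_re]
      exact (Complex.abs_re_le_norm _).trans_lt hcon
    · rw [← Complex.sub_im]
      exact (Complex.abs_im_le_norm _).trans_lt hcon
  have h1 : r ^ T.card ≤ ‖eval x (P i)‖ := by
    rw [hP, map_prod, norm_prod, ← Finset.prod_const]
    refine Finset.prod_le_prod (fun _ _ => hr.le) fun σ hσ => ?_
    simpa using hi σ hσ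
  calc r ^ (T.card * ∑ i, e i) ≤ r ^ (T.card * e i) :=
        pow_le_pow_of_le_one hr.le hr1 (Nat.mul_le_mul_left _
          (Finset.single_le_sum (f := e) (fun _ _ => Nat.zero_le _) (Finset.mem_univ i)))
    _ = (r ^ T.card) ^ e i := pow_mul _ _ _
    _ ≤ ‖eval x (P i)‖ ^ e i := pow_le_pow_left₀ (by positivity) h1 _
    _ = ‖eval x (P i ^ e i)‖ := by rw [map_pow, norm_pow]
    _ ≤ C i * ∑ l, ‖eval x (g l)‖ := hC i x hx
    _ ≤ (1 + ∑ i, C i) * ∑ l, ‖eval x (g l)‖ := by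
        refine mul_le_mul_of_nonneg_right ?_ hE
        have := Finset.single_le_sum (f := C) (fun i _ => hC0 i) (Finset.mem_univ i)
        linarith

end Lojasiewicz

section DescentEstimates

variable {k M d : ℕ} {dd : Fin k → ℕ} {f : Fin k → MvPolynomial (Fin M) ℂ}
  {h : MvPolynomial (Fin M) ℂ}

theorem exists_descent_off_grid (hd : 1 ≤ d) (hh : h.IsHomogeneous d)
    (hf : ∀ j, (f j).IsHomogeneous (dd j)) (hdeg : ∀ j, d < dd j)
    (hreg : ∀ u : Fin M → ℂ, u ≠ 0 → (∀ j, eval u (f j) = 0) → eval u h = 0 →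
      ∃ I, eval u (jacobianMinor f I) ≠ 0)
    (hfin : {x : Fin M → ℂ | (∀ j, eval x (f j) = 0) ∧ eval x h = 1 ∧
      ∀ I, eval x (jacobianMinor f I) = 0}.Finite) :
    ∃ (S : Finset ℝ) (m : ℕ) (c l₀ : ℝ), 0 < m ∧ 0 < c ∧ 0 < l₀ ∧ l₀ ≤ 1 ∧
      ∀ r, 0 < r → r ≤ l₀ → ∀ x : Fin M → ℂ, eval x h = 1 → sqSum (evalFamily f) x ≤ r ^ m →
      ¬ NearGrid S r x →
      ∃ w, ‖w‖ ≤ 1 ∧ fderiv ℂ (fun y : Fin M → ℂ => eval y h) x w = 0 ∧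
        ∑ j, 2 * inner ℝ (evalFamily f j x) (fderiv ℂ (evalFamily f j) x w) ≤
          -(c / r * sqSum (evalFamily f) x) := by
  obtain ⟨R, hR, c₁, hc₁, H₁⟩ := exists_descent_at_infinity hd hh hf hdeg hreg 1
  set Z : Set (Fin M → ℂ) := Metric.closedBall 0 R ∩ {x | eval x h = 1} with hZdef
  have hZ : IsCompact Z := (isCompact_closedBall _ _).inter_right
    (isClosed_eq h.continuous_eval continuous_const)
  obtain ⟨c₂, hc₂, c₃, hc₃, H₂⟩ := exists_descent_of_minor hd hh hf hZ fun x hx => hx.2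
  set g : (Fin k ⊕ Unit) ⊕ (Fin k → Fin M) → MvPolynomial (Fin M) ℂ :=
    Sum.elim (Sum.elim f fun _ => h - 1) (jacobianMinor f) with hg
  have hfin' : {x : Fin M → ℂ | ∀ l, eval x (g l) = 0}.Finite := by
    refine hfin.subset fun x hx => ⟨fun j => hx (.inl (.inl j)), ?_, fun I => hx (.inr I)⟩
    have := hx (.inl (.inr ()))
    rwa [hg, Sum.elim_inl, Sum.elim_inr, map_sub, map_one, sub_eq_zero] at this
  obtain ⟨S, m, C, hC, H₃⟩ := exists_lojasiewicz g hfin' hZ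
  set nI : ℝ := (Fintype.card (Fin k → Fin M) : ℝ) with hnI
  have hnI0 : 0 ≤ nI := by positivity
  set b : ℝ := 1 / (2 * C * (nI + 1)) with hb
  have hb0 : 0 < b := by positivity
  set c : ℝ := min c₁ (c₂ * b) with hc
  have hc0 : 0 < c := by positivity
  set l₀ : ℝ := min 1 (min (1 / (2 * C * (k + 1))) (c₃ * b)) with hl
  have hl0 : 0 < l₀ := by positivity
  have hl1 : l₀ ≤ 1 := min_le_left _ _
  have hl2 : l₀ ≤ 1 / (2 * C * (k + 1)) := (min_le_right _ _).trans (min_le_left _ _)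
  have hl3 : l₀ ≤ c₃ * b := (min_le_right _ _).trans (min_le_right _ _)
  refine ⟨S, 2 * (m + 1), c, l₀, by omega, hc0, hl0, hl1, fun r hr hrl x hx hφ hS => ?_⟩
  set φ := sqSum (evalFamily f) x with hφdef
  have hφ0 : 0 ≤ φ := sqSum_nonneg _ _
  have hr1 : r ≤ 1 := hrl.trans hl1
  have hs0 : 0 ≤ √φ := Real.sqrt_nonneg _
  have hs : √φ ≤ r ^ (m + 1) := by
    rw [Real.sqrt_le_iff]
    refine ⟨by positivity, ?_⟩
    rwa [← pow_mul, mul_comm]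
  have hφs : φ = √φ * √φ := (Real.mul_self_sqrt hφ0).symm
  by_cases hxR : R ≤ ‖x‖
  · obtain ⟨w, hw1, hw2, hw3⟩ := H₁ x hx hxR (hφ.trans (pow_le_one₀ hr.le hr1))
    refine ⟨w, hw1, hw2, hw3.trans (neg_le_neg ?_)⟩
    have h1 : √φ ≤ r := hs.trans (pow_le_of_le_one hr.le hr1 (by omega))
    calc c / r * φ = c / r * (√φ * √φ) := by rw [← hφs]
      _ ≤ c / r * (r * √φ) := by gcongr
      _ = c * √φ := by field_simp
      _ ≤ c₁ * √φ := by gcongr; exact min_le_left _ _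
  · have hxZ : x ∈ Z := ⟨by rw [mem_closedBall_zero_iff]; exact (not_le.1 hxR).le, hx⟩
    have h1 := H₃ x hxZ r hr hr1 hS
    have h2 : ∑ l, ‖eval x (g l)‖ =
        ∑ j, ‖eval x (f j)‖ + ∑ I, ‖eval x (jacobianMinor f I)‖ := by
      simp [hg, Fintype.sum_sum_type, hx]
    have h3 : C * ∑ j, ‖eval x (f j)‖ ≤ r ^ m / 2 := by
      calc C * ∑ j, ‖eval x (f j)‖ ≤ C * ∑ _j : Fin k, √φ := by
            gcongr
            exact norm_eval_le_sqrt f x _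
        _ = C * k * √φ := by simp; ring
        _ ≤ C * (k + 1) * r ^ (m + 1) := by
            refine mul_le_mul ?_ hs hs0 (by positivity)
            gcongr
            linarith
        _ = C * (k + 1) * r * r ^ m := by ring
        _ ≤ C * (k + 1) * (1 / (2 * C * (k + 1))) * r ^ m := by
            gcongr
            exact hrl.trans hl2
        _ = r ^ m / 2 := by field_simp
    obtain ⟨I, hI⟩ : ∃ I, b * r ^ m ≤ ‖eval x (jacobianMinor f I)‖ := by
      by_contra! hcon
      have h4 : C * ∑ I, ‖eval x (jacobianMinor f I)‖ < r ^ m / 2 := by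
        calc C * ∑ I, ‖eval x (jacobianMinor f I)‖ ≤ C * ∑ _I : Fin k → Fin M, b * r ^ m := by
              gcongr with I
              exact (hcon I).le
          _ = C * nI * (b * r ^ m) := by simp [hnI]; ring
          _ < C * (nI + 1) * (b * r ^ m) := by
              gcongr
              linarith
          _ = r ^ m / 2 := by rw [hb]; field_simp
      rw [h2, mul_add] at h1
      linarith
    obtain ⟨w, hw1, hw2, hw3⟩ := H₂ x hxZ (b * r ^ m) I (by positivity) hI (by
      calc √φ ≤ r ^ (m + 1) := hs
        _ = r * r ^ m := by ring
        _ ≤ c₃ * b * r ^ m := by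
            gcongr
            exact hrl.trans hl3
        _ = _ := by ring)
    refine ⟨w, hw1, hw2, hw3.trans (neg_le_neg ?_)⟩
    calc c / r * φ = c / r * (√φ * √φ) := by rw [← hφs]
      _ ≤ c / r * (r ^ (m + 1) * √φ) := by gcongr
      _ = c * r ^ m * √φ := by rw [pow_succ]; field_simp
      _ ≤ c₂ * b * r ^ m * √φ := by gcongr; exact min_le_right _ _
      _ = _ := by ring

end DescentEstimates

section Iteration

variable {k M d : ℕ} {dd : Fin k → ℕ} {f : Fin k → MvPolynomial (Fin M) ℂ}
  {h : MvPolynomial (Fin M) ℂ} {K : Type*} [TopologicalSpace K] [CompactSpace K] {n : ℕ}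

theorem exists_pos_separation (S : Finset ℝ) :
    ∃ r > 0, ∀ p ∈ S, ∀ q ∈ S, p ≠ q → 2 * r ≤ |p - q| := by
  have : ∀ᶠ r in nhdsWithin (0 : ℝ) (Set.Ioi 0), ∀ p ∈ S, ∀ q ∈ S, p ≠ q → 2 * r ≤ |p - q| := by
    rw [Filter.eventually_all_finset]
    intro p _
    rw [Filter.eventually_all_finset]
    intro q _
    by_cases hpq : p = q
    · exact .of_forall fun r hne => absurd hpq hne
    · have h0 : 0 < |p - q| / 2 := by
        have := abs_pos.2 (sub_ne_zero.2 hpq)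
        positivity
      filter_upwards [mem_nhdsWithin_of_mem_nhds (Iio_mem_nhds h0)] with r hr _
      have : r < |p - q| / 2 := hr
      linarith
  obtain ⟨r, hr, h0⟩ := (this.and self_mem_nhdsWithin).exists
  exact ⟨r, h0, hr⟩

/-- The defect of a map into `h = 1` can be made arbitrarily small. -/
theorem exists_lowering_to (hd : 1 ≤ d) (hh : h.IsHomogeneous d)
    (hf : ∀ j, (f j).IsHomogeneous (dd j)) (hdeg : ∀ j, d < dd j)
    (hreg : ∀ u : Fin M → ℂ, u ≠ 0 → (∀ j, eval u (f j) = 0) → eval u h = 0 →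
      ∃ I, eval u (jacobianMinor f I) ≠ 0)
    (hnk : n + k ≤ M) (hK : AvoidsZero K (EuclideanSpace ℝ (Fin n))) {α : ℝ} (hα : 0 < α)
    {u : K → Fin M → ℂ} (hu : Continuous u) (huh : ∀ x, eval (u x) h = 1) :
    ∃ v, Continuous v ∧ ∀ x, eval (v x) h = 1 ∧ ((∀ j, eval (u x) (f j) = 0) → v x = u x) ∧
      sqSum (evalFamily f) (v x) ≤ α := by
  have hfc : ∀ j, Continuous (evalFamily f j) := fun j => (f j).continuous_eval
  obtain ⟨β₀, hβ₀⟩ := isCompact_univ.exists_bound_of_continuousOn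
    ((continuous_sqSum hfc).comp hu).continuousOn
  set β : ℝ := max α β₀ with hβ
  have hαβ : α ≤ β := le_max_left _ _
  have hβ0 : 0 < β := hα.trans_le hαβ
  obtain ⟨R, hR, c, hc, H⟩ := exists_descent_at_infinity hd hh hf hdeg hreg (2 * β)
  obtain ⟨v, hv, H'⟩ := exists_lowering_sqSum (K := K) (f := evalFamily f)
    (h := fun x : Fin M → ℂ => eval x h) (d := d) (by omega) h.contDiff_eval
    (fun c x => hh.eval_smul_eq c x) (fun j => (f j).contDiff_eval) hnk hK
    (L := 1 + ({0} : Finset ℝ).card) (Q := collapse {0} R) (q := 4 * ({0} : Finset ℝ).card * R)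
    (η := c / √(2 * β)) (by positivity) (dist_collapse_le {0} R) (dist_le_collapse {0} hR.le)
    hα hαβ (by positivity)
    (fun x hx _ hxβ => by
      by_cases hxR : R ≤ ‖x‖
      · right
        obtain ⟨w, hw1, hw2, hw3⟩ := H x hx hxR hxβ
        refine ⟨w, hw1, hw2, hw3.trans ?_⟩
        have h1 : √(sqSum (evalFamily f) x) ≤ √(2 * β) := Real.sqrt_le_sqrt hxβ
        have h2 := Real.mul_self_sqrt (sqSum_nonneg (evalFamily f) x)
        rw [neg_mul, neg_le_neg_iff]
        calc c / √(2 * β) * sqSum (evalFamily f) x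
            = c / √(2 * β) * (√(sqSum (evalFamily f) x) * √(sqSum (evalFamily f) x)) := by rw [h2]
          _ ≤ c / √(2 * β) * (√(2 * β) * √(sqSum (evalFamily f) x)) := by gcongr
          _ = c * √(sqSum (evalFamily f) x) := by
              have : √(2 * β) ≠ 0 := by positivity
              field_simp
      · left
        refine eventually_collapse_eq (fun p hp q hq hpq => ?_) fun i => ?_
        · rw [Finset.mem_singleton] at hp hq
          exact absurd (hp.trans hq.symm) hpq
        · have hi : ‖x i‖ < R := (norm_le_pi_norm x i).trans_lt (not_le.1 hxR)
          exact ⟨⟨0, by simp, by simpa using (Complex.abs_re_le_norm _).trans_lt hi⟩,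
            ⟨0, by simp, by simpa using (Complex.abs_im_le_norm _).trans_lt hi⟩⟩)
    hu huh (fun x => by
      have := hβ₀ x (Set.mem_univ x)
      exact (le_abs_self _).trans (this.trans (le_max_right _ _)))
  exact ⟨v, hv, fun x => ⟨(H' x).1, (H' x).2.1, (H' x).2.2.1⟩⟩

/-- Successive lowering steps with geometrically decreasing displacement. -/
theorem exists_lowering_step (hd : 1 ≤ d) (hh : h.IsHomogeneous d)
    (hf : ∀ j, (f j).IsHomogeneous (dd j)) (hdeg : ∀ j, d < dd j)
    (hreg : ∀ u : Fin M → ℂ, u ≠ 0 → (∀ j, eval u (f j) = 0) → eval u h = 0 →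
      ∃ I, eval u (jacobianMinor f I) ≠ 0)
    (hfin : {x : Fin M → ℂ | (∀ j, eval x (f j) = 0) ∧ eval x h = 1 ∧
      ∀ I, eval x (jacobianMinor f I) = 0}.Finite)
    (hnk : n + k ≤ M) (hK : AvoidsZero K (EuclideanSpace ℝ (Fin n))) :
    ∃ (m : ℕ) (l C : ℝ), 0 < m ∧ 0 < l ∧ l ≤ 1 ∧ ∀ r, 0 < r → r ≤ l →
      ∀ u : K → Fin M → ℂ, Continuous u → (∀ x, eval (u x) h = 1) →
      (∀ x, sqSum (evalFamily f) (u x) ≤ r ^ m / 2) →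
      ∃ v : K → Fin M → ℂ, Continuous v ∧ ∀ x, eval (v x) h = 1 ∧
        ((∀ j, eval (u x) (f j) = 0) → v x = u x) ∧
        sqSum (evalFamily f) (v x) ≤ (r / 2) ^ m / 2 ∧ dist (v x) (u x) ≤ C * r := by
  obtain ⟨S, m, c, l₀, hm, hc, hl, hl1, H⟩ := exists_descent_off_grid hd hh hf hdeg hreg hfin
  obtain ⟨σ, hσ, hsep⟩ := exists_pos_separation S
  refine ⟨m, min l₀ σ, 2 * (8 * (1 + S.card) / c * (Real.log (8 * 2 ^ m) + 1)) + 4 * S.card,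
    hm, by positivity, (min_le_left _ _).trans hl1, fun r hr hrl u hu huh hus => ?_⟩
  have hαβ : (r / 2) ^ m / 2 ≤ r ^ m / 2 := by
    gcongr
    linarith
  obtain ⟨v, hv, H'⟩ := exists_lowering_sqSum (K := K) (f := evalFamily f)
    (h := fun x : Fin M → ℂ => eval x h) (d := d) (by omega) h.contDiff_eval
    (fun c x => hh.eval_smul_eq c x) (fun j => (f j).contDiff_eval) hnk hK
    (L := 1 + S.card) (Q := collapse S r) (q := 4 * S.card * r)
    (η := c / r) (by positivity) (dist_collapse_le S r) (dist_le_collapse S hr.le)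
    (α := (r / 2) ^ m / 2) (β := r ^ m / 2) (by positivity) hαβ (by positivity)
    (fun x hx _ hxβ => by
      by_cases hxS : NearGrid S r x
      · left
        refine eventually_collapse_eq (fun p hp q hq hpq => ?_) hxS
        exact le_trans (by linarith [hrl.trans (min_le_right l₀ σ)]) (hsep p hp q hq hpq)
      · right
        obtain ⟨w, hw1, hw2, hw3⟩ :=
          H r hr (hrl.trans (min_le_left _ _)) x hx (by linarith) hxS
        exact ⟨w, hw1, hw2, hw3.trans (by rw [neg_mul])⟩)
    hu huh hus
  refine ⟨v, hv, fun x => ⟨(H' x).1, (H' x).2.1, (H' x).2.2.1, (H' x).2.2.2.trans (le_of_eq ?_)⟩⟩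
  have h1 : 8 * (r ^ m / 2) / ((r / 2) ^ m / 2) = 8 * 2 ^ m := by
    rw [div_pow]
    field_simp
  rw [h1]
  field_simp

/-- A map from a low-dimensional compact space into the Milnor fibre `h = 1` can be modified,
relative to the common zeros of `f`, so as to take values in the common zeros of `f`. -/
theorem exists_map_to_commonZeros (hd : 1 ≤ d) (hh : h.IsHomogeneous d)
    (hf : ∀ j, (f j).IsHomogeneous (dd j)) (hdeg : ∀ j, d < dd j)
    (hreg : ∀ u : Fin M → ℂ, u ≠ 0 → (∀ j, eval u (f j) = 0) → eval u h = 0 →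
      ∃ I, eval u (jacobianMinor f I) ≠ 0)
    (hfin : {x : Fin M → ℂ | (∀ j, eval x (f j) = 0) ∧ eval x h = 1 ∧
      ∀ I, eval x (jacobianMinor f I) = 0}.Finite)
    (hnk : n + k ≤ M) (hK : AvoidsZero K (EuclideanSpace ℝ (Fin n)))
    {u : K → Fin M → ℂ} (hu : Continuous u) (huh : ∀ x, eval (u x) h = 1) :
    ∃ v : K → Fin M → ℂ, Continuous v ∧ ∀ x, eval (v x) h = 1 ∧ (∀ j, eval (v x) (f j) = 0) ∧
      ((∀ j, eval (u x) (f j) = 0) → v x = u x) := by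
  obtain ⟨m, l, C, hm, hl, hl1, step⟩ :=
    exists_lowering_step (K := K) hd hh hf hdeg hreg hfin hnk hK
  obtain ⟨v₀, hv₀, H₀⟩ := exists_lowering_to hd hh hf hdeg hreg hnk hK
    (α := l ^ m / 2) (by positivity) hu huh
  have step' : ∀ (r : ℝ) (u : K → Fin M → ℂ), ∃ v : K → Fin M → ℂ, 0 < r → r ≤ l →
      Continuous u → (∀ x, eval (u x) h = 1) →
      (∀ x, sqSum (evalFamily f) (u x) ≤ r ^ m / 2) → Continuous v ∧ ∀ x, eval (v x) h = 1 ∧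
        ((∀ j, eval (u x) (f j) = 0) → v x = u x) ∧
        sqSum (evalFamily f) (v x) ≤ (r / 2) ^ m / 2 ∧ dist (v x) (u x) ≤ C * r := by
    intro r u
    by_cases hyp : 0 < r ∧ r ≤ l ∧ Continuous u ∧ (∀ x, eval (u x) h = 1) ∧
      (∀ x, sqSum (evalFamily f) (u x) ≤ r ^ m / 2)
    · obtain ⟨v, hv⟩ := step r hyp.1 hyp.2.1 u hyp.2.2.1 hyp.2.2.2.1 hyp.2.2.2.2
      exact ⟨v, fun _ _ _ _ _ => hv⟩
    · exact ⟨u, fun h1 h2 h3 h4 h5 => absurd ⟨h1, h2, h3, h4, h5⟩ hyp⟩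
  choose G hG using step'
  set r : ℕ → ℝ := fun j => l * (1 / 2) ^ j with hr
  have hr0 : ∀ j, 0 < r j := fun j => by positivity
  have hrl : ∀ j, r j ≤ l := fun j => by
    have : ((1 : ℝ) / 2) ^ j ≤ 1 := pow_le_one₀ (by norm_num) (by norm_num)
    exact mul_le_of_le_one_right hl.le this
  have hrs : ∀ j, r (j + 1) = r j / 2 := fun j => by rw [hr]; ring
  let w : ℕ → K → Fin M → ℂ := fun j => Nat.rec v₀ (fun j u => G (r j) u) j
  have hws : ∀ j, w (j + 1) = G (r j) (w j) := fun j => rfl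
  have hw : ∀ j, Continuous (w j) ∧ ∀ x, eval (w j x) h = 1 ∧
      ((∀ i, eval (u x) (f i) = 0) → w j x = u x) ∧
      sqSum (evalFamily f) (w j x) ≤ r j ^ m / 2 := by
    intro j
    induction j with
    | zero =>
      refine ⟨hv₀, fun x => ⟨(H₀ x).1, (H₀ x).2.1, ?_⟩⟩
      change sqSum (evalFamily f) (v₀ x) ≤ r 0 ^ m / 2
      simpa [hr] using (H₀ x).2.2
    | succ j ih =>
      have := hG (r j) (w j) (hr0 j) (hrl j) ih.1 (fun x => (ih.2 x).1) fun x => (ih.2 x).2.2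
      refine ⟨this.1, fun x => ⟨(this.2 x).1, fun hx => ?_, ?_⟩⟩
      · have h1 := (ih.2 x).2.1 hx
        rw [hws, (this.2 x).2.1 (by rw [h1]; exact hx), h1]
      · rw [hrs]
        exact (this.2 x).2.2.1
  have hdist : ∀ x j, dist (w j x) (w (j + 1) x) ≤ C * l * (1 / 2) ^ j := fun x j => by
    rw [dist_comm, mul_assoc]
    exact ((hG (r j) (w j) (hr0 j) (hrl j) (hw j).1 (fun x => ((hw j).2 x).1)
      fun x => ((hw j).2 x).2.2).2 x).2.2.2
  have hlim : ∀ x, ∃ a, Filter.Tendsto (fun j => w j x) Filter.atTop (nhds a) := fun x =>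
    cauchySeq_tendsto_of_complete (cauchySeq_of_le_geometric (1 / 2) (C * l) (by norm_num)
      (hdist x))
  choose v hv using hlim
  have hunif : TendstoUniformly w v Filter.atTop := by
    rw [Metric.tendstoUniformly_iff]
    intro ε hε
    have h1 : Filter.Tendsto (fun j : ℕ => C * l * (1 / 2 : ℝ) ^ j / (1 - 1 / 2)) Filter.atTop
        (nhds (C * l * 0 / (1 - 1 / 2))) :=
      ((tendsto_pow_atTop_nhds_zero_of_lt_one (by norm_num) (by norm_num)).const_mul _).div_const _
    filter_upwards [h1.eventually_lt_const (by simpa using hε)] with j hj x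
    rw [dist_comm]
    exact (dist_le_of_le_geometric_of_tendsto (1 / 2) (C * l) (by norm_num) (hdist x) (hv x)
      j).trans_lt hj
  have hrt : Filter.Tendsto (fun j => r j ^ m / 2) Filter.atTop (nhds 0) := by
    have h1 : Filter.Tendsto r Filter.atTop (nhds (l * 0)) :=
      (tendsto_pow_atTop_nhds_zero_of_lt_one (by norm_num) (by norm_num)).const_mul _
    have h2 := (h1.pow m).div_const 2
    simpa [hm.ne'] using h2
  have hfc : ∀ j, Continuous (evalFamily f j) := fun j => (f j).continuous_eval
  refine ⟨v, hunif.continuous (.of_forall fun j => (hw j).1), fun x => ⟨?_, ?_, fun hx => ?_⟩⟩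
  · refine tendsto_nhds_unique ((h.continuous_eval.tendsto (v x)).comp (hv x)) ?_
    exact tendsto_const_nhds.congr fun j => ((hw j).2 x).1.symm
  · have h1 : sqSum (evalFamily f) (v x) ≤ 0 :=
      le_of_tendsto_of_tendsto (((continuous_sqSum hfc).tendsto (v x)).comp (hv x)) hrt
        (.of_forall fun j => ((hw j).2 x).2.2)
    exact sqSum_eq_zero.1 (le_antisymm h1 (sqSum_nonneg _ _))
  · refine tendsto_nhds_unique (hv x) ?_
    exact tendsto_const_nhds.congr fun j => (((hw j).2 x).2.1 hx).symm

end Iteration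

section Connectivity

open scoped unitInterval

/-- If maps of low-dimensional cubes into `W` can be modified, relative to `F`, to take values in
`F ⊆ W`, then high connectivity passes from `W` to `F`. -/
theorem SConnected.of_compression {E : Type*} [TopologicalSpace E] {W F : E → Prop}
    (hFW : ∀ x, F x → W x) {s : ℕ}
    (hext : ∀ i ≤ s, ∀ u : I × (Fin i → I) → E, Continuous u → (∀ x, W (u x)) →
      ∃ v : I × (Fin i → I) → E, Continuous v ∧ ∀ x, F (v x) ∧ (F (u x) → v x = u x))
    (hW : SConnected s {x // W x}) : SConnected s {x // F x} := by
  obtain ⟨⟨w⟩, hpc, hpi⟩ := hW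
  have hne : Nonempty {x // F x} := by
    obtain ⟨v, -, hv⟩ := hext 0 (Nat.zero_le _) (fun _ => w.1) continuous_const fun _ => w.2
    exact ⟨⟨v (0, fun _ => 0), (hv _).1⟩⟩
  refine ⟨hne, ⟨hne, fun a b => ?_⟩, fun i hi1 his y => ?_⟩
  · obtain ⟨γ⟩ := hpc.joined ⟨a.1, hFW _ a.2⟩ ⟨b.1, hFW _ b.2⟩
    obtain ⟨v, hvc, hv⟩ := hext 0 (Nat.zero_le _) (fun p => (γ p.1).1)
      (continuous_subtype_val.comp (γ.continuous.comp continuous_fst)) fun p => (γ p.1).2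
    refine ⟨⟨⟨fun t => ⟨v (t, fun _ => 0), (hv _).1⟩, ?_⟩, ?_, ?_⟩⟩
    · exact (hvc.comp (by fun_prop)).subtype_mk _
    · refine Subtype.ext (((hv (0, fun _ => 0)).2 ?_).trans ?_)
      · simpa using a.2
      · simp
    · refine Subtype.ext (((hv (1, fun _ => 0)).2 ?_).trans ?_)
      · simpa using b.2
      · simp
  · set y' : {x // W x} := ⟨y.1, hFW _ y.2⟩ with hy'
    let ι : C({x // F x}, {x // W x}) :=
      ⟨fun p => ⟨p.1, hFW _ p.2⟩, continuous_subtype_val.subtype_mk _⟩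
    let lift : GenLoop (Fin i) {x // F x} y → GenLoop (Fin i) {x // W x} y' := fun g =>
      ⟨ι.comp g.1, fun t ht => by
        have := g.2 t ht
        change ι (g.1 t) = y'
        rw [this]; rfl⟩
    refine ⟨fun a b => ?_⟩
    induction a using Quotient.inductionOn with | _ g₀
    induction b using Quotient.inductionOn with | _ g₁
    have hsub := hpi i hi1 his y'
    have hhom : GenLoop.Homotopic (lift g₀) (lift g₁) :=
      Quotient.exact (hsub.elim (Quotient.mk (GenLoop.Homotopic.setoid (Fin i) y') (lift g₀))
        (Quotient.mk (GenLoop.Homotopic.setoid (Fin i) y') (lift g₁)))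
    obtain ⟨H⟩ := hhom
    obtain ⟨v, hvc, hv⟩ := hext i his (fun p => (H p).1)
      (continuous_subtype_val.comp H.continuous) fun p => (H p).2
    have key : ∀ (p : I × (Fin i → I)) (z : {x // F x}), (H p).1 = z.1 → v p = z.1 := by
      intro p z hz
      rw [(hv p).2 (by rw [hz]; exact z.2), hz]
    refine Quotient.sound ⟨⟨⟨⟨fun p => ⟨v p, (hv p).1⟩, hvc.subtype_mk _⟩, fun t => ?_, fun t => ?_⟩,
      fun τ t ht => ?_⟩⟩
    · exact Subtype.ext (key (0, t) (g₀.1 t) (congrArg Subtype.val (H.apply_zero t)))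
    · exact Subtype.ext (key (1, t) (g₁.1 t) (congrArg Subtype.val (H.apply_one t)))
    · exact Subtype.ext (key (τ, t) (g₀.1 t) (congrArg Subtype.val (H.eq_fst τ ht)))

theorem avoidsZero_cube {i m : ℕ} (him : i + 1 < m) :
    AvoidsZero (I × (Fin i → I)) (EuclideanSpace ℝ (Fin m)) := by
  refine avoidsZero_of_retract (E := ℝ × (Fin i → ℝ))
    (j := fun p => ((p.1 : ℝ), fun l => (p.2 l : ℝ))) (by fun_prop)
    (ρ := fun p => (Set.projIcc 0 1 zero_le_one p.1, fun l => Set.projIcc 0 1 zero_le_one (p.2 l)))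
    ?_ ?_ ?_
  · refine Continuous.prodMk (continuous_projIcc.comp continuous_fst) ?_
    exact continuous_pi fun l => continuous_projIcc.comp ((continuous_apply l).comp continuous_snd)
  · intro p
    refine Prod.ext (Set.projIcc_val zero_le_one _) (funext fun l => Set.projIcc_val zero_le_one _)
  · simp only [Module.finrank_prod, Module.finrank_self, Module.finrank_fintype_fun_eq_card,
      Fintype.card_fin, finrank_euclideanSpace]
    omega

end Connectivity

section SingularLocus

variable {N k d : ℕ} {f : Fin k → MvPolynomial (Fin (N + 1)) ℂ} {h : MvPolynomial (Fin (N + 1)) ℂ}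

theorem not_linearIndependent_of_jacobianMinor_eq_zero {x : Fin (N + 1) → ℂ}
    (hx : ∀ I, eval x (jacobianMinor f I) = 0) :
    ¬ LinearIndependent ℂ fun j => pgrad (f j) x := by
  intro hli
  obtain ⟨I, hI⟩ := exists_det_ne_zero_of_linearIndependent hli
  have := hx I
  rw [eval_jacobianMinor] at this
  exact hI this

/-- On `h = 1` each line through the origin meets only finitely many points. -/
theorem finite_of_finite_projectivization (hd : 1 ≤ d) (hh : h.IsHomogeneous d)
    {V : Set (Projectivization ℂ (Fin (N + 1) → ℂ))} (hV : V.Finite)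
    {A : Set (Fin (N + 1) → ℂ)} (hA : ∀ x ∈ A, eval x h = 1)
    (hAV : ∀ x ∈ A, ∀ hx : x ≠ 0, Projectivization.mk ℂ x hx ∈ V) : A.Finite := by
  have hroots : ∀ b : ℂ, {c : ℂ | c ^ d * b = 1}.Finite := by
    intro b
    by_cases hb : b = 0
    · simp [hb]
    · refine (Polynomial.nthRoots d b⁻¹).toFinset.finite_toSet.subset fun c hc => ?_
      have hc' : c ^ d * b = 1 := hc
      rw [Finset.mem_coe, Multiset.mem_toFinset, Polynomial.mem_nthRoots hd]
      exact eq_inv_of_mul_eq_one_left hc'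
  refine (hV.biUnion fun P _ => (hroots (eval P.rep h)).image fun c => c • P.rep).subset
    fun x hx => ?_
  have hx0 : x ≠ 0 := by
    rintro rfl
    have h1 := hA 0 hx
    have h2 := hh.eval_smul_eq 0 (0 : Fin (N + 1) → ℂ)
    rw [smul_zero, h1, zero_pow (by omega), zero_mul] at h2
    exact one_ne_zero h2
  obtain ⟨c, hc⟩ := (Projectivization.mk_eq_mk_iff' ℂ x (Projectivization.mk ℂ x hx0).rep hx0
    (Projectivization.mk ℂ x hx0).rep_nonzero).1 (Projectivization.mk_rep _).symm
  refine Set.mem_biUnion (hAV x hx hx0) ⟨c, ?_, hc⟩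
  have h1 := hA x hx
  rw [← hc, hh.eval_smul_eq] at h1
  exact h1

end SingularLocus

/-- **Theorem 1 (ii).**  If `V_sing` is finite and disjoint from `H`, `d < d_j` for all `j`,
and the global Milnor fiber `F_h = {h = 1}` is `s`-connected for some `0 ≤ s ≤ n - 1`, then the
affine complete intersection `F = {f_1 = ⋯ = f_k = 0, h = 1}` is also `s`-connected. -/
theorem milnor_fiber_s_connected
    (n k N : ℕ) (hn : 1 ≤ n) (hk : 1 ≤ k) (hN : N = n + k)
    (d : ℕ) (dd : Fin k → ℕ) (hd : 1 ≤ d)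
    (f : Fin k → MvPolynomial (Fin (N + 1)) ℂ)
    (h : MvPolynomial (Fin (N + 1)) ℂ)
    (hf : ∀ j, (f j).IsHomogeneous (dd j))
    (hh : h.IsHomogeneous d)
    (Vsing Hset : Set (Projectivization ℂ (Fin (N + 1) → ℂ)))
    -- `Vsing` is the singular locus of `V`
    (hVsing : Vsing = {P | ∃ x, ∃ hx : x ≠ 0, P = Projectivization.mk ℂ x hx ∧
        (∀ j, eval x (f j) = 0) ∧
        ¬ LinearIndependent ℂ fun j => pgrad (f j) x})
    -- `Hset` is the hypersurface `H = {h = 0}`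
    (hHset : Hset = {P | ∃ x, ∃ hx : x ≠ 0, P = Projectivization.mk ℂ x hx ∧ eval x h = 0})
    -- `V_sing` is finite
    (hVsingFin : Vsing.Finite)
    -- `V_sing ∩ H = ∅`
    (hVH : Vsing ∩ Hset = ∅)
    -- `d < d_j` for all `j`
    (hdeg : ∀ j, d < dd j)
    (s : ℕ) (hs : s ≤ n - 1)
    -- the global Milnor fiber `F_h = {h = 1}` is `s`-connected
    (hFh : SConnected s {x : Fin (N + 1) → ℂ // eval x h = 1}) :
    -- the affine complete intersection `F` is `s`-connected
    SConnected s
      {x : Fin (N + 1) → ℂ // (∀ j, eval x (f j) = 0) ∧ eval x h = 1} := by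
  subst hHset hVsing
  have hreg : ∀ u : Fin (N + 1) → ℂ, u ≠ 0 → (∀ j, eval u (f j) = 0) → eval u h = 0 →
      ∃ I, eval u (jacobianMinor f I) ≠ 0 := by
    intro u hu huf huh
    by_contra! hcon
    exact (Set.eq_empty_iff_forall_notMem.1 hVH (Projectivization.mk ℂ u hu))
      ⟨⟨u, hu, rfl, huf, not_linearIndependent_of_jacobianMinor_eq_zero hcon⟩, u, hu, rfl, huh⟩
  have hfin : {x : Fin (N + 1) → ℂ | (∀ j, eval x (f j) = 0) ∧ eval x h = 1 ∧
      ∀ I, eval x (jacobianMinor f I) = 0}.Finite :=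
    finite_of_finite_projectivization hd hh hVsingFin (fun x hx => hx.2.1) fun x hx hx0 =>
      ⟨x, hx0, rfl, hx.1, not_linearIndependent_of_jacobianMinor_eq_zero hx.2.2⟩
  refine hFh.of_compression (fun x hx => hx.2) fun i hi u hu huW => ?_
  obtain ⟨v, hv, hvF⟩ := exists_map_to_commonZeros (n := n + 1) hd hh hf hdeg hreg hfin (by omega)
    (avoidsZero_cube (by omega)) hu huW
  exact ⟨v, hv, fun x => ⟨⟨(hvF x).2.1, (hvF x).1⟩, fun hx => (hvF x).2.2 hx.1⟩⟩
end
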